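/- arXiv:math/9208201 — 2 statements merged into one kernel-verified Lean document; each statement's English description precedes it below -/
import Mathlib

section
/- Let α,β>−1 and 1≤p<∞. Suppose there exists c_p>0 such that for every n∈ℕ and every real polynomial q of degree ≤n, (∫_{−1}^{1} |q(t)|^p w_{α,β}(t) dt)^{1/p} ≤ c_p·(∑_{j=1}^{n+1} λ_j |q(t_j)|^p)^{1/p}, where t_1>⋯>t_{n+1} are the zeros of p_{n+1}^{(α,β)} and λ_j the corresponding Gaussian quadrature weights. Then μ(α,β)<p<M(α,β). -/
open MeasureTheory Set Filter
open scoped ENNReal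
open scoped ENNReal

/-- The Jacobi weight `w_{α,β}(t) = (1-t)^α (1+t)^β`. -/
noncomputable def jacobiWeight (α β : ℝ) (t : ℝ) : ℝ := (1 - t) ^ α * (1 + t) ^ β

/-- The system of `L₂(I, w_{α,β})`-normalized Jacobi polynomials. -/
structure JacobiSystem (α β : ℝ) where
  P : ℕ → Polynomial ℝ
  natDegree_eq : ∀ n, (P n).natDegree = n
  leadingCoeff_pos : ∀ n, 0 < (P n).leadingCoeff
  orthonormal : ∀ n m, (∫ t in Ioo (-1:ℝ) 1,
      (P n).eval t * (P m).eval t * jacobiWeight α β t) = if n = m then 1 else 0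

/-- Zeros of `p_{n+1}^{(α,β)}` and the Gaussian quadrature weights. -/
structure JacobiNodes {α β : ℝ} (J : JacobiSystem α β) where
  node : (n : ℕ) → Fin (n + 1) → ℝ
  wt : (n : ℕ) → Fin (n + 1) → ℝ
  node_mem : ∀ n j, node n j ∈ Ioo (-1:ℝ) 1
  node_strictAnti : ∀ n, StrictAnti (node n)
  node_isZero : ∀ n j, (J.P (n + 1)).eval (node n j) = 0
  wt_pos : ∀ n j, 0 < wt n j
  quadrature : ∀ (n : ℕ) (q : Polynomial ℝ), q.natDegree ≤ 2 * n + 1 →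
    (∫ t in Ioo (-1:ℝ) 1, q.eval t * jacobiWeight α β t)
      = ∑ j : Fin (n + 1), wt n j * q.eval (node n j)


/-- `μ(α,β) = max(1, 4(α+1)/(2α+5), 4(β+1)/(2β+5))`. -/
noncomputable def muExp (α β : ℝ) : ℝ :=
  max 1 (max (4 * (α + 1) / (2 * α + 5)) (4 * (β + 1) / (2 * β + 5)))

/-- `m(α,β) = max(1, 4(α+1)/(2α+3), 4(β+1)/(2β+3))`. -/
noncomputable def mExp (α β : ℝ) : ℝ :=
  max 1 (max (4 * (α + 1) / (2 * α + 3)) (4 * (β + 1) / (2 * β + 3)))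

/-- `M(α,β)`, the conjugate exponent of `m(α,β)` (equal to `∞` when `m(α,β) = 1`),
as an extended real number. -/
noncomputable def MExp (α β : ℝ) : ℝ≥0∞ :=
  if mExp α β = 1 then ⊤ else ENNReal.ofReal (mExp α β / (mExp α β - 1))

theorem jacobiWeight_nonneg {α β t : ℝ} (ht : t ∈ Icc (-1 : ℝ) 1) : 0 ≤ jacobiWeight α β t :=
  mul_nonneg (Real.rpow_nonneg (by linarith [ht.2]) _) (Real.rpow_nonneg (by linarith [ht.1]) _)

theorem jacobiWeight_pos {α β t : ℝ} (ht : t ∈ Ioo (-1 : ℝ) 1) : 0 < jacobiWeight α β t :=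
  mul_pos (Real.rpow_pos_of_pos (by linarith [ht.2]) _)
    (Real.rpow_pos_of_pos (by linarith [ht.1]) _)

theorem continuousOn_jacobiWeight {α β : ℝ} :
    ContinuousOn (jacobiWeight α β) (Ioo (-1 : ℝ) 1) := by
  unfold jacobiWeight
  refine ContinuousOn.mul (ContinuousOn.rpow_const (by fun_prop) fun x hx => Or.inl ?_)
    (ContinuousOn.rpow_const (by fun_prop) fun x hx => Or.inl ?_)
  · have := hx.2; intro h; linarith
  · have := hx.1; intro h; linarith

theorem integrableOn_jacobiWeight {α β : ℝ} (hα : -1 < α) (hβ : -1 < β) :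
    IntegrableOn (jacobiWeight α β) (Ioo (-1 : ℝ) 1) := by
  have h1 : IntervalIntegrable (fun t : ℝ => (1 + t) ^ β * (1 - t) ^ α) volume (-1) 0 := by
    refine IntervalIntegrable.mul_continuousOn ?_ ?_
    · have := (intervalIntegral.intervalIntegrable_rpow' (a := 0) (b := 1) hβ).comp_add_left 1
      simpa using this
    · refine ContinuousOn.rpow_const (by fun_prop) fun x hx => Or.inl ?_
      rw [uIcc_of_le (by norm_num)] at hx
      have := hx.2; intro h; linarith
  have h2 : IntervalIntegrable (fun t : ℝ => (1 - t) ^ α * (1 + t) ^ β) volume 0 1 := by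
    refine IntervalIntegrable.mul_continuousOn ?_ ?_
    · have := (intervalIntegral.intervalIntegrable_rpow' (a := 1) (b := 0) hα).comp_sub_left 1
      simpa using this
    · refine ContinuousOn.rpow_const (by fun_prop) fun x hx => Or.inl ?_
      rw [uIcc_of_le (by norm_num)] at hx
      have := hx.1; intro h; linarith
  have h3 : IntervalIntegrable (jacobiWeight α β) volume (-1) 1 := by
    refine IntervalIntegrable.trans (b := 0) ?_ h2
    refine h1.congr ?_
    exact fun t _ => mul_comm _ _
  rw [intervalIntegrable_iff_integrableOn_Ioo_of_le (by norm_num)] at h3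
  exact h3

theorem integrableOn_mul_jacobiWeight {α β : ℝ} (hα : -1 < α) (hβ : -1 < β) {f : ℝ → ℝ}
    (hf : Continuous f) :
    IntegrableOn (fun t => f t * jacobiWeight α β t) (Ioo (-1 : ℝ) 1) := by
  obtain ⟨C, hC⟩ := (isCompact_Icc (a := (-1 : ℝ)) (b := 1)).exists_bound_of_continuousOn
    hf.continuousOn
  refine Integrable.bdd_mul (c := C) (integrableOn_jacobiWeight hα hβ)
    hf.aestronglyMeasurable ?_
  exact (ae_restrict_iff' measurableSet_Ioo).2
    (Eventually.of_forall fun x hx => hC x (Ioo_subset_Icc_self hx))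

open Polynomial in
/-- The Jacobi differential operator `(1 - t²) q'' + (β - α - (α + β + 2) t) q'`. -/
noncomputable def jacobiOp (α β : ℝ) (q : ℝ[X]) : ℝ[X] :=
  (1 - X ^ 2) * derivative (derivative q) + (C (β - α) - C (α + β + 2) * X) * derivative q

open Polynomial in
theorem coeff_jacobiOp (α β : ℝ) (q : ℝ[X]) (N : ℕ) :
    (jacobiOp α β q).coeff N = (N + 1) * (N + 2) * q.coeff (N + 2) +
      (β - α) * (N + 1) * q.coeff (N + 1) - N * (N + 1 + α + β) * q.coeff N := by
  have e : jacobiOp α β q = derivative (derivative q) - X ^ 2 * derivative (derivative q) +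
      C (β - α) * derivative q - C (α + β + 2) * (X * derivative q) := by
    unfold jacobiOp; ring
  rw [e, coeff_sub, coeff_add, coeff_sub, coeff_C_mul, coeff_C_mul, coeff_X_pow_mul']
  obtain _ | _ | N := N
  · simp [coeff_derivative]
    ring
  · rw [coeff_X_mul]
    simp [coeff_derivative]
    ring
  · rw [coeff_X_mul]
    simp [coeff_derivative]
    ring

open Polynomial in
theorem natDegree_jacobiOp_le (α β : ℝ) (q : ℝ[X]) :
    (jacobiOp α β q).natDegree ≤ q.natDegree := by
  rw [natDegree_le_iff_coeff_eq_zero]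
  intro N hN
  rw [coeff_jacobiOp, coeff_eq_zero_of_natDegree_lt hN,
    coeff_eq_zero_of_natDegree_lt (n := N + 1) (by omega),
    coeff_eq_zero_of_natDegree_lt (n := N + 2) (by omega)]
  ring

open Polynomial in
theorem integral_jacobiOp_symm {α β : ℝ} (hα : -1 < α) (hβ : -1 < β) (q r : ℝ[X]) :
    ∫ t in Ioo (-1 : ℝ) 1, (jacobiOp α β q * r).eval t * jacobiWeight α β t =
      ∫ t in Ioo (-1 : ℝ) 1, (q * jacobiOp α β r).eval t * jacobiWeight α β t := by
  set s : ℝ[X] := derivative q * r - q * derivative r with hs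
  set F : ℝ → ℝ := fun t => (1 - t) ^ (α + 1) * (1 + t) ^ (β + 1) * s.eval t with hF
  have hFc : ContinuousOn F (Icc (-1) 1) := by
    refine ContinuousOn.mul (ContinuousOn.mul
      (ContinuousOn.rpow_const (by fun_prop) fun x _ => Or.inr (by linarith))
      (ContinuousOn.rpow_const (by fun_prop) fun x _ => Or.inr (by linarith))) ?_
    exact s.continuous.continuousOn
  have hd : ∀ t ∈ Ioo (-1 : ℝ) 1, HasDerivAt F
      ((jacobiOp α β q * r - q * jacobiOp α β r).eval t * jacobiWeight α β t) t := by
    intro t ht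
    have e1 : 0 < 1 - t := by linarith [ht.2]
    have e2 : 0 < 1 + t := by linarith [ht.1]
    have d1 : HasDerivAt (fun t : ℝ => (1 - t) ^ (α + 1)) (-1 * (α + 1) * (1 - t) ^ (α + 1 - 1)) t :=
      ((hasDerivAt_id t).const_sub 1).rpow_const (Or.inl e1.ne')
    have d2 : HasDerivAt (fun t : ℝ => (1 + t) ^ (β + 1)) (1 * (β + 1) * (1 + t) ^ (β + 1 - 1)) t :=
      ((hasDerivAt_id t).const_add 1).rpow_const (Or.inl e2.ne')
    refine ((d1.mul d2).mul (s.hasDerivAt t)).congr_deriv ?_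
    simp only [Pi.mul_apply]
    rw [add_sub_cancel_right, add_sub_cancel_right, Real.rpow_add_one e1.ne',
      Real.rpow_add_one e2.ne', jacobiWeight, hs]
    simp only [jacobiOp, derivative_sub, derivative_mul, eval_sub, eval_add, eval_mul, eval_one,
      eval_pow, eval_X, eval_C]
    ring
  have hint : IntervalIntegrable (fun t => (jacobiOp α β q * r - q * jacobiOp α β r).eval t *
      jacobiWeight α β t) volume (-1) 1 := by
    rw [intervalIntegrable_iff_integrableOn_Ioo_of_le (by norm_num)]
    exact integrableOn_mul_jacobiWeight hα hβ (Polynomial.continuous _)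
  have hft := intervalIntegral.integral_eq_sub_of_hasDerivAt_of_le (by norm_num) hFc hd hint
  have hF1 : F 1 = 0 := by
    simp only [hF]; rw [sub_self, Real.zero_rpow (by linarith)]; simp
  have hF2 : F (-1) = 0 := by
    simp only [hF]; rw [add_neg_cancel, Real.zero_rpow (x := β + 1) (by linarith)]; simp
  rw [hF1, hF2, sub_zero, intervalIntegral.integral_of_le (by norm_num),
    integral_Ioc_eq_integral_Ioo] at hft
  rw [← sub_eq_zero, ← integral_sub
    (integrableOn_mul_jacobiWeight hα hβ (Polynomial.continuous _))
    (integrableOn_mul_jacobiWeight hα hβ (Polynomial.continuous _)), ← hft]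
  congr 1
  ext t
  simp [sub_mul]

open Polynomial in
/-- The monic polynomial of degree `n + 1` vanishing at the `n + 1` nodes. -/
noncomputable def nodePoly {α β : ℝ} {J : JacobiSystem α β} (N : JacobiNodes J) (n : ℕ) : ℝ[X] :=
  Lagrange.nodal Finset.univ (N.node n)

open Polynomial in
theorem jacobiOp_nodePoly {α β : ℝ} (hα : -1 < α) (hβ : -1 < β) {J : JacobiSystem α β}
    (N : JacobiNodes J) (n : ℕ) :
    jacobiOp α β (nodePoly N n) = C (-((n + 1) * (n + 2 + α + β))) * nodePoly N n := by
  set Q := nodePoly N n with hQ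
  have hQd : Q.natDegree = n + 1 := by simp [hQ, nodePoly, Lagrange.natDegree_nodal]
  have hQz : ∀ j, Q.eval (N.node n j) = 0 := fun j =>
    Lagrange.eval_nodal_at_node (Finset.mem_univ j)
  set R := jacobiOp α β Q - C (-((n + 1) * (n + 2 + α + β))) * Q with hR
  have hRd : R.natDegree ≤ n := by
    rw [natDegree_le_iff_coeff_eq_zero]
    intro k hk
    have h1 : Q.natDegree ≤ k := by omega
    rw [hR, coeff_sub, coeff_jacobiOp, coeff_C_mul,
      coeff_eq_zero_of_natDegree_lt (p := Q) (n := k + 1) (by omega),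
      coeff_eq_zero_of_natDegree_lt (p := Q) (n := k + 2) (by omega)]
    obtain rfl | h2 : k = n + 1 ∨ n + 1 < k := by omega
    · push_cast; ring
    · rw [coeff_eq_zero_of_natDegree_lt (p := Q) (n := k) (by omega)]; simp
  have horth : ∀ r : ℝ[X], r.natDegree ≤ n →
      ∫ t in Ioo (-1 : ℝ) 1, (Q * r).eval t * jacobiWeight α β t = 0 := by
    intro r hr
    rw [N.quadrature n (Q * r) (natDegree_mul_le.trans (by omega))]
    simp [hQz]
  have hRR : ∫ t in Ioo (-1 : ℝ) 1, (R * R).eval t * jacobiWeight α β t = 0 := by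
    have h1 := integral_jacobiOp_symm hα hβ Q R
    rw [horth (jacobiOp α β R) ((natDegree_jacobiOp_le _ _ _).trans hRd)] at h1
    have h2 := horth (C (-((n + 1) * (n + 2 + α + β))) * R)
      ((natDegree_C_mul_le _ _).trans hRd)
    rw [← sub_eq_zero.2 (h1.trans h2.symm), ← integral_sub
      (integrableOn_mul_jacobiWeight hα hβ (Polynomial.continuous _))
      (integrableOn_mul_jacobiWeight hα hβ (Polynomial.continuous _))]
    congr 1
    ext t
    rw [← sub_mul, ← eval_sub]
    congr 2
    rw [hR]
    ring
  rw [N.quadrature n (R * R) (natDegree_mul_le.trans (by omega))] at hRR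
  have hRz : ∀ j, R.eval (N.node n j) = 0 := by
    intro j
    have := (Finset.sum_eq_zero_iff_of_nonneg (fun j _ => by
      rw [eval_mul]
      exact mul_nonneg (N.wt_pos n j).le (mul_self_nonneg _))).1 hRR j (Finset.mem_univ j)
    rw [eval_mul] at this
    rcases mul_eq_zero.1 this with h | h
    · exact absurd h (N.wt_pos n j).ne'
    · exact mul_self_eq_zero.1 h
  have hR0 : R = 0 := by
    refine eq_zero_of_degree_lt_of_eval_index_eq_zero Finset.univ (v := N.node n)
      (N.node_strictAnti n).injective.injOn ?_ fun j _ => hRz j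
    refine (degree_le_of_natDegree_le hRd).trans_lt ?_
    rw [Finset.card_univ, Fintype.card_fin]
    exact_mod_cast Nat.lt_succ_self n
  exact sub_eq_zero.1 hR0

theorem wkb_approx {a b ω K ε : ℝ} (hω : 0 < ω) (hK : 0 < K)
    (hε : Real.exp (K / ω * (b - a)) - 1 ≤ ε) {u v ψ : ℝ → ℝ}
    (hu : ∀ x ∈ Icc a b, HasDerivAt u (v x) x)
    (hv : ∀ x ∈ Icc a b, HasDerivAt v (-(ω ^ 2 + ψ x) * u x) x)
    (hψ : ∀ x ∈ Icc a b, |ψ x| ≤ K) :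
    ∃ ρ φ : ℝ, 0 ≤ ρ ∧ ∀ x ∈ Icc a b,
      |u x - ρ * Real.cos (ω * x - φ)| ≤ ε * ρ ∧ |v x| ≤ (1 + ε) * (ω * ρ) := by
  set e : ℝ → ℂ := fun x => Complex.exp (Complex.I * (ω * x : ℝ)) with he
  have hed : ∀ x, HasDerivAt e (e x * (Complex.I * ω)) x := by
    intro x
    have h1 : HasDerivAt (fun x : ℝ => ((ω * x : ℝ) : ℂ)) (ω : ℂ) x := by
      have := ((hasDerivAt_id x).const_mul ω).ofReal_comp
      simpa using this
    exact (h1.const_mul Complex.I).cexp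
  have hen : ∀ x, ‖e x‖ = 1 := by
    intro x
    simp only [he]
    rw [mul_comm, Complex.norm_exp_ofReal_mul_I]
  set Z : ℝ → ℂ := fun x => ((u x : ℂ) + Complex.I * ((v x / ω : ℝ) : ℂ)) * e x with hZ
  have hZn : ∀ x, ‖Z x‖ = ‖(u x : ℂ) + Complex.I * ((v x / ω : ℝ) : ℂ)‖ := by
    intro x; simp only [hZ, norm_mul, hen, mul_one]
  have hZd : ∀ x ∈ Icc a b,
      HasDerivAt Z (-(Complex.I * ((ψ x * u x / ω : ℝ) : ℂ) * e x)) x := by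
    intro x hx
    have h1 := (hu x hx).ofReal_comp
    have h2 := (((hv x hx).div_const ω).ofReal_comp).const_mul Complex.I
    have h3 := (h1.add h2).mul (hed x)
    refine h3.congr_deriv ?_
    have : (ω : ℂ) ≠ 0 := by exact_mod_cast hω.ne'
    simp only [Pi.add_apply]
    push_cast
    field_simp
    ring_nf
    simp only [Complex.I_sq]
    ring
  have hun : ∀ x, |u x| ≤ ‖Z x‖ := by
    intro x
    rw [hZn]
    have := Complex.abs_re_le_norm ((u x : ℂ) + Complex.I * ((v x / ω : ℝ) : ℂ))
    simpa using this
  have hvn : ∀ x, |v x| ≤ ω * ‖Z x‖ := by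
    intro x
    rw [hZn]
    have := Complex.abs_im_le_norm ((u x : ℂ) + Complex.I * ((v x / ω : ℝ) : ℂ))
    have h2 : |v x / ω| ≤ ‖(u x : ℂ) + Complex.I * ((v x / ω : ℝ) : ℂ)‖ := by
      simpa using this
    rw [abs_div, abs_of_pos hω, div_le_iff₀ hω] at h2
    linarith
  have hκ : 0 < K / ω := by positivity
  have key : ∀ x ∈ Icc a b, ‖Z x - Z a‖ ≤ ε * ‖Z a‖ := by
    intro x hx
    have := norm_le_gronwallBound_of_norm_deriv_right_le (f := fun x => Z x - Z a)
      (f' := fun x => -(Complex.I * ((ψ x * u x / ω : ℝ) : ℂ) * e x)) (δ := 0) (K := K / ω)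
      (ε := K / ω * ‖Z a‖) (a := a) (b := b)
      (fun y hy => ((hZd y hy).continuousAt.sub continuousAt_const).continuousWithinAt)
      (fun y hy => ((hZd y (Ico_subset_Icc_self hy)).sub_const _).hasDerivWithinAt)
      (by simp)
      (by
        intro y hy
        have hy' := Ico_subset_Icc_self hy
        rw [norm_neg, norm_mul, norm_mul, hen, Complex.norm_I, one_mul, mul_one,
          Complex.norm_real, Real.norm_eq_abs, abs_div, abs_mul, abs_of_pos hω]
        have h1 : ‖Z y‖ ≤ ‖Z y - Z a‖ + ‖Z a‖ := by
          simpa using norm_add_le (Z y - Z a) (Z a)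
        calc |ψ y| * |u y| / ω ≤ K * ‖Z y‖ / ω := by
              gcongr
              · exact hψ y hy'
              · exact hun y
          _ = K / ω * ‖Z y‖ := by ring
          _ ≤ K / ω * (‖Z y - Z a‖ + ‖Z a‖) := by gcongr
          _ = _ := by ring) x hx
    refine this.trans ?_
    rw [gronwallBound_of_K_ne_0 hκ.ne']
    simp only [zero_mul, zero_add]
    have h3 : K / ω * ‖Z a‖ / (K / ω) = ‖Z a‖ := by field_simp
    rw [h3, mul_comm]
    gcongr
    refine le_trans ?_ hε
    gcongr
    exact hx.2
  refine ⟨‖Z a‖, (Z a).arg, norm_nonneg _, fun x hx => ⟨?_, ?_⟩⟩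
  · have h1 : (u x : ℂ) + Complex.I * ((v x / ω : ℝ) : ℂ)
        = Z x * Complex.exp (-(Complex.I * (ω * x : ℝ))) := by
      simp only [hZ, he]
      rw [mul_assoc, ← Complex.exp_add]; simp
    have h2 : u x = (Z x * Complex.exp (-(Complex.I * (ω * x : ℝ)))).re := by
      rw [← h1]; simp
    have h3 : ‖Z a‖ * Real.cos (ω * x - (Z a).arg)
        = (Z a * Complex.exp (-(Complex.I * (ω * x : ℝ)))).re := by
      conv_rhs => rw [← Complex.norm_mul_exp_arg_mul_I (Z a)]
      rw [mul_assoc, ← Complex.exp_add, Complex.re_ofReal_mul]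
      have : ((Z a).arg : ℂ) * Complex.I + -(Complex.I * ((ω * x : ℝ) : ℂ))
          = ((-(ω * x - (Z a).arg) : ℝ) : ℂ) * Complex.I := by
        push_cast; ring
      rw [this, Complex.exp_ofReal_mul_I_re, Real.cos_neg]
    rw [h2, h3, ← Complex.sub_re, ← sub_mul]
    refine (Complex.abs_re_le_norm _).trans ?_
    rw [norm_mul]
    have h4 : ‖Complex.exp (-(Complex.I * ((ω * x : ℝ) : ℂ)))‖ = 1 := by
      have : -(Complex.I * ((ω * x : ℝ) : ℂ)) = ((-(ω * x) : ℝ) : ℂ) * Complex.I := by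
        push_cast; ring
      rw [this, Complex.norm_exp_ofReal_mul_I]
    rw [h4, mul_one]
    exact key x hx
  · have h1 : ‖Z x‖ ≤ ‖Z x - Z a‖ + ‖Z a‖ := by
      simpa using norm_add_le (Z x - Z a) (Z a)
    calc |v x| ≤ ω * ‖Z x‖ := hvn x
      _ ≤ ω * ((1 + ε) * ‖Z a‖) := by
        gcongr
        linarith [key x hx]
      _ = _ := by ring

theorem exists_zeros_of_approx_cos {c d ω φ ρ : ℝ} (hω : 0 < ω) (hρ : 0 < ρ)
    {u : ℝ → ℝ} (hu : ContinuousOn u (Icc c d))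
    (h : ∀ x ∈ Icc c d, |u x - ρ * Real.cos (ω * x - φ)| ≤ 1 / 10 * ρ) :
    ∃ S : Finset ℝ, (∀ x ∈ S, x ∈ Icc c d ∧ u x = 0) ∧
      (d - c) * ω / Real.pi - 2 ≤ (S.card : ℝ) := by
  have hpi := Real.pi_pos
  set j0 : ℤ := ⌈(c * ω - φ) / Real.pi⌉ with hj0
  set j1 : ℤ := ⌊(d * ω - φ) / Real.pi⌋ with hj1
  set X : ℤ → ℝ := fun j => (j * Real.pi + φ) / ω with hX
  have hXmono : StrictMono X := by
    intro i j hij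
    have : (i : ℝ) < j := by exact_mod_cast hij
    simp only [hX]
    gcongr
  have hX0 : c ≤ X j0 := by
    have := Int.le_ceil ((c * ω - φ) / Real.pi)
    rw [div_le_iff₀ hpi] at this
    simp only [hX]
    rw [le_div_iff₀ hω]
    linarith
  have hX1 : X j1 ≤ d := by
    have := Int.floor_le ((d * ω - φ) / Real.pi)
    rw [le_div_iff₀ hpi] at this
    simp only [hX]
    rw [div_le_iff₀ hω]
    linarith
  have hcos : ∀ j : ℤ, Real.cos (ω * X j - φ) = (-1) ^ j := by
    intro j
    have : ω * X j - φ = j * Real.pi := by simp only [hX]; field_simp; ring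
    rw [this, Real.cos_int_mul_pi]
  have hz : ∀ j ∈ Finset.Ico j0 j1, ∃ z ∈ Ioo (X j) (X (j + 1)), u z = 0 := by
    intro j hj
    rw [Finset.mem_Ico] at hj
    have hlt : X j < X (j + 1) := hXmono (by omega)
    have hjl : c ≤ X j := hX0.trans (hXmono.monotone hj.1)
    have hjr : X (j + 1) ≤ d := (hXmono.monotone (by omega)).trans hX1
    have hsub : Icc (X j) (X (j + 1)) ⊆ Icc c d := Icc_subset_Icc hjl hjr
    have ha := h (X j) (hsub (left_mem_Icc.2 hlt.le))
    have hb := h (X (j + 1)) (hsub (right_mem_Icc.2 hlt.le))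
    rw [hcos, abs_le] at ha hb
    rw [zpow_add_one₀ (by norm_num)] at hb
    rcases Int.even_or_odd j with hev | hodd
    · rw [hev.neg_one_zpow] at ha hb
      have := intermediate_value_Ioo' hlt.le (hu.mono hsub)
      exact this ⟨by linarith, by linarith⟩
    · rw [hodd.neg_one_zpow] at ha hb
      have := intermediate_value_Ioo hlt.le (hu.mono hsub)
      exact this ⟨by linarith, by linarith⟩
  choose! z hz1 hz2 using hz
  have hinj : Set.InjOn z (Finset.Ico j0 j1 : Finset ℤ) := by
    intro i hi j hj hij
    have h1 := hz1 i hi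
    have h2 := hz1 j hj
    rw [hij] at h1
    have h3 : i < j + 1 := hXmono.lt_iff_lt.1 (h1.1.trans h2.2)
    have h4 : j < i + 1 := hXmono.lt_iff_lt.1 (h2.1.trans h1.2)
    omega
  refine ⟨(Finset.Ico j0 j1).image z, ?_, ?_⟩
  · intro x hx
    obtain ⟨j, hj, rfl⟩ := Finset.mem_image.1 hx
    have h1 := hz1 j hj
    refine ⟨⟨?_, ?_⟩, hz2 j hj⟩
    · rw [Finset.mem_Ico] at hj
      exact (hX0.trans (hXmono.monotone hj.1)).trans h1.1.le
    · rw [Finset.mem_Ico] at hj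
      exact h1.2.le.trans ((hXmono.monotone (by omega)).trans hX1)
  · rw [Finset.card_image_of_injOn hinj, Int.card_Ico]
    have h1 : ((j1 - j0 : ℤ) : ℝ) ≤ ((j1 - j0).toNat : ℝ) := by
      exact_mod_cast Int.self_le_toNat _
    push_cast at h1
    have h2 := Int.ceil_lt_add_one ((c * ω - φ) / Real.pi)
    have h3 := Int.sub_one_lt_floor ((d * ω - φ) / Real.pi)
    have h4 : (d - c) * ω / Real.pi = (d * ω - φ) / Real.pi - (c * ω - φ) / Real.pi := by ring
    rw [h4]
    linarith

theorem rpow_ge_quadratic {p x : ℝ} (hp : 0 ≤ p) (hx : |x| ≤ 2) :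
    (1 / 4 : ℝ) ^ p * ((x ^ 2 - 1 / 16) / 4) ≤ |x| ^ p := by
  have h4 : 0 ≤ (1 / 4 : ℝ) ^ p := by positivity
  have hx2 : x ^ 2 ≤ 4 := by rw [← sq_abs]; nlinarith [abs_nonneg x]
  rcases le_total (1 / 4) |x| with h | h
  · calc (1 / 4 : ℝ) ^ p * ((x ^ 2 - 1 / 16) / 4) ≤ (1 / 4 : ℝ) ^ p * 1 := by
          gcongr; linarith
      _ ≤ |x| ^ p := by rw [mul_one]; gcongr
  · have : x ^ 2 ≤ 1 / 16 := by rw [← sq_abs]; nlinarith [abs_nonneg x]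
    refine le_trans (mul_nonpos_of_nonneg_of_nonpos h4 (by linarith)) (by positivity)

theorem eventually_integral_mul_cos_le {a b : ℝ} (hab : a ≤ b) {h : ℝ → ℝ}
    {δ : ℝ} (hδ : 0 < δ) (hh : ContinuousOn h (Icc a b)) :
    ∀ᶠ ω in atTop, ∀ φ : ℝ, |∫ x in a..b, h x * Real.cos (2 * (ω * x - φ))| ≤ δ := by
  set f : ℝ → ℂ := (Ioc a b).indicator (fun x => (h x : ℂ)) with hf
  have h1 := Real.tendsto_integral_exp_smul_cocompact f
  have h2 : Tendsto (fun ω : ℝ => ω / Real.pi) atTop (cocompact ℝ) :=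
    (tendsto_id.atTop_div_const Real.pi_pos).mono_right atTop_le_cocompact
  have h3 := (h1.comp h2).norm
  simp only [norm_zero] at h3
  filter_upwards [h3.eventually (gt_mem_nhds hδ)] with ω hω φ
  refine le_trans ?_ hω.le
  simp only [Function.comp_apply]
  have hint : IntervalIntegrable h volume a b :=
    (hh.mono (by rw [uIcc_of_le hab])).intervalIntegrable
  have e1 : (∫ v : ℝ, Real.fourierChar (-(v * (ω / Real.pi))) • f v)
      = ∫ v in a..b, Complex.exp (-(2 * ω * v : ℝ) * Complex.I) * (h v : ℂ) := by
    rw [intervalIntegral.integral_of_le hab, ← integral_indicator measurableSet_Ioc]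
    congr 1
    ext v
    by_cases hv : v ∈ Ioc a b
    · simp only [hf, indicator_of_mem hv]
      rw [Circle.smul_def, Real.fourierChar_apply, smul_eq_mul]
      congr 2
      push_cast
      have : (Real.pi : ℂ) ≠ 0 := by exact_mod_cast Real.pi_ne_zero
      field_simp
    · simp [hf, indicator_of_notMem hv]
  have e2 : ((∫ x in a..b, h x * Real.cos (2 * (ω * x - φ)) : ℝ))
      = (Complex.exp ((2 * φ : ℝ) * Complex.I) *
        ∫ v in a..b, Complex.exp (-(2 * ω * v : ℝ) * Complex.I) * (h v : ℂ)).re := by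
    rw [← intervalIntegral.integral_const_mul]
    have hci : IntervalIntegrable (fun v : ℝ => Complex.exp ((2 * φ : ℝ) * Complex.I) *
        (Complex.exp (-(2 * ω * v : ℝ) * Complex.I) * (h v : ℂ))) volume a b := by
      apply ContinuousOn.intervalIntegrable
      rw [uIcc_of_le hab]
      have : ContinuousOn (fun v => (h v : ℂ)) (Icc a b) :=
        Complex.continuous_ofReal.comp_continuousOn hh
      fun_prop
    have := Complex.reCLM.intervalIntegral_comp_comm hci
    simp only [Complex.reCLM_apply] at this
    rw [← this]
    congr 1
    ext x
    rw [← mul_assoc, ← Complex.exp_add]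
    have e3 : ((2 * φ : ℝ) : ℂ) * Complex.I + -((2 * ω * x : ℝ) : ℂ) * Complex.I
        = ((-(2 * (ω * x - φ)) : ℝ) : ℂ) * Complex.I := by push_cast; ring
    rw [e3, mul_comm, Complex.re_mul_ofReal, Complex.exp_ofReal_mul_I_re, Real.cos_neg, mul_comm]
  rw [e2, e1]
  refine (Complex.abs_re_le_norm _).trans ?_
  rw [norm_mul, Complex.norm_exp_ofReal_mul_I, one_mul]

theorem eventually_integral_rpow_approx_cos_ge {a b p : ℝ} (hab : a ≤ b) (hp : 0 ≤ p)
    {h : ℝ → ℝ} (hh : ContinuousOn h (Icc a b)) (h0 : ∀ x ∈ Icc a b, 0 ≤ h x) :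
    ∀ᶠ ω in atTop, ∀ (φ : ℝ) (y : ℝ → ℝ), ContinuousOn y (Icc a b) →
      (∀ x ∈ Icc a b, |y x - Real.cos (ω * x - φ)| ≤ 1 / 10) →
      (1 / 4 : ℝ) ^ p / 25 * ∫ x in a..b, h x ≤ ∫ x in a..b, h x * |y x| ^ p := by
  have hI0 : 0 ≤ ∫ x in a..b, h x := intervalIntegral.integral_nonneg hab h0
  have hnn : ∀ y : ℝ → ℝ, 0 ≤ ∫ x in a..b, h x * |y x| ^ p := fun y =>
    intervalIntegral.integral_nonneg hab fun x hx => mul_nonneg (h0 x hx) (by positivity)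
  rcases hI0.eq_or_lt with hI | hI
  · refine Eventually.of_forall fun ω φ y _ _ => ?_
    rw [← hI, mul_zero]; exact hnn y
  filter_upwards [eventually_integral_mul_cos_le hab (by positivity :
    0 < (∫ x in a..b, h x) / 20) hh] with ω hω φ y hy hyc
  have hint : ∀ k : ℝ → ℝ, ContinuousOn k (Icc a b) → IntervalIntegrable k volume a b :=
    fun k hk => (hk.mono (by rw [uIcc_of_le hab])).intervalIntegrable
  have hcosc : ContinuousOn (fun x => Real.cos (2 * (ω * x - φ))) (Icc a b) := by fun_prop
  have step : ∫ x in a..b, (1 / 4 : ℝ) ^ p *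
      ((19 / 80) / 4 * h x + 1 / 8 * (h x * Real.cos (2 * (ω * x - φ))))
      ≤ ∫ x in a..b, h x * |y x| ^ p := by
    apply intervalIntegral.integral_mono_on hab
    · apply hint
      fun_prop
    · apply hint
      exact hh.mul (hy.abs.rpow_const fun x _ => Or.inr hp)
    · intro x hx
      have hc := Real.cos_le_one (ω * x - φ)
      have hc' := Real.neg_one_le_cos (ω * x - φ)
      have hyx := abs_le.1 (hyc x hx)
      have hy2 : |y x| ≤ 2 := abs_le.2 ⟨by linarith, by linarith⟩
      have h1 := rpow_ge_quadratic hp hy2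
      have h2 : (19 / 80 : ℝ) / 4 + 1 / 8 * Real.cos (2 * (ω * x - φ)) ≤
          ((y x) ^ 2 - 1 / 16) / 4 := by
        rw [Real.cos_two_mul]
        set C := Real.cos (ω * x - φ)
        nlinarith [sq_nonneg (y x - C)]
      calc _ = h x * ((1 / 4 : ℝ) ^ p * ((19 / 80 : ℝ) / 4 +
            1 / 8 * Real.cos (2 * (ω * x - φ)))) := by ring
        _ ≤ h x * ((1 / 4 : ℝ) ^ p * (((y x) ^ 2 - 1 / 16) / 4)) := by
            have := h0 x hx
            gcongr
        _ ≤ _ := mul_le_mul_of_nonneg_left h1 (h0 x hx)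
  refine le_trans ?_ step
  rw [intervalIntegral.integral_const_mul, intervalIntegral.integral_add,
    intervalIntegral.integral_const_mul, intervalIntegral.integral_const_mul, div_mul_eq_mul_div,
    mul_div_assoc]
  · have := (abs_le.1 (hω φ)).1
    gcongr
    linarith
  · apply hint; fun_prop
  · apply hint; fun_prop

/-- The frequency `√((n + 1) (n + 2 + α + β))` of the degree `n + 1` Jacobi polynomial. -/
noncomputable def jacobiFreq (α β : ℝ) (n : ℕ) : ℝ := √((n + 1) * (n + 2 + α + β))

theorem jacobiFreq_sq {α β : ℝ} (hα : -1 < α) (hβ : -1 < β) (n : ℕ) :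
    jacobiFreq α β n ^ 2 = (n + 1) * (n + 2 + α + β) := by
  have : (0 : ℝ) ≤ n := n.cast_nonneg
  exact Real.sq_sqrt (mul_nonneg (by linarith) (by linarith))

theorem tendsto_jacobiFreq (α β : ℝ) :
    Tendsto (jacobiFreq α β) atTop atTop := by
  refine Real.tendsto_sqrt_atTop.comp (Tendsto.atTop_mul_atTop₀ ?_ ?_)
  · exact tendsto_atTop_add_const_right _ _ tendsto_natCast_atTop_atTop
  · simp only [add_assoc]
    exact tendsto_atTop_add_const_right _ _ tendsto_natCast_atTop_atTop

theorem hasDerivAt_jacobiWeight_cos {γ δ θ : ℝ} (hθ : θ ∈ Ioo 0 Real.pi) :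
    HasDerivAt (fun x => jacobiWeight γ δ (Real.cos x))
      (jacobiWeight γ δ (Real.cos θ) * (((γ - δ) + (γ + δ) * Real.cos θ) / Real.sin θ)) θ := by
  have hs : 0 < Real.sin θ := Real.sin_pos_of_mem_Ioo hθ
  have hsq := Real.sin_sq_add_cos_sq θ
  have hc1 : 0 < 1 - Real.cos θ := by nlinarith [Real.neg_one_le_cos θ, Real.cos_le_one θ]
  have hc2 : 0 < 1 + Real.cos θ := by nlinarith [Real.neg_one_le_cos θ, Real.cos_le_one θ]
  have d1 := ((Real.hasDerivAt_cos θ).const_sub 1).rpow_const (p := γ) (Or.inl hc1.ne')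
  have d2 := ((Real.hasDerivAt_cos θ).const_add 1).rpow_const (p := δ) (Or.inl hc2.ne')
  refine (d1.mul d2).congr_deriv ?_
  rw [Real.rpow_sub_one hc1.ne', Real.rpow_sub_one hc2.ne', jacobiWeight]
  have hsn := hs.ne'
  have h1 := hc1.ne'
  have h2 := hc2.ne'
  field_simp
  have : Real.sin θ ^ 2 = (1 - Real.cos θ) * (1 + Real.cos θ) := by linarith
  rw [this]
  ring

open Polynomial in
theorem eventually_nodePoly_approx {α β : ℝ} (hα : -1 < α) (hβ : -1 < β) {J : JacobiSystem α β}
    (N : JacobiNodes J) {a b : ℝ} (ha : 0 < a) (hab : a < b) (hb : b < Real.pi) :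
    ∀ᶠ n in atTop, ∃ ρ φ : ℝ, 0 < ρ ∧ ∀ x ∈ Icc a b,
      |jacobiWeight (α / 2 + 1 / 4) (β / 2 + 1 / 4) (Real.cos x) *
        (nodePoly N n).eval (Real.cos x) - ρ * Real.cos (jacobiFreq α β n * x - φ)|
          ≤ 1 / 10 * ρ ∧
      ((nodePoly N n).eval (Real.cos x) = 0 →
        jacobiWeight (α / 2 + 1 / 4) (β / 2 + 1 / 4) (Real.cos x) *
          (Real.sin x * |(derivative (nodePoly N n)).eval (Real.cos x)|)
            ≤ 2 * (jacobiFreq α β n * ρ)) := by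
  set g : ℝ → ℝ := fun x => jacobiWeight (α / 2 + 1 / 4) (β / 2 + 1 / 4) (Real.cos x) with hg
  set B : ℝ → ℝ := fun x => ((α - β) / 2 + (α + β + 1) / 2 * Real.cos x) / Real.sin x with hB
  set B' : ℝ → ℝ := fun x => (-((α + β + 1) / 2 * Real.sin x) * Real.sin x -
    ((α - β) / 2 + (α + β + 1) / 2 * Real.cos x) * Real.cos x) / Real.sin x ^ 2 with hB'
  have hmem : ∀ x ∈ Icc a b, x ∈ Ioo 0 Real.pi := fun x hx =>
    ⟨ha.trans_le hx.1, hx.2.trans_lt hb⟩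
  have hsin : ∀ x ∈ Icc a b, 0 < Real.sin x := fun x hx => Real.sin_pos_of_mem_Ioo (hmem x hx)
  have hgpos : ∀ x ∈ Icc a b, 0 < g x := by
    intro x hx
    apply jacobiWeight_pos
    have := hsin x hx
    have hsq := Real.sin_sq_add_cos_sq x
    constructor <;> nlinarith [Real.neg_one_le_cos x, Real.cos_le_one x]
  have hgd : ∀ x ∈ Icc a b, HasDerivAt g (g x * B x) x := by
    intro x hx
    refine (hasDerivAt_jacobiWeight_cos (hmem x hx)).congr_deriv ?_
    simp only [hg, hB]
    ring
  have hBd : ∀ x ∈ Icc a b, HasDerivAt B (B' x) x := by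
    intro x hx
    refine ((((Real.hasDerivAt_cos x).const_mul _).const_add _).div (Real.hasDerivAt_sin x)
      (hsin x hx).ne').congr_deriv ?_
    simp only [hB']
    ring
  have hψc : ContinuousOn (fun x => -(B' x + B x ^ 2)) (Icc a b) := by
    have h1 : ∀ x ∈ Icc a b, Real.sin x ≠ 0 := fun x hx => (hsin x hx).ne'
    have h2 : ∀ x ∈ Icc a b, Real.sin x ^ 2 ≠ 0 := fun x hx => pow_ne_zero _ (h1 x hx)
    simp only [hB, hB']
    fun_prop (disch := assumption)
  obtain ⟨K, hK⟩ := isCompact_Icc.exists_bound_of_continuousOn hψc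
  have hlim : Tendsto (fun n => Real.exp ((|K| + 1) / jacobiFreq α β n * (b - a)) - 1)
      atTop (nhds 0) := by
    have h1 : Tendsto (fun n => (|K| + 1) / jacobiFreq α β n * (b - a)) atTop (nhds 0) := by
      simpa using ((tendsto_jacobiFreq α β).const_div_atTop (|K| + 1)).mul_const (b - a)
    have h2 := (Real.continuous_exp.tendsto 0).comp h1
    simpa using h2.sub_const 1
  filter_upwards [hlim.eventually (gt_mem_nhds (by norm_num : (0 : ℝ) < 1 / 10)),
    (tendsto_jacobiFreq α β).eventually_gt_atTop 0] with n hn hω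
  set Q := nodePoly N n with hQ
  set ω := jacobiFreq α β n with hωdef
  have hode : ∀ c : ℝ, (1 - c ^ 2) * (derivative (derivative Q)).eval c +
      (β - α - (α + β + 2) * c) * (derivative Q).eval c = -ω ^ 2 * Q.eval c := by
    intro c
    have := congrArg (Polynomial.eval c) (jacobiOp_nodePoly hα hβ N n)
    simp only [jacobiOp, eval_add, eval_mul, eval_sub, eval_one, eval_pow, eval_X, eval_C] at this
    rw [this, hωdef, jacobiFreq_sq hα hβ]
  have hyd : ∀ x, HasDerivAt (fun x => Q.eval (Real.cos x))
      (-Real.sin x * (derivative Q).eval (Real.cos x)) x := by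
    intro x
    refine ((Q.hasDerivAt (Real.cos x)).comp x (Real.hasDerivAt_cos x)).congr_deriv ?_
    ring
  have hyd' : ∀ x, HasDerivAt (fun x => -Real.sin x * (derivative Q).eval (Real.cos x))
      (-Real.cos x * (derivative Q).eval (Real.cos x) +
        Real.sin x ^ 2 * (derivative (derivative Q)).eval (Real.cos x)) x := by
    intro x
    refine ((Real.hasDerivAt_sin x).neg.mul (((derivative Q).hasDerivAt (Real.cos x)).comp x
      (Real.hasDerivAt_cos x))).congr_deriv ?_
    simp only [Function.comp_apply, Pi.neg_apply]
    ring
  obtain ⟨ρ, φ, hρ, hmain⟩ := wkb_approx (u := fun x => g x * Q.eval (Real.cos x))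
    (v := fun x => g x * (-Real.sin x * (derivative Q).eval (Real.cos x) +
      B x * Q.eval (Real.cos x))) (ψ := fun x => -(B' x + B x ^ 2)) (a := a) (b := b)
    (ω := ω) (K := |K| + 1) (ε := 1 / 10) hω (by positivity) hn.le
    (by
      intro x hx
      refine ((hgd x hx).mul (hyd x)).congr_deriv ?_
      ring)
    (by
      intro x hx
      refine ((hgd x hx).mul ((hyd' x).add ((hBd x hx).mul (hyd x)))).congr_deriv ?_
      have h1 := hode (Real.cos x)
      have h2 : 1 - Real.cos x ^ 2 = Real.sin x ^ 2 := by
        linarith [Real.sin_sq_add_cos_sq x]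
      have h3 : B x * Real.sin x = (α - β) / 2 + (α + β + 1) / 2 * Real.cos x := by
        simp only [hB]
        exact div_mul_cancel₀ _ (hsin x hx).ne'
      rw [h2] at h1
      simp only [Pi.add_apply, Pi.mul_apply]
      linear_combination g x * h1 - 2 * g x * (derivative Q).eval (Real.cos x) * h3)
    (by
      intro x hx
      exact (hK x hx).trans ((le_abs_self K).trans (by linarith)))
  have hρ' : ρ ≠ 0 := by
    rintro rfl
    have hz : ∀ x ∈ Icc a b, Q.eval (Real.cos x) = 0 := by
      intro x hx
      have := (hmain x hx).1
      simp only [zero_mul, sub_zero, mul_zero, abs_nonpos_iff] at this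
      exact (mul_eq_zero.1 this).resolve_left (hgpos x hx).ne'
    have hinf : (Real.cos '' Icc a b).Infinite := by
      refine (Icc_infinite hab).image (Real.injOn_cos.mono fun x hx => ?_)
      exact Ioo_subset_Icc_self (hmem x hx)
    have hQ0 : Q = 0 := Polynomial.eq_zero_of_infinite_isRoot Q
      (hinf.mono (by rintro _ ⟨x, hx, rfl⟩; exact hz x hx))
    have : Q.Monic := Lagrange.nodal_monic
    exact this.ne_zero hQ0
  refine ⟨ρ, φ, lt_of_le_of_ne hρ hρ'.symm, fun x hx => ⟨(hmain x hx).1, fun h0 => ?_⟩⟩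
  have h1 := (hmain x hx).2
  simp only [h0, mul_zero, add_zero] at h1
  rw [abs_mul, abs_mul, abs_neg, abs_of_pos (hgpos x hx), abs_of_pos (hsin x hx)] at h1
  refine h1.trans ?_
  have : 0 ≤ ω * ρ := by positivity
  linarith

open Polynomial in
theorem eventually_sum_wt_le {α β : ℝ} (hα : -1 < α) (hβ : -1 < β) {J : JacobiSystem α β}
    (N : JacobiNodes J) {c' c d d' : ℝ} (h1 : -1 ≤ c') (h2 : c' < c) (h3 : c < d) (h4 : d < d')
    (h5 : d' ≤ 1) :
    ∀ᶠ n in atTop, ∑ j with N.node n j ∈ Icc c d, N.wt n j ≤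
      2 * ∫ t in c'..d', jacobiWeight α β t := by
  have hsub : Ioo c' d' ⊆ Ioo (-1 : ℝ) 1 := Ioo_subset_Ioo h1 h5
  have hcd' : c' < d' := by linarith
  have hw := integrableOn_jacobiWeight hα hβ
  have hI : 0 < ∫ t in c'..d', jacobiWeight α β t := by
    apply intervalIntegral.intervalIntegral_pos_of_pos_on
    · rw [intervalIntegrable_iff_integrableOn_Ioo_of_le hcd'.le]
      exact hw.mono_set hsub
    · intro x hx; exact jacobiWeight_pos (hsub hx)
    · exact hcd'
  set I := ∫ t in c'..d', jacobiWeight α β t with hIdef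
  set W := ∫ t in Ioo (-1 : ℝ) 1, jacobiWeight α β t with hWdef
  have hW : 0 ≤ W := setIntegral_nonneg measurableSet_Ioo fun x hx =>
    jacobiWeight_nonneg (Ioo_subset_Icc_self hx)
  obtain ⟨g, hg0, hg1, hg01⟩ := exists_continuous_zero_one_of_isClosed
    (isOpen_Ioo (a := c') (b := d')).isClosed_compl (isClosed_Icc (a := c) (b := d)) (by
      rw [Set.disjoint_left]
      intro x hx hx'
      exact hx ⟨h2.trans_le hx'.1, hx'.2.trans_lt h4⟩)
  set η := I / (2 * (W + 1)) with hη
  have hηpos : 0 < η := by positivity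
  obtain ⟨r, hr⟩ := exists_polynomial_near_of_continuousOn (-1) 1 g g.continuous.continuousOn η
    hηpos
  filter_upwards [eventually_ge_atTop r.natDegree] with n hn
  have hq := N.quadrature n (r + C η) (by
    refine (natDegree_add_le _ _).trans ?_
    rw [natDegree_C]
    omega)
  have hlow : ∀ x ∈ Icc (-1 : ℝ) 1, g x ≤ (r + C η).eval x := by
    intro x hx
    have := (abs_lt.1 (hr x hx)).1
    simp only [eval_add, eval_C]
    linarith
  have hup : ∀ x ∈ Icc (-1 : ℝ) 1, (r + C η).eval x ≤ g x + 2 * η := by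
    intro x hx
    have := (abs_lt.1 (hr x hx)).2
    simp only [eval_add, eval_C]
    linarith
  calc ∑ j with N.node n j ∈ Icc c d, N.wt n j
      ≤ ∑ j with N.node n j ∈ Icc c d, N.wt n j * (r + C η).eval (N.node n j) := by
        refine Finset.sum_le_sum fun j hj => ?_
        rw [Finset.mem_filter] at hj
        have e1 := hlow _ (Ioo_subset_Icc_self (N.node_mem n j))
        rw [hg1 hj.2] at e1
        exact le_mul_of_one_le_right (N.wt_pos n j).le e1
    _ ≤ ∑ j, N.wt n j * (r + C η).eval (N.node n j) := by
        refine Finset.sum_le_sum_of_subset_of_nonneg (Finset.filter_subset _ _) fun j _ _ => ?_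
        have e1 := hlow _ (Ioo_subset_Icc_self (N.node_mem n j))
        exact mul_nonneg (N.wt_pos n j).le ((hg01 _).1.trans e1)
    _ = ∫ t in Ioo (-1 : ℝ) 1, (r + C η).eval t * jacobiWeight α β t := hq.symm
    _ ≤ ∫ t in Ioo (-1 : ℝ) 1, ((Ioo c' d').indicator (jacobiWeight α β) t +
          2 * η * jacobiWeight α β t) := by
        refine setIntegral_mono_on (integrableOn_mul_jacobiWeight hα hβ (Polynomial.continuous _))
          ((hw.indicator measurableSet_Ioo).add (hw.const_mul _)) measurableSet_Ioo fun x hx => ?_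
        have hx' := Ioo_subset_Icc_self hx
        have hwx := jacobiWeight_nonneg (α := α) (β := β) hx'
        have e2 : g x * jacobiWeight α β x ≤ (Ioo c' d').indicator (jacobiWeight α β) x := by
          by_cases hxc : x ∈ Ioo c' d'
          · rw [indicator_of_mem hxc]
            exact mul_le_of_le_one_left hwx (hg01 x).2
          · rw [indicator_of_notMem hxc, hg0 hxc]
            simp
        nlinarith [hup x hx']
    _ = I + 2 * η * W := by
        rw [integral_add (hw.indicator measurableSet_Ioo) (hw.const_mul _),
          integral_indicator measurableSet_Ioo, Measure.restrict_restrict measurableSet_Ioo,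
          inter_eq_left.2 hsub, integral_const_mul, hIdef,
          intervalIntegral.integral_of_le hcd'.le, integral_Ioc_eq_integral_Ioo]
    _ ≤ 2 * I := by
        have : 2 * η * (W + 1) = I := by
          rw [hη]; field_simp
        nlinarith

open Polynomial in
theorem integral_le_of_marcinkiewicz_zygmund {α β : ℝ} (hα : -1 < α) (hβ : -1 < β)
    {J : JacobiSystem α β} (N : JacobiNodes J) {p cp : ℝ} (hp : 1 ≤ p) (hcp : 0 < cp)
    (hineq : ∀ n : ℕ, ∀ q : Polynomial ℝ, q.natDegree ≤ n →
      (∫ t in Ioo (-1:ℝ) 1, |q.eval t| ^ p * jacobiWeight α β t) ^ (1 / p)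
        ≤ cp * (∑ j : Fin (n + 1), N.wt n j * |q.eval (N.node n j)| ^ p) ^ (1 / p))
    (n : ℕ) (S : Finset (Fin (n + 1))) {e f : ℝ} (he : -1 < e) (hef : e ≤ f) (hf : f < 1)
    (hS : (∀ k ∈ S, N.node n k < e) ∨ (∀ k ∈ S, f < N.node n k)) :
    ∫ t in e..f, (|(nodePoly N n).eval t| * ∑ k ∈ S,
      |(derivative (nodePoly N n)).eval (N.node n k)|⁻¹ * |t - N.node n k|⁻¹) ^ p *
        jacobiWeight α β t ≤ cp ^ p * ∑ k ∈ S, N.wt n k := by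
  have hp0 : 0 < p := by linarith
  set v := N.node n with hv
  set nw := Lagrange.nodalWeight Finset.univ v with hnw
  have hinj : Set.InjOn v (Finset.univ : Finset (Fin (n + 1))) :=
    (N.node_strictAnti n).injective.injOn
  set r : Fin (n + 1) → ℝ := fun k => if k ∈ S then (SignType.sign (nw k) : ℝ) else 0 with hr
  set q := Lagrange.interpolate Finset.univ v r with hq
  have hqd : q.natDegree ≤ n := by
    have h1 : q.degree < _ := Lagrange.degree_interpolate_lt r hinj
    rw [Finset.card_univ, Fintype.card_fin] at h1
    exact natDegree_le_iff_coeff_eq_zero.2 fun k hk =>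
      coeff_eq_zero_of_degree_lt (h1.trans_le (by exact_mod_cast hk))
  have hqn : ∀ k, q.eval (v k) = r k := fun k =>
    Lagrange.eval_interpolate_at_node r hinj (Finset.mem_univ k)
  have hnwd : ∀ k, nw k = ((derivative (nodePoly N n)).eval (v k))⁻¹ := fun k =>
    Lagrange.nodalWeight_eq_eval_derivative_nodal (Finset.mem_univ k)
  have heval : ∀ t ∈ Icc e f, |q.eval t| = |(nodePoly N n).eval t| * ∑ k ∈ S,
      |(derivative (nodePoly N n)).eval (v k)|⁻¹ * |t - v k|⁻¹ := by
    intro t ht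
    by_cases hex : ∃ k, t = v k
    · obtain ⟨k, rfl⟩ := hex
      have hk : k ∉ S := by
        intro hk
        rcases hS with h | h
        · exact absurd (h k hk) (not_lt.2 ht.1)
        · exact absurd (h k hk) (not_lt.2 ht.2)
      have h0 : (nodePoly N n).eval (v k) = 0 := Lagrange.eval_nodal_at_node (Finset.mem_univ k)
      rw [hqn, h0]
      simp [hr, hk]
    · push Not at hex
      rw [hq, Lagrange.eval_interpolate_not_at_node r fun i _ => hex i, abs_mul]
      congr 1
      have h1 : ∀ i, Lagrange.nodalWeight Finset.univ v i * (t - v i)⁻¹ * r i =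
          if i ∈ S then |nw i| * (t - v i)⁻¹ else 0 := by
        intro i
        by_cases hi : i ∈ S
        · simp only [hr, hi, if_true]
          rw [← self_mul_sign (nw i)]
          ring
        · simp [hr, hi]
      simp only [h1, Finset.sum_ite_mem, Finset.univ_inter]
      simp only [hnwd, abs_inv]
      rcases hS with h | h
      · rw [Finset.abs_sum_of_nonneg]
        · refine Finset.sum_congr rfl fun k hk => ?_
          rw [abs_of_pos (a := t - v k)]
          linarith [h k hk, ht.1]
        · intro k hk
          have : 0 < t - v k := by linarith [h k hk, ht.1]
          positivity
      · rw [← abs_neg, ← Finset.sum_neg_distrib, Finset.abs_sum_of_nonneg]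
        · refine Finset.sum_congr rfl fun k hk => ?_
          rw [abs_of_neg (a := t - v k), inv_neg, mul_neg]
          linarith [h k hk, ht.2]
        · intro k hk
          have : 0 < -(t - v k) := by linarith [h k hk, ht.2]
          rw [← mul_neg, ← inv_neg]
          positivity
  have hcont : Continuous fun t => |q.eval t| ^ p :=
    q.continuous.abs.rpow_const fun _ => Or.inr hp0.le
  have hA : 0 ≤ ∫ t in Ioo (-1:ℝ) 1, |q.eval t| ^ p * jacobiWeight α β t :=
    setIntegral_nonneg measurableSet_Ioo fun x hx =>
      mul_nonneg (by positivity) (jacobiWeight_nonneg (Ioo_subset_Icc_self hx))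
  have hB : 0 ≤ ∑ j : Fin (n + 1), N.wt n j * |q.eval (v j)| ^ p :=
    Finset.sum_nonneg fun j _ => mul_nonneg (N.wt_pos n j).le (by positivity)
  have hmain : (∫ t in Ioo (-1:ℝ) 1, |q.eval t| ^ p * jacobiWeight α β t) ≤
      cp ^ p * ∑ j : Fin (n + 1), N.wt n j * |q.eval (v j)| ^ p := by
    have h1 := Real.rpow_le_rpow (by positivity) (hineq n q hqd) hp0.le
    rwa [Real.mul_rpow hcp.le (by positivity), ← Real.rpow_mul hA, ← Real.rpow_mul hB,
      one_div_mul_cancel hp0.ne', Real.rpow_one, Real.rpow_one] at h1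
  calc _ = ∫ t in e..f, |q.eval t| ^ p * jacobiWeight α β t := by
        refine intervalIntegral.integral_congr fun t ht => ?_
        rw [uIcc_of_le hef] at ht
        simp only [heval t ht]
    _ ≤ ∫ t in Ioo (-1:ℝ) 1, |q.eval t| ^ p * jacobiWeight α β t := by
        rw [intervalIntegral.integral_of_le hef]
        refine setIntegral_mono_set (integrableOn_mul_jacobiWeight hα hβ hcont) ?_ ?_
        · exact (ae_restrict_iff' measurableSet_Ioo).2 (Eventually.of_forall fun x hx =>
            mul_nonneg (by positivity) (jacobiWeight_nonneg (Ioo_subset_Icc_self hx)))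
        · exact (show Ioc e f ⊆ Ioo (-1 : ℝ) 1 from fun x hx =>
            ⟨he.trans hx.1, hx.2.trans_lt hf⟩).eventuallyLE
    _ ≤ _ := hmain
    _ ≤ _ := by
        gcongr
        rw [← Finset.sum_subset (Finset.subset_univ S)]
        · refine Finset.sum_le_sum fun k hk => ?_
          rw [hqn]
          refine mul_le_of_le_one_right (N.wt_pos n k).le (Real.rpow_le_one (abs_nonneg _) ?_ hp0.le)
          simp only [hr, hk, if_true]
          rcases lt_trichotomy (nw k) 0 with h | h | h
          · simp [sign_neg h]
          · simp [h]
          · simp [sign_pos h]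
        · intro k _ hk
          rw [hqn]
          simp [hr, hk, Real.zero_rpow hp0.ne']

/-- A two-interval weighted inequality for the kernel `|t - t'|⁻¹`. -/
def TwoIntervalBound (α β p K : ℝ) : Prop :=
  ∀ (c' c d d' e f m : ℝ) (D : ℝ → ℝ), -1 ≤ c' → c' < c → c < d → d < d' → d' ≤ 1 →
    -1 < e → e < f → f < 1 → (d < e ∨ f < c) → 0 ≤ m →
    (∀ t ∈ Icc c d, m ≤ jacobiWeight (α / 2 + 1 / 4) (β / 2 + 1 / 4) t) →
    (∀ t ∈ Icc c d, ∀ t' ∈ Icc c d, 1 - t ^ 2 ≤ 4 * (1 - t' ^ 2)) →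
    ContinuousOn D (Icc e f) → (∀ t ∈ Icc e f, ∀ t' ∈ Icc c d, |t - t'| ≤ D t) →
    (m * (d - c)) ^ p * ∫ t in e..f,
      (jacobiWeight (α / 2 + 1 / 4) (β / 2 + 1 / 4) t * D t) ^ (-p) * jacobiWeight α β t ≤
        K * ∫ t in c'..d', jacobiWeight α β t

theorem integral_comp_cos_mul_sin {e f : ℝ} (he : -1 ≤ e) (hef : e ≤ f) (hf : f ≤ 1)
    {F : ℝ → ℝ} (hF : ContinuousOn F (Icc e f)) :
    ∫ t in e..f, F t = ∫ x in Real.arccos f..Real.arccos e, F (Real.cos x) * Real.sin x := by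
  have hle : Real.arccos f ≤ Real.arccos e := Real.arccos_le_arccos hef
  have h := intervalIntegral.integral_comp_mul_deriv' (a := Real.arccos f) (b := Real.arccos e)
    (f := Real.cos) (f' := fun x => -Real.sin x) (g := F)
    (fun x _ => Real.hasDerivAt_cos x) (by fun_prop) (by
      refine hF.mono ?_
      rintro _ ⟨x, hx, rfl⟩
      rw [uIcc_of_le hle] at hx
      constructor
      · rw [← Real.cos_arccos he (hef.trans hf)]
        exact Real.cos_le_cos_of_nonneg_of_le_pi ((Real.arccos_nonneg f).trans hx.1)
          (Real.arccos_le_pi e) hx.2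
      · rw [← Real.cos_arccos (he.trans hef) hf]
        exact Real.cos_le_cos_of_nonneg_of_le_pi (Real.arccos_nonneg f)
          (hx.2.trans (Real.arccos_le_pi e)) hx.1)
  rw [Real.cos_arccos he (hef.trans hf), Real.cos_arccos (he.trans hef) hf] at h
  rw [intervalIntegral.integral_symm, ← h, ← intervalIntegral.integral_neg]
  congr 1
  ext x
  simp

theorem cos_mem_Icc_of_mem_Icc_arccos {e f x : ℝ} (he : -1 ≤ e) (hef : e ≤ f) (hf : f ≤ 1)
    (hx : x ∈ Icc (Real.arccos f) (Real.arccos e)) : Real.cos x ∈ Icc e f := by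
  constructor
  · rw [← Real.cos_arccos he (hef.trans hf)]
    exact Real.cos_le_cos_of_nonneg_of_le_pi ((Real.arccos_nonneg f).trans hx.1)
      (Real.arccos_le_pi e) hx.2
  · rw [← Real.cos_arccos (he.trans hef) hf]
    exact Real.cos_le_cos_of_nonneg_of_le_pi (Real.arccos_nonneg f)
      (hx.2.trans (Real.arccos_le_pi e)) hx.1

open Polynomial in
theorem sum_sqrt_node_ge {α β : ℝ} {J : JacobiSystem α β} (N : JacobiNodes J) {n : ℕ}
    {c d ω φ ρ : ℝ} (hc : -1 < c) (hcd : c < d) (hd : d < 1)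
    (hω : 40 ≤ ω * (Real.arccos c - Real.arccos d)) (hρ : 0 < ρ)
    (hsq : ∀ t ∈ Icc c d, ∀ t' ∈ Icc c d, 1 - t ^ 2 ≤ 4 * (1 - t' ^ 2))
    (happ : ∀ x ∈ Icc (Real.arccos d) (Real.arccos c),
      |jacobiWeight (α / 2 + 1 / 4) (β / 2 + 1 / 4) (Real.cos x) *
        (nodePoly N n).eval (Real.cos x) - ρ * Real.cos (ω * x - φ)| ≤ 1 / 10 * ρ) :
    (d - c) * ω / 8 ≤ ∑ j with N.node n j ∈ Icc c d, √(1 - N.node n j ^ 2) := by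
  set a := Real.arccos d with ha
  set b := Real.arccos c with hb
  have hab : a < b := Real.arccos_lt_arccos hc.le hcd hd.le
  have hΔ : 0 < b - a := sub_pos.2 hab
  have hω0 : 0 < ω := by
    by_contra h
    nlinarith
  have ha0 : 0 < a := Real.arccos_pos.2 hd
  have hbpi : b < Real.pi := by
    refine lt_of_le_of_ne (Real.arccos_le_pi c) fun h => ?_
    rw [hb, Real.arccos_eq_pi] at h
    linarith
  have hcosmem : ∀ x ∈ Icc a b, Real.cos x ∈ Icc c d := fun x hx =>
    cos_mem_Icc_of_mem_Icc_arccos hc.le hcd.le hd.le hx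
  have hmemI : ∀ x ∈ Icc a b, Real.cos x ∈ Ioo (-1 : ℝ) 1 := fun x hx =>
    ⟨hc.trans_le (hcosmem x hx).1, (hcosmem x hx).2.trans_lt hd⟩
  obtain ⟨Z, hZ, hZc⟩ := exists_zeros_of_approx_cos hω0 hρ (u := fun x =>
    jacobiWeight (α / 2 + 1 / 4) (β / 2 + 1 / 4) (Real.cos x) *
        (nodePoly N n).eval (Real.cos x)) (by
      refine ContinuousOn.mul ?_ ((nodePoly N n).continuous.comp Real.continuous_cos).continuousOn
      exact continuousOn_jacobiWeight.comp Real.continuous_cos.continuousOn hmemI) happ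
  set S : Finset (Fin (n + 1)) := Finset.univ.filter fun j => N.node n j ∈ Icc c d with hS
  have hcard : Z.card ≤ S.card := by
    have hinj : Set.InjOn Real.cos (Z : Set ℝ) := Real.injOn_cos.mono
      fun x (hx : x ∈ Z) => show x ∈ Icc 0 Real.pi from
        ⟨ha0.le.trans (hZ x hx).1.1, (hZ x hx).1.2.trans hbpi.le⟩
    rw [← Finset.card_image_of_injOn hinj]
    refine (Finset.card_le_card (t := S.image (N.node n)) ?_).trans Finset.card_image_le
    intro y hy
    obtain ⟨x, hx, rfl⟩ := Finset.mem_image.1 hy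
    have h1 := hZ x hx
    have h2 := (mul_eq_zero.1 h1.2).resolve_left (jacobiWeight_pos (hmemI x h1.1)).ne'
    rw [nodePoly, Lagrange.eval_nodal, Finset.prod_eq_zero_iff] at h2
    obtain ⟨j, _, hj⟩ := h2
    have hj' : N.node n j = Real.cos x := by linarith
    rw [Finset.mem_image]
    refine ⟨j, ?_, hj'⟩
    rw [hS, Finset.mem_filter, hj']
    exact ⟨Finset.mem_univ _, hcosmem x h1.1⟩
  have hcard' : (b - a) * ω / 4 ≤ (S.card : ℝ) := by
    have h1 : (Z.card : ℝ) ≤ S.card := by exact_mod_cast hcard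
    refine le_trans ?_ (hZc.trans h1)
    have h2 : (3 / 10 : ℝ) * ((b - a) * ω) ≤ (b - a) * ω / Real.pi := by
      rw [le_div_iff₀ Real.pi_pos]
      have := Real.pi_lt_d2
      have : 0 < (b - a) * ω := by positivity
      nlinarith
    nlinarith
  have hterm : ∀ j ∈ S, (d - c) / (2 * (b - a)) ≤ √(1 - N.node n j ^ 2) := by
    intro j hj
    rw [hS, Finset.mem_filter] at hj
    obtain ⟨ξ, hξ, hξ'⟩ := exists_hasDerivAt_eq_slope Real.cos (fun x => -Real.sin x) hab
      Real.continuous_cos.continuousOn fun x _ => Real.hasDerivAt_cos x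
    rw [ha, hb, Real.cos_arccos hc.le (hcd.le.trans hd.le), Real.cos_arccos (hc.le.trans hcd.le)
      hd.le, ← ha, ← hb] at hξ'
    have h1 : Real.sin ξ * (b - a) = d - c := by
      rw [eq_div_iff hΔ.ne'] at hξ'
      linarith
    have h2 : Real.sin ξ ≤ 2 * √(1 - N.node n j ^ 2) := by
      have h3 := hsq _ (hcosmem ξ (Ioo_subset_Icc_self hξ)) _ hj.2
      have h4 : Real.sin ξ ^ 2 = 1 - Real.cos ξ ^ 2 := by
        linarith [Real.sin_sq_add_cos_sq ξ]
      rw [← h4] at h3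
      refine (Real.le_sqrt_of_sq_le h3).trans (le_of_eq ?_)
      rw [Real.sqrt_mul (by norm_num)]
      congr 1
      rw [Real.sqrt_eq_iff_mul_self_eq_of_pos] <;> norm_num
    rw [div_le_iff₀ (by positivity), ← h1]
    nlinarith
  calc (d - c) * ω / 8 = ((b - a) * ω / 4) * ((d - c) / (2 * (b - a))) := by
        field_simp; ring
    _ ≤ S.card * ((d - c) / (2 * (b - a))) := by
        have : 0 < d - c := sub_pos.2 hcd
        gcongr
    _ ≤ _ := by
        rw [← nsmul_eq_mul]
        exact Finset.card_nsmul_le_sum _ _ _ hterm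

open Polynomial in
theorem twoIntervalBound_of_marcinkiewicz_zygmund {α β : ℝ} (hα : -1 < α) (hβ : -1 < β)
    {J : JacobiSystem α β} (N : JacobiNodes J) {p cp : ℝ} (hp : 1 ≤ p) (hcp : 0 < cp)
    (hineq : ∀ n : ℕ, ∀ q : Polynomial ℝ, q.natDegree ≤ n →
      (∫ t in Ioo (-1:ℝ) 1, |q.eval t| ^ p * jacobiWeight α β t) ^ (1 / p)
        ≤ cp * (∑ j : Fin (n + 1), N.wt n j * |q.eval (N.node n j)| ^ p) ^ (1 / p)) :
    ∃ K, TwoIntervalBound α β p K := by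
  have hp0 : 0 < p := by linarith
  refine ⟨16 ^ p * (25 * 4 ^ p) * (cp ^ p * 2), ?_⟩
  intro c' c d d' e f m D h1 h2 h3 h4 h5 he hef hf hside hm hmG hsq hDc hD
  set G := jacobiWeight (α / 2 + 1 / 4) (β / 2 + 1 / 4) with hG
  set w := jacobiWeight α β with hw
  have hc : -1 < c := by linarith
  have hd : d < 1 := by linarith
  have hmax : max d f < 1 := max_lt hd hf
  have hmin : -1 < min c e := lt_min hc he
  have hlt : min c e < max d f := (min_le_left _ _).trans_lt (h3.trans_le (le_max_left _ _))
  set a₀ := Real.arccos (max d f) with ha₀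
  set b₀ := Real.arccos (min c e) with hb₀
  have ha₀pos : 0 < a₀ := Real.arccos_pos.2 hmax
  have hab₀ : a₀ < b₀ := Real.arccos_lt_arccos hmin.le hlt hmax.le
  have hb₀pi : b₀ < Real.pi := by
    refine lt_of_le_of_ne (Real.arccos_le_pi _) fun h => ?_
    rw [hb₀, Real.arccos_eq_pi] at h
    linarith
  have hC : Icc (Real.arccos d) (Real.arccos c) ⊆ Icc a₀ b₀ :=
    Icc_subset_Icc (Real.arccos_le_arccos (le_max_left _ _))
      (Real.arccos_le_arccos (min_le_left _ _))
  have hB : Icc (Real.arccos f) (Real.arccos e) ⊆ Icc a₀ b₀ :=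
    Icc_subset_Icc (Real.arccos_le_arccos (le_max_right _ _))
      (Real.arccos_le_arccos (min_le_right _ _))
  have hBab : Real.arccos f ≤ Real.arccos e := Real.arccos_le_arccos hef.le
  have hBI : Icc e f ⊆ Ioo (-1 : ℝ) 1 := fun t ht => ⟨he.trans_le ht.1, ht.2.trans_lt hf⟩
  have hcosB : ∀ x ∈ Icc (Real.arccos f) (Real.arccos e), Real.cos x ∈ Icc e f := fun x hx =>
    cos_mem_Icc_of_mem_Icc_arccos he.le hef.le hf.le hx
  have hsep : ∀ t ∈ Icc e f, ∀ t' ∈ Icc c d, 0 < |t - t'| := by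
    intro t ht t' ht'
    rw [abs_pos, sub_ne_zero]
    rcases hside with h | h
    · exact (ht'.2.trans_lt (h.trans_le ht.1)).ne'
    · exact (ht.2.trans_lt (h.trans_le ht'.1)).ne
  have hDpos : ∀ t ∈ Icc e f, 0 < D t := fun t ht =>
    (hsep t ht c (left_mem_Icc.2 h3.le)).trans_le (hD t ht c (left_mem_Icc.2 h3.le))
  have hGpos : ∀ t ∈ Ioo (-1 : ℝ) 1, 0 < G t := fun t ht => jacobiWeight_pos ht
  have hGc : ContinuousOn G (Icc e f) := continuousOn_jacobiWeight.mono hBI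
  have hwc : ContinuousOn w (Icc e f) := continuousOn_jacobiWeight.mono hBI
  set H : ℝ → ℝ := fun t => (G t * D t) ^ (-p) * w t with hH
  have hHc : ContinuousOn H (Icc e f) := by
    refine ContinuousOn.mul ((hGc.mul hDc).rpow_const fun t ht => Or.inl ?_) hwc
    exact (mul_pos (hGpos t (hBI ht)) (hDpos t ht)).ne'
  set h : ℝ → ℝ := fun x => H (Real.cos x) * Real.sin x with hh
  have hhc : ContinuousOn h (Icc (Real.arccos f) (Real.arccos e)) :=
    (hHc.comp Real.continuous_cos.continuousOn hcosB).mul Real.continuous_sin.continuousOn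
  have hsin : ∀ x ∈ Icc a₀ b₀, 0 ≤ Real.sin x := fun x hx =>
    Real.sin_nonneg_of_nonneg_of_le_pi (ha₀pos.le.trans hx.1) (hx.2.trans hb₀pi.le)
  have hH0 : ∀ t ∈ Icc e f, 0 ≤ H t := fun t ht =>
    mul_nonneg (Real.rpow_nonneg (mul_pos (hGpos t (hBI ht)) (hDpos t ht)).le _)
      (jacobiWeight_nonneg (Ioo_subset_Icc_self (hBI ht)))
  have hh0 : ∀ x ∈ Icc (Real.arccos f) (Real.arccos e), 0 ≤ h x := fun x hx =>
    mul_nonneg (hH0 _ (hcosB x hx)) (hsin x (hB hx))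
  have hΔ : 0 < Real.arccos c - Real.arccos d :=
    sub_pos.2 (Real.arccos_lt_arccos hc.le h3 hd.le)
  have hωlim := tendsto_jacobiFreq α β
  obtain ⟨n, ⟨ρ, φ, hρ, happ⟩, hosc, hsum, hωΔ⟩ :=
    ((eventually_nodePoly_approx hα hβ N ha₀pos hab₀ hb₀pi).and
      ((hωlim.eventually (eventually_integral_rpow_approx_cos_ge hBab hp0.le hhc hh0)).and
        ((eventually_sum_wt_le hα hβ N h1 h2 h3 h4 h5).and
          ((hωlim.atTop_mul_const hΔ).eventually_ge_atTop 40)))).exists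
  set ω := jacobiFreq α β n with hω
  have hω0 : 0 < ω := by
    by_contra hneg
    nlinarith
  set Q := nodePoly N n with hQ
  set S : Finset (Fin (n + 1)) := Finset.univ.filter fun j => N.node n j ∈ Icc c d with hS
  have hSmem : ∀ k ∈ S, N.node n k ∈ Icc c d := fun k hk => (Finset.mem_filter.1 hk).2
  have hcount := sum_sqrt_node_ge N hc h3 hd hωΔ hρ hsq fun x hx => (happ x (hC hx)).1
  rw [← hS] at hcount
  have hmz := integral_le_of_marcinkiewicz_zygmund hα hβ N hp hcp hineq n S he hef.le hf (by
    rcases hside with hs | hs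
    · exact Or.inl fun k hk => (hSmem k hk).2.trans_lt hs
    · exact Or.inr fun k hk => hs.trans_le (hSmem k hk).1)
  rw [← hQ] at hmz
  set T : ℝ → ℝ := fun t => ∑ k ∈ S, |(derivative Q).eval (N.node n k)|⁻¹ * |t - N.node n k|⁻¹
    with hT
  set M := m * (d - c) / 16 with hM
  have hdc : 0 < d - c := sub_pos.2 h3
  have hM0 : 0 ≤ M := by positivity
  have hterm : ∀ t ∈ Icc e f, ∀ k ∈ S, m / (2 * (ω * ρ) * D t) * √(1 - N.node n k ^ 2) ≤
      |(derivative Q).eval (N.node n k)|⁻¹ * |t - N.node n k|⁻¹ := by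
    intro t ht k hk
    have hkm := hSmem k hk
    have hkI := N.node_mem n k
    have e1 := (happ (Real.arccos (N.node n k)) (hC ⟨Real.arccos_le_arccos hkm.2,
      Real.arccos_le_arccos hkm.1⟩)).2
    rw [Real.cos_arccos hkI.1.le hkI.2.le, Real.sin_arccos] at e1
    have e2 := e1 (Lagrange.eval_nodal_at_node (Finset.mem_univ k))
    have hQ' : 0 < |(derivative Q).eval (N.node n k)| := by
      rw [abs_pos]
      have := Lagrange.nodalWeight_ne_zero (s := Finset.univ) (v := N.node n)
        (N.node_strictAnti n).injective.injOn (Finset.mem_univ k)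
      rw [Lagrange.nodalWeight_eq_eval_derivative_nodal (Finset.mem_univ k)] at this
      exact fun h0 => this (inv_eq_zero.2 h0)
    have e3 : m * √(1 - N.node n k ^ 2) / (2 * (ω * ρ)) ≤
        |(derivative Q).eval (N.node n k)|⁻¹ := by
      rw [div_le_iff₀ (by positivity), ← div_eq_inv_mul, le_div_iff₀ hQ', mul_assoc]
      refine le_trans ?_ e2
      gcongr
      exact hmG _ hkm
    have e4 : (D t)⁻¹ ≤ |t - N.node n k|⁻¹ :=
      inv_anti₀ (hsep t ht _ hkm) (hD t ht _ hkm)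
    have hDt := hDpos t ht
    calc _ = m * √(1 - N.node n k ^ 2) / (2 * (ω * ρ)) * (D t)⁻¹ := by field_simp
      _ ≤ _ := by gcongr
  have hTge : ∀ t ∈ Icc e f, M / (ρ * D t) ≤ T t := by
    intro t ht
    have hDt := hDpos t ht
    calc M / (ρ * D t) = m / (2 * (ω * ρ) * D t) * ((d - c) * ω / 8) := by
          rw [hM]; field_simp; ring
      _ ≤ m / (2 * (ω * ρ) * D t) * ∑ k ∈ S, √(1 - N.node n k ^ 2) := by gcongr
      _ ≤ T t := by
          rw [Finset.mul_sum]
          exact Finset.sum_le_sum (hterm t ht)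
  have hTc : ContinuousOn T (Icc e f) := by
    refine continuousOn_finsetSum _ fun k hk => ContinuousOn.mul continuousOn_const ?_
    exact ContinuousOn.inv₀ (by fun_prop) fun t ht => (hsep t ht _ (hSmem k hk)).ne'
  set y : ℝ → ℝ := fun x => G (Real.cos x) * Q.eval (Real.cos x) / ρ with hy
  have hyc : ContinuousOn y (Icc (Real.arccos f) (Real.arccos e)) :=
    ((hGc.comp Real.continuous_cos.continuousOn hcosB).mul
      (Q.continuous.comp Real.continuous_cos).continuousOn).div_const _
  have hosc' := hosc φ y hyc (by
    intro x hx
    have := (happ x (hB hx)).1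
    rw [show y x - Real.cos (ω * x - φ) =
      (G (Real.cos x) * Q.eval (Real.cos x) - ρ * Real.cos (ω * x - φ)) / ρ by
        simp only [hy]; field_simp, abs_div, abs_of_pos hρ, div_le_iff₀ hρ]
    exact this)
  set F : ℝ → ℝ := fun t => (|Q.eval t| * T t) ^ p * w t with hF
  have hFc : ContinuousOn F (Icc e f) :=
    ((Q.continuous.abs.continuousOn.mul hTc).rpow_const fun _ _ => Or.inr hp0.le).mul hwc
  have hpt : ∀ x ∈ Icc (Real.arccos f) (Real.arccos e),
      M ^ p * (h x * |y x| ^ p) ≤ F (Real.cos x) * Real.sin x := by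
    intro x hx
    have ht := hcosB x hx
    set t := Real.cos x with htdef
    have hDt := hDpos t ht
    have hGt := hGpos t (hBI ht)
    have hGD : 0 < G t * D t := mul_pos hGt hDt
    have hw0 : 0 ≤ w t := jacobiWeight_nonneg (Ioo_subset_Icc_self (hBI ht))
    have hs0 := hsin x (hB hx)
    have e1 : M ^ p * ((G t * D t) ^ (-p) * |y x| ^ p) ≤ (|Q.eval t| * T t) ^ p := by
      rw [Real.rpow_neg hGD.le, ← Real.inv_rpow hGD.le, ← Real.mul_rpow (by positivity)
        (abs_nonneg _), ← Real.mul_rpow hM0 (by positivity)]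
      refine Real.rpow_le_rpow (by positivity) ?_ hp0.le
      have e2 : |y x| = G t * |Q.eval t| / ρ := by
        simp only [hy]
        rw [abs_div, abs_mul, abs_of_pos hρ, abs_of_pos hGt]
      calc M * ((G t * D t)⁻¹ * |y x|) = |Q.eval t| * (M / (ρ * D t)) := by
            rw [e2]; field_simp
        _ ≤ _ := by
            have := hTge t ht
            gcongr
    calc M ^ p * (h x * |y x| ^ p)
        = M ^ p * ((G t * D t) ^ (-p) * |y x| ^ p) * (w t * Real.sin x) := by
          simp only [hh, hH, ← htdef]; ring
      _ ≤ (|Q.eval t| * T t) ^ p * (w t * Real.sin x) := by gcongr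
      _ = _ := by simp only [hF]; ring
  have hfin : M ^ p * ((1 / 4 : ℝ) ^ p / 25 * ∫ t in e..f, H t) ≤
      cp ^ p * (2 * ∫ t in c'..d', w t) := by
    calc M ^ p * ((1 / 4 : ℝ) ^ p / 25 * ∫ t in e..f, H t)
        = M ^ p * ((1 / 4 : ℝ) ^ p / 25 * ∫ x in Real.arccos f..Real.arccos e, h x) := by
          rw [integral_comp_cos_mul_sin he.le hef.le hf.le hHc]
      _ ≤ M ^ p * ∫ x in Real.arccos f..Real.arccos e, h x * |y x| ^ p := by gcongr
      _ = ∫ x in Real.arccos f..Real.arccos e, M ^ p * (h x * |y x| ^ p) := by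
          rw [intervalIntegral.integral_const_mul]
      _ ≤ ∫ x in Real.arccos f..Real.arccos e, F (Real.cos x) * Real.sin x := by
          refine intervalIntegral.integral_mono_on hBab ?_ ?_ hpt
          · refine ContinuousOn.intervalIntegrable ?_
            rw [uIcc_of_le hBab]
            exact continuousOn_const.mul
              (hhc.mul (hyc.abs.rpow_const fun _ _ => Or.inr hp0.le))
          · refine ContinuousOn.intervalIntegrable ?_
            rw [uIcc_of_le hBab]
            exact (hFc.comp Real.continuous_cos.continuousOn hcosB).mul
              Real.continuous_sin.continuousOn
      _ = ∫ t in e..f, F t := (integral_comp_cos_mul_sin he.le hef.le hf.le hFc).symm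
      _ ≤ cp ^ p * ∑ k ∈ S, N.wt n k := hmz
      _ ≤ _ := by gcongr
  have e16 : (m * (d - c)) ^ p = 16 ^ p * M ^ p := by
    rw [← Real.mul_rpow (by norm_num) hM0, hM]
    congr 1
    ring
  have e4 : (25 * (4 : ℝ) ^ p) * ((1 / 4 : ℝ) ^ p / 25) = 1 := by
    rw [one_div, Real.inv_rpow (by norm_num)]
    have : (4 : ℝ) ^ p ≠ 0 := by positivity
    field_simp
  calc (m * (d - c)) ^ p * ∫ t in e..f, H t
      = 16 ^ p * (25 * (4 : ℝ) ^ p) *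
          (M ^ p * ((1 / 4 : ℝ) ^ p / 25 * ∫ t in e..f, H t)) := by
        rw [e16]
        linear_combination (-(16 ^ p * M ^ p * ∫ t in e..f, H t)) * e4
    _ ≤ 16 ^ p * (25 * (4 : ℝ) ^ p) * (cp ^ p * (2 * ∫ t in c'..d', w t)) := by gcongr
    _ = _ := by ring

theorem TwoIntervalBound.swap {α β p K : ℝ} (h : TwoIntervalBound α β p K) :
    TwoIntervalBound β α p K := by
  have hw : ∀ a b t : ℝ, jacobiWeight a b (-t) = jacobiWeight b a t := by
    intro a b t
    rw [jacobiWeight, jacobiWeight, mul_comm, sub_neg_eq_add, ← sub_eq_add_neg]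
  have hneg : ∀ {a b t : ℝ}, t ∈ Icc (-b) (-a) → -t ∈ Icc a b := fun ht =>
    ⟨by linarith [ht.2], by linarith [ht.1]⟩
  intro c' c d d' e f m D h1 h2 h3 h4 h5 he hef hf hside hm hmG hsq hDc hD
  have key := h (-d') (-d) (-c) (-c') (-f) (-e) m (fun t => D (-t)) (by linarith) (by linarith)
    (by linarith) (by linarith) (by linarith) (by linarith) (by linarith) (by linarith)
    (hside.symm.imp (fun _ => by linarith) fun _ => by linarith) hm
    (fun t ht => by rw [← hw]; exact hmG _ (hneg ht))
    (fun t ht t' ht' => by simpa using hsq _ (hneg ht) _ (hneg ht'))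
    (hDc.comp continuousOn_neg fun t ht => hneg ht)
    (fun t ht t' ht' => by
      have := hD _ (hneg ht) _ (hneg ht')
      rwa [neg_sub_neg, abs_sub_comm] at this)
  simp only [← hw α β, ← hw (α / 2 + 1 / 4)] at *
  rw [← intervalIntegral.integral_comp_neg (f := fun t => jacobiWeight α β t) (a := c') (b := d'),
    ← intervalIntegral.integral_comp_neg (a := e) (b := f)] at key
  rw [show -c - -d = d - c by ring] at key
  simpa using key

theorem rpow_mem_Icc_of_mem_Icc (γ : ℝ) {x : ℝ} (hx : x ∈ Icc (1 / 4 : ℝ) 4) :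
    x ^ γ ∈ Icc ((4 : ℝ) ^ |γ|)⁻¹ (4 ^ |γ|) := by
  have hx0 : 0 < x := by linarith [hx.1]
  have h4 : 0 < Real.log 4 := Real.log_pos (by norm_num)
  have hlog : |Real.log x| ≤ Real.log 4 := by
    rw [abs_le]
    constructor
    · rw [← Real.log_inv]
      exact Real.log_le_log (by norm_num) (by linarith [hx.1])
    · exact Real.log_le_log hx0 hx.2
  have hle : |Real.log x * γ| ≤ Real.log 4 * |γ| := by
    rw [abs_mul]
    gcongr
  rw [← Real.rpow_neg (by norm_num), Real.rpow_def_of_pos hx0, Real.rpow_def_of_pos (by norm_num),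
    Real.rpow_def_of_pos (by norm_num)]
  constructor
  · exact Real.exp_le_exp.2 (by linarith [neg_abs_le (Real.log x * γ)])
  · exact Real.exp_le_exp.2 ((le_abs_self _).trans hle)

theorem jacobiWeight_mem_Icc (α β : ℝ) {t : ℝ} (ht : t ∈ Icc (-3 / 4 : ℝ) 1) :
    jacobiWeight α β t ∈ Icc (((4 : ℝ) ^ |β|)⁻¹ * (1 - t) ^ α) (4 ^ |β| * (1 - t) ^ α) := by
  have h1 := rpow_mem_Icc_of_mem_Icc β (x := 1 + t) ⟨by linarith [ht.1], by linarith [ht.2]⟩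
  have h2 : 0 ≤ (1 - t) ^ α := Real.rpow_nonneg (by linarith [ht.2]) _
  rw [jacobiWeight, mul_comm ((1 - t) ^ α)]
  exact ⟨mul_le_mul_of_nonneg_right h1.1 h2, mul_le_mul_of_nonneg_right h1.2 h2⟩

theorem false_of_forall_log_le {c R : ℝ} (hc : 0 < c)
    (h : ∀ ε : ℝ, 0 < ε → ε < 1 / 16 → c * Real.log (1 / (4 * ε)) ≤ R) : False := by
  have h1 := h (Real.exp (-(|R| / c + 2)) / 16) (by positivity) (by
    have : Real.exp (-(|R| / c + 2)) < 1 := Real.exp_zero ▸ Real.exp_lt_exp.2 (by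
      have : 0 ≤ |R| / c := by positivity
      linarith)
    linarith)
  have h2 : |R| / c + 2 ≤ Real.log (1 / (4 * (Real.exp (-(|R| / c + 2)) / 16))) := by
    rw [Real.le_log_iff_exp_le (by positivity), Real.exp_neg]
    have := Real.exp_pos (|R| / c + 2)
    rw [le_div_iff₀ (by positivity)]
    field_simp
    norm_num
  have h3 : c * (|R| / c + 2) ≤ R := (mul_le_mul_of_nonneg_left h2 hc.le).trans h1
  have h4 : c * (|R| / c + 2) = |R| + 2 * c := by field_simp
  linarith [le_abs_self R]

theorem le_integral_of_two_interval {α β p e f c L : ℝ} {D g : ℝ → ℝ} (he : -1 < e)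
    (hef : e ≤ f) (hf : f < 1) (hDc : ContinuousOn D (Icc e f)) (hD : ∀ t ∈ Icc e f, 0 < D t)
    (hg : ContinuousOn g (Icc e f)) (hL : ∫ t in e..f, g t = L)
    (h : ∀ t ∈ Icc e f, c * g t ≤
      (jacobiWeight (α / 2 + 1 / 4) (β / 2 + 1 / 4) t * D t) ^ (-p) * jacobiWeight α β t) :
    c * L ≤ ∫ t in e..f,
      (jacobiWeight (α / 2 + 1 / 4) (β / 2 + 1 / 4) t * D t) ^ (-p) * jacobiWeight α β t := by
  have hI : Icc e f ⊆ Ioo (-1 : ℝ) 1 := fun t ht => ⟨he.trans_le ht.1, ht.2.trans_lt hf⟩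
  rw [← hL, ← intervalIntegral.integral_const_mul]
  refine intervalIntegral.integral_mono_on hef ?_ ?_ h
  · exact (continuousOn_const.mul hg).intervalIntegrable_of_Icc hef
  · refine ContinuousOn.intervalIntegrable_of_Icc hef (ContinuousOn.mul ?_
      (continuousOn_jacobiWeight.mono hI))
    refine ((continuousOn_jacobiWeight.mono hI).mul hDc).rpow_const fun t ht => Or.inl ?_
    exact (mul_pos (jacobiWeight_pos (hI ht)) (hD t ht)).ne'

theorem integral_inv_one_sub {e f : ℝ} (hef : e ≤ f) (hf : f < 1) :
    ∫ t in e..f, (1 - t)⁻¹ = Real.log ((1 - e) / (1 - f)) := by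
  rw [intervalIntegral.integral_comp_sub_left (fun s : ℝ => s⁻¹) 1,
    integral_inv_of_pos (by linarith) (by linarith)]

theorem continuousOn_inv_one_sub {e f : ℝ} (hf : f < 1) :
    ContinuousOn (fun t : ℝ => (1 - t)⁻¹) (Icc e f) :=
  ContinuousOn.inv₀ (by fun_prop) fun t ht => by linarith [ht.2]

theorem TwoIntervalBound.lt_of_right {α β p K : ℝ} (hp : 0 < p) (h : TwoIntervalBound α β p K) :
    p * (2 * α + 1) < 4 * (α + 1) := by
  by_contra! hcon
  set g := α / 2 + 1 / 4 with hg
  set γ := β / 2 + 1 / 4 with hγ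
  set A : ℝ := 4 ^ |γ| with hA
  set A' : ℝ := 4 ^ |g| with hA'
  set B : ℝ := 4 ^ |β| with hB
  have hA0 : 0 < A := by positivity
  have hA'0 : 0 < A' := by positivity
  have hB0 : 0 < B := by positivity
  set m : ℝ := A⁻¹ * A'⁻¹ with hm
  have hm0 : 0 < m := by positivity
  refine false_of_forall_log_le (c := (m * (1 / 2)) ^ p * ((A * 2) ^ (-p) * B⁻¹))
    (R := K * ∫ t in (-3 / 4)..(1 / 4), jacobiWeight α β t) (by positivity) fun ε hε hε' => ?_
  have hle := h (-3 / 4) (-1 / 2) 0 (1 / 4) (1 / 2) (1 - 2 * ε) m (fun _ => 2) (by norm_num)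
    (by norm_num) (by norm_num) (by norm_num) (by norm_num) (by norm_num) (by linarith)
    (by linarith) (Or.inl (by norm_num)) hm0.le (by
      intro t ht
      refine le_trans ?_ (jacobiWeight_mem_Icc g γ ⟨by linarith [ht.1], by linarith [ht.2]⟩).1
      rw [hm]
      gcongr
      exact (rpow_mem_Icc_of_mem_Icc g ⟨by linarith [ht.2], by linarith [ht.1]⟩).1)
    (by rintro t ⟨h1, h2⟩ t' ⟨h3, h4⟩; nlinarith)
    continuousOn_const
    (by rintro t ⟨h1, h2⟩ t' ⟨h3, h4⟩; rw [abs_le]; constructor <;> linarith)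
  rw [show (0 : ℝ) - -1 / 2 = 1 / 2 by norm_num] at hle
  refine le_trans ?_ hle
  rw [mul_assoc]
  refine mul_le_mul_of_nonneg_left ?_ (by positivity)
  refine le_integral_of_two_interval (g := fun t => (1 - t)⁻¹) (by norm_num) (by linarith)
    (by linarith) continuousOn_const (fun _ _ => by norm_num)
    (continuousOn_inv_one_sub (by linarith)) ?_ ?_
  · rw [integral_inv_one_sub (by linarith) (by linarith)]
    congr 1
    field_simp
    ring
  · intro t ht
    have hs : 0 < 1 - t := by linarith [ht.2]
    have hs1 : 1 - t ≤ 1 := by linarith [ht.1]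
    have htI : t ∈ Icc (-3 / 4 : ℝ) 1 := ⟨by linarith [ht.1], by linarith⟩
    have hG := (jacobiWeight_mem_Icc g γ htI).2
    have hG0 : 0 < jacobiWeight g γ t := jacobiWeight_pos ⟨by linarith [ht.1], by linarith⟩
    have hw := (jacobiWeight_mem_Icc α β htI).1
    calc (A * 2) ^ (-p) * B⁻¹ * (1 - t)⁻¹
        ≤ (A * 2) ^ (-p) * B⁻¹ * ((1 - t) ^ g) ^ (-p) * (1 - t) ^ α := by
          rw [mul_assoc _ (((1 - t) ^ g) ^ (-p)), ← Real.rpow_mul hs.le, ← Real.rpow_add hs,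
            ← Real.rpow_neg_one (1 - t)]
          refine mul_le_mul_of_nonneg_left ?_ (by positivity)
          have hexp : g * -p + α ≤ -1 := by rw [hg]; linarith
          exact Real.rpow_le_rpow_of_exponent_ge hs hs1 hexp
      _ = (A * (1 - t) ^ g * 2) ^ (-p) * (B⁻¹ * (1 - t) ^ α) := by
          rw [mul_right_comm A, Real.mul_rpow (x := A * 2) (by positivity) (by positivity)]
          ring
      _ ≤ (jacobiWeight g γ t * 2) ^ (-p) * (B⁻¹ * (1 - t) ^ α) := by
          refine mul_le_mul_of_nonneg_right ?_ (by positivity)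
          exact Real.rpow_le_rpow_of_nonpos (by positivity) (by gcongr) (by linarith)
      _ ≤ _ := by gcongr

theorem TwoIntervalBound.lt_of_left {α β p K : ℝ} (hp : 0 < p) (h : TwoIntervalBound α β p K) :
    4 * (α + 1) < p * (2 * α + 5) := by
  by_contra! hcon
  set g := α / 2 + 1 / 4 with hg
  set γ := β / 2 + 1 / 4 with hγ
  set A : ℝ := 4 ^ |γ| with hA
  set A' : ℝ := 4 ^ |g| with hA'
  set B : ℝ := 4 ^ |β| with hB
  set B' : ℝ := 4 ^ |α| with hB'
  have hA0 : 0 < A := by positivity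
  have hA'0 : 0 < A' := by positivity
  have hB0 : 0 < B := by positivity
  have hB'0 : 0 < B' := by positivity
  refine false_of_forall_log_le (c := (A⁻¹ * A'⁻¹) ^ p * (A ^ (-p) * B⁻¹))
    (R := |K| * (B * B' * (5 / 2))) (by positivity) fun ε hε hε' => ?_
  set m : ℝ := A⁻¹ * A'⁻¹ * ε ^ g with hm
  have hm0 : 0 < m := by positivity
  have hle := h (1 - 3 * ε) (1 - 2 * ε) (1 - ε) (1 - ε / 2) 0 (1 - 4 * ε) m (fun t => 1 - t)
    (by linarith) (by linarith) (by linarith) (by linarith) (by linarith) (by linarith)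
    (by linarith) (by linarith) (Or.inr (by linarith)) hm0.le (by
      intro t ht
      refine le_trans ?_ (jacobiWeight_mem_Icc g γ ⟨by linarith [ht.1], by linarith [ht.2]⟩).1
      have h1 := (rpow_mem_Icc_of_mem_Icc g (x := (1 - t) / ε)
        ⟨by rw [le_div_iff₀ hε]; linarith [ht.2], by rw [div_le_iff₀ hε]; linarith [ht.1]⟩).1
      rw [Real.div_rpow (by linarith [ht.2]) hε.le, le_div_iff₀ (by positivity)] at h1
      rw [hm, mul_assoc]
      gcongr)
    (by rintro t ⟨h1, h2⟩ t' ⟨h3, h4⟩; nlinarith)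
    (by fun_prop)
    (by rintro t ⟨h1, h2⟩ t' ⟨h3, h4⟩; rw [abs_le]; constructor <;> linarith)
  have hR : K * ∫ t in (1 - 3 * ε)..(1 - ε / 2), jacobiWeight α β t ≤
      |K| * (B * B' * (5 / 2)) * ε ^ (α + 1) := by
    have h1 := intervalIntegral.norm_integral_le_of_norm_le_const (a := 1 - 3 * ε)
      (b := 1 - ε / 2) (f := jacobiWeight α β) (C := B * (B' * ε ^ α)) (by
        intro t ht
        rw [uIoc_of_le (by linarith)] at ht
        have htI : t ∈ Icc (-3 / 4 : ℝ) 1 := ⟨by linarith [ht.1], by linarith [ht.2]⟩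
        rw [Real.norm_of_nonneg (jacobiWeight_nonneg ⟨by linarith [ht.1], htI.2⟩)]
        refine (jacobiWeight_mem_Icc α β htI).2.trans ?_
        have h1 := (rpow_mem_Icc_of_mem_Icc α (x := (1 - t) / ε)
          ⟨by rw [le_div_iff₀ hε]; linarith [ht.2], by rw [div_le_iff₀ hε]; linarith [ht.1]⟩).2
        rw [Real.div_rpow (by linarith [ht.2]) hε.le, div_le_iff₀ (by positivity)] at h1
        gcongr)
    rw [show 1 - ε / 2 - (1 - 3 * ε) = 5 / 2 * ε by ring, abs_of_pos (by positivity),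
      Real.norm_eq_abs] at h1
    calc K * ∫ t in (1 - 3 * ε)..(1 - ε / 2), jacobiWeight α β t
        ≤ |K| * |∫ t in (1 - 3 * ε)..(1 - ε / 2), jacobiWeight α β t| := by
          rw [← abs_mul]; exact le_abs_self _
      _ ≤ |K| * (B * (B' * ε ^ α) * (5 / 2 * ε)) := by gcongr
      _ = _ := by rw [Real.rpow_add hε, Real.rpow_one]; ring
  have hL := le_integral_of_two_interval (α := α) (β := β) (p := p) (e := 0) (f := 1 - 4 * ε)
    (c := A ^ (-p) * B⁻¹ * ε ^ (α + 1 - p * (g + 1))) (D := fun t => 1 - t)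
    (g := fun t => (1 - t)⁻¹) (by norm_num) (by linarith)
    (by linarith) (by fun_prop) (fun t ht => by linarith [ht.2])
    (continuousOn_inv_one_sub (by linarith))
    (integral_inv_one_sub (by linarith) (by linarith)) (by
      intro t ht
      have hs : 0 < 1 - t := by linarith [ht.2]
      have htI : t ∈ Icc (-3 / 4 : ℝ) 1 := ⟨by linarith [ht.1], by linarith⟩
      have hG := (jacobiWeight_mem_Icc g γ htI).2
      have hG0 : 0 < jacobiWeight g γ t := jacobiWeight_pos ⟨by linarith [ht.1], by linarith⟩
      have hw := (jacobiWeight_mem_Icc α β htI).1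
      calc A ^ (-p) * B⁻¹ * ε ^ (α + 1 - p * (g + 1)) * (1 - t)⁻¹
          ≤ A ^ (-p) * B⁻¹ * (1 - t) ^ (α + 1 - p * (g + 1)) * (1 - t)⁻¹ := by
            gcongr
            · rw [hg]; linarith
            · linarith [ht.2]
        _ = (A * (1 - t) ^ g * (1 - t)) ^ (-p) * (B⁻¹ * (1 - t) ^ α) := by
            rw [mul_assoc A, Real.mul_rpow (by positivity) (by positivity),
              ← Real.rpow_add_one hs.ne', ← Real.rpow_mul hs.le, ← Real.rpow_neg_one (1 - t),
              mul_assoc _ _ ((1 - t) ^ (-1 : ℝ)), ← Real.rpow_add hs,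
              show α + 1 - p * (g + 1) + -1 = (g + 1) * -p + α by ring, Real.rpow_add hs]
            ring
        _ ≤ (jacobiWeight g γ t * (1 - t)) ^ (-p) * (B⁻¹ * (1 - t) ^ α) := by
            refine mul_le_mul_of_nonneg_right ?_ (by positivity)
            exact Real.rpow_le_rpow_of_nonpos (by positivity) (by gcongr) (by linarith)
        _ ≤ _ := by gcongr)
  rw [show (1 - 0 : ℝ) / (1 - (1 - 4 * ε)) = 1 / (4 * ε) by ring] at hL
  rw [show 1 - ε - (1 - 2 * ε) = ε by ring] at hle
  have h1 := (mul_le_mul_of_nonneg_left hL (by positivity : 0 ≤ (m * ε) ^ p)).trans (hle.trans hR)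
  have h2 : (m * ε) ^ p = (A⁻¹ * A'⁻¹) ^ p * ε ^ (p * (g + 1)) := by
    rw [hm, mul_assoc _ (ε ^ g), ← Real.rpow_add_one hε.ne',
      Real.mul_rpow (by positivity) (by positivity), ← Real.rpow_mul hε.le, mul_comm (g + 1)]
  have h3 : ε ^ (p * (g + 1)) * ε ^ (α + 1 - p * (g + 1)) = ε ^ (α + 1) := by
    rw [← Real.rpow_add hε]
    congr 1
    ring
  refine le_of_mul_le_mul_right ?_ (by positivity : 0 < ε ^ (α + 1))
  refine le_trans (le_of_eq ?_) h1
  rw [h2, ← h3]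
  ring

theorem TwoIntervalBound.ne_one {α β p K : ℝ} (h : TwoIntervalBound α β p K) : p ≠ 1 := by
  rintro rfl
  have hbd : ∀ a b : ℝ, ∀ t ∈ Icc (-1 / 16 : ℝ) (1 / 2),
      jacobiWeight a b t ∈ Icc (((4 : ℝ) ^ |b|)⁻¹ * (4 ^ |a|)⁻¹) (4 ^ |b| * 4 ^ |a|) := by
    intro a b t ht
    have h1 := jacobiWeight_mem_Icc a b (t := t) ⟨by linarith [ht.1], by linarith [ht.2]⟩
    have h2 := rpow_mem_Icc_of_mem_Icc a (x := 1 - t) ⟨by linarith [ht.2], by linarith [ht.1]⟩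
    exact ⟨le_trans (mul_le_mul_of_nonneg_left h2.1 (by positivity)) h1.1,
      h1.2.trans (mul_le_mul_of_nonneg_left h2.2 (by positivity))⟩
  have hG := hbd (α / 2 + 1 / 4) (β / 2 + 1 / 4)
  have hw := hbd α β
  set m : ℝ := (4 ^ |β / 2 + 1 / 4|)⁻¹ * (4 ^ |α / 2 + 1 / 4|)⁻¹ with hm
  set A : ℝ := 4 ^ |β / 2 + 1 / 4| * 4 ^ |α / 2 + 1 / 4| with hA
  set b : ℝ := (4 ^ |β|)⁻¹ * (4 ^ |α|)⁻¹ with hb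
  set B : ℝ := 4 ^ |β| * 4 ^ |α| with hB
  have hm0 : 0 < m := by positivity
  have hA0 : 0 < A := by positivity
  have hb0 : 0 < b := by positivity
  have hB0 : 0 < B := by positivity
  refine false_of_forall_log_le (c := m * (A⁻¹ * b)) (R := |K| * (B * 3)) (by positivity)
    fun ε hε hε' => ?_
  have hle := h (-ε) 0 ε (2 * ε) (2 * ε) (1 / 2) m (fun t => t)
    (by linarith) (by linarith) (by linarith) (by linarith) (by linarith) (by linarith)
    (by linarith) (by linarith) (Or.inl (by linarith)) hm0.le
    (fun t ht => (hG t ⟨by linarith [ht.1], by linarith [ht.2]⟩).1)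
    (by rintro t ⟨h1, h2⟩ t' ⟨h3, h4⟩; nlinarith)
    (by fun_prop)
    (by rintro t ⟨h1, h2⟩ t' ⟨h3, h4⟩; rw [abs_le]; constructor <;> linarith)
  have hR : K * ∫ t in (-ε)..(2 * ε), jacobiWeight α β t ≤ |K| * (B * 3) * ε := by
    have h1 := intervalIntegral.norm_integral_le_of_norm_le_const (a := -ε)
      (b := 2 * ε) (f := jacobiWeight α β) (C := B) (by
        intro t ht
        rw [uIoc_of_le (by linarith)] at ht
        rw [Real.norm_of_nonneg (jacobiWeight_nonneg ⟨by linarith [ht.1], by linarith [ht.2]⟩)]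
        exact (hw t ⟨by linarith [ht.1], by linarith [ht.2]⟩).2)
    rw [show 2 * ε - -ε = 3 * ε by ring, abs_of_pos (by positivity), Real.norm_eq_abs] at h1
    calc K * ∫ t in (-ε)..(2 * ε), jacobiWeight α β t
        ≤ |K| * |∫ t in (-ε)..(2 * ε), jacobiWeight α β t| := by
          rw [← abs_mul]; exact le_abs_self _
      _ ≤ |K| * (B * (3 * ε)) := by gcongr
      _ = _ := by ring
  have hL := le_integral_of_two_interval (α := α) (β := β) (p := 1) (e := 2 * ε) (f := 1 / 2)
    (c := A⁻¹ * b) (D := fun t => t) (g := fun t => t⁻¹) (by linarith) (by linarith)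
    (by linarith) (by fun_prop) (fun t ht => by linarith [ht.1])
    (ContinuousOn.inv₀ (by fun_prop) fun t ht => by linarith [ht.1])
    (integral_inv_of_pos (by linarith) (by linarith)) (by
      intro t ht
      have ht0 : 0 < t := by linarith [ht.1]
      have htI : t ∈ Icc (-1 / 16 : ℝ) (1 / 2) := ⟨by linarith, ht.2⟩
      have hG0 : 0 < jacobiWeight (α / 2 + 1 / 4) (β / 2 + 1 / 4) t :=
        hm0.trans_le (hG t htI).1
      have h1 := inv_anti₀ hG0 (hG t htI).2
      have h2 : A⁻¹ * t⁻¹ ≤ (jacobiWeight (α / 2 + 1 / 4) (β / 2 + 1 / 4) t * t) ^ (-1 : ℝ) := by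
        rw [Real.rpow_neg_one, mul_inv (jacobiWeight _ _ t)]
        gcongr
      calc A⁻¹ * b * t⁻¹ = A⁻¹ * t⁻¹ * b := by ring
        _ ≤ _ := mul_le_mul h2 (hw t htI).1 hb0.le (by positivity))
  rw [show (1 / 2 : ℝ) / (2 * ε) = 1 / (4 * ε) by field_simp; norm_num] at hL
  rw [Real.rpow_one, sub_zero] at hle
  have h1 := (mul_le_mul_of_nonneg_left hL (by positivity : 0 ≤ m * ε)).trans (hle.trans hR)
  refine le_of_mul_le_mul_right ?_ hε
  refine le_trans (le_of_eq ?_) h1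
  ring

/-- Theorem 1 (b), (1) ⇒ (2) (exponent part, scalar case): if the scalar
Marcinkiewicz–Zygmund interpolation inequality holds at the Jacobi nodes, then
`μ(α,β) < p < M(α,β)`. -/
theorem exponent_range_of_marcinkiewicz_zygmund_right
    (α β : ℝ) (hα : -1 < α) (hβ : -1 < β)
    (J : JacobiSystem α β) (N : JacobiNodes J)
    (p : ℝ) (hp : 1 ≤ p)
    (cp : ℝ) (hcp : 0 < cp)
    (hineq : ∀ n : ℕ, ∀ q : Polynomial ℝ, q.natDegree ≤ n →
      (∫ t in Ioo (-1:ℝ) 1, |q.eval t| ^ p * jacobiWeight α β t) ^ (1 / p)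
        ≤ cp * (∑ j : Fin (n + 1), N.wt n j * |q.eval (N.node n j)| ^ p) ^ (1 / p)) :
    muExp α β < p ∧ ENNReal.ofReal p < MExp α β := by
  obtain ⟨K, hK⟩ := twoIntervalBound_of_marcinkiewicz_zygmund hα hβ N hp hcp hineq
  have hp0 : 0 < p := by linarith
  have hp1 : 1 < p := lt_of_le_of_ne hp hK.ne_one.symm
  have hα1 := hK.lt_of_right hp0
  have hα2 := hK.lt_of_left hp0
  have hβ1 := hK.swap.lt_of_right hp0
  have hβ2 := hK.swap.lt_of_left hp0
  refine ⟨max_lt hp1 (max_lt ?_ ?_), ?_⟩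
  · rw [div_lt_iff₀ (by linarith)]
    exact hα2
  · rw [div_lt_iff₀ (by linarith)]
    exact hβ2
  · have hm : p * (mExp α β - 1) < mExp α β := by
      have h3 : p * (mExp α β - 1) - mExp α β = (p - 1) * mExp α β - p := by ring
      have h4 : mExp α β < p / (p - 1) := by
        refine max_lt ?_ (max_lt ?_ ?_)
        · rw [lt_div_iff₀ (by linarith)]
          linarith
        · rw [div_lt_div_iff₀ (by linarith) (by linarith)]
          linarith
        · rw [div_lt_div_iff₀ (by linarith) (by linarith)]
          linarith
      rw [lt_div_iff₀ (by linarith)] at h4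
      linarith
    rw [MExp]
    split_ifs with h1
    · exact ENNReal.ofReal_lt_top
    · have h2 : 1 < mExp α β := lt_of_le_of_ne (le_max_left _ _) (Ne.symm h1)
      rw [ENNReal.ofReal_lt_ofReal_iff (by apply div_pos <;> linarith),
        lt_div_iff₀ (by linarith)]
      exact hm
end

section
/- Let X be a Banach space and α,β>−1, and suppose X has Jacobi (p_n^{(α,β)})-type 2: there exists c>0 such that for all m∈ℕ and all x_0,…,x_m∈X, (∫_{−1}^{1} ‖∑_{j=0}^m p_j^{(α,β)}(t) x_j‖² w_{α,β}(t) dt)^{1/2} ≤ c·(∑_{j=0}^m ‖x_j‖²)^{1/2}. Then X is isomorphic to a Hilbert space. -/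
open MeasureTheory Set Filter
open scoped ENNReal

universe u

/-- `X` is isomorphic to a Hilbert space: there exist a (real) Hilbert space `H` and a
continuous linear bijection `X → H` with continuous inverse. -/
def IsIsomorphicToHilbertSpace (X : Type u) [NormedAddCommGroup X] [NormedSpace ℝ X] : Prop :=
  ∃ (H : Type u) (hn : NormedAddCommGroup H),
    letI := hn
    ∃ (hi : InnerProductSpace ℝ H),
      letI := hi
      Nonempty (X ≃L[ℝ] H)

namespace JacobiSystem

open Polynomial

variable {α β : ℝ}

theorem integrableOn_weight (J : JacobiSystem α β) :
    IntegrableOn (jacobiWeight α β) (Ioo (-1) 1) := by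
  obtain ⟨a, ha⟩ : ∃ a, J.P 0 = C a :=
    ⟨_, eq_C_of_natDegree_eq_zero (J.natDegree_eq 0)⟩
  have h := J.orthonormal 0 0
  simp only [ha, eval_C, if_true] at h
  by_contra hw
  have ha0 : a * a ≠ 0 := by
    rintro h0
    simp [h0] at h
  refine hw ?_
  have hi : IntegrableOn (fun t => a * a * jacobiWeight α β t) (Ioo (-1) 1) := by
    by_contra hn
    rw [integral_undef hn] at h
    exact zero_ne_one h
  have := hi.const_mul (a * a)⁻¹
  refine this.congr (Eventually.of_forall fun t => ?_)
  simp only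
  rw [← mul_assoc, inv_mul_cancel₀ ha0, one_mul]

theorem integrableOn_mul_weight (J : JacobiSystem α β) {f : ℝ → ℝ} (hf : Continuous f) :
    IntegrableOn (fun t => f t * jacobiWeight α β t) (Ioo (-1) 1) := by
  rw [← integrableOn_Icc_iff_integrableOn_Ioo]
  refine IntegrableOn.continuousOn_mul hf.continuousOn ?_ isCompact_Icc
  rw [integrableOn_Icc_iff_integrableOn_Ioo]
  exact J.integrableOn_weight

variable (J : JacobiSystem α β)

/-- Integration against the Jacobi weight, as a linear functional on polynomials. -/
noncomputable def moment : ℝ[X] →ₗ[ℝ] ℝ where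
  toFun p := ∫ t in Ioo (-1:ℝ) 1, p.eval t * jacobiWeight α β t
  map_add' p q := by
    rw [← integral_add (J.integrableOn_mul_weight p.continuous)
      (J.integrableOn_mul_weight q.continuous)]
    simp [add_mul]
  map_smul' a p := by
    simp [mul_assoc, integral_const_mul]

theorem moment_apply (p : ℝ[X]) :
    J.moment p = ∫ t in Ioo (-1:ℝ) 1, p.eval t * jacobiWeight α β t := rfl

theorem moment_P_mul_P (n m : ℕ) : J.moment (J.P n * J.P m) = if n = m then 1 else 0 := by
  rw [moment_apply, ← J.orthonormal n m]
  simp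

theorem ne_zero (n : ℕ) : J.P n ≠ 0 := leadingCoeff_ne_zero.mp (J.leadingCoeff_pos n).ne'

theorem degree_eq (n : ℕ) : (J.P n).degree = n := by
  rw [degree_eq_natDegree (J.ne_zero n), J.natDegree_eq]

theorem coeff_self_pos (n : ℕ) : 0 < (J.P n).coeff n := by
  have := J.leadingCoeff_pos n
  rwa [leadingCoeff, J.natDegree_eq] at this

theorem expansion {n : ℕ} {p : ℝ[X]} (hp : p.degree < n) :
    p = ∑ j ∈ Finset.range n, C (J.moment (p * J.P j)) * J.P j := by
  have key : ∃ c : ℕ → ℝ, p = ∑ j ∈ Finset.range n, C (c j) * J.P j := by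
    induction n generalizing p with
    | zero => exact ⟨0, by simpa [degree_lt_iff_coeff_zero, Polynomial.ext_iff] using hp⟩
    | succ n ih =>
      set a := p.coeff n / (J.P n).coeff n with ha
      have hq : (p - C a * J.P n).degree < n := by
        rw [degree_lt_iff_coeff_zero] at hp ⊢
        intro m hm
        rcases hm.eq_or_lt with rfl | hm
        · simp [ha, (J.coeff_self_pos n).ne']
        · rw [coeff_sub, coeff_C_mul, hp m (by lia), coeff_eq_zero_of_natDegree_lt
            (by rw [J.natDegree_eq]; exact hm)]
          simp
      obtain ⟨c, hc⟩ := ih hq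
      refine ⟨fun j => if j = n then a else c j, ?_⟩
      rw [Finset.sum_range_succ]
      simp only [if_true]
      rw [← sub_eq_iff_eq_add, hc]
      refine Finset.sum_congr rfl fun j hj => ?_
      rw [if_neg (Finset.mem_range.mp hj).ne]
  obtain ⟨c, hc⟩ := key
  have hcoef : ∀ j ∈ Finset.range n, J.moment (p * J.P j) = c j := by
    intro j hj
    rw [hc, Finset.sum_mul, map_sum, Finset.sum_eq_single_of_mem j hj]
    · rw [mul_assoc, ← smul_eq_C_mul, map_smul, moment_P_mul_P]; simp
    · intro i _ hij
      rw [mul_assoc, ← smul_eq_C_mul, map_smul, moment_P_mul_P]; simp [hij]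
  conv_lhs => rw [hc]
  exact Finset.sum_congr rfl fun j hj => by rw [hcoef j hj]

theorem moment_mul_eq_zero {n : ℕ} {q : ℝ[X]} (hq : q.degree < n) :
    J.moment (J.P n * q) = 0 := by
  rw [J.expansion hq, Finset.mul_sum, map_sum]
  refine Finset.sum_eq_zero fun j hj => ?_
  rw [mul_left_comm, ← smul_eq_C_mul, map_smul, moment_P_mul_P,
    if_neg (Finset.mem_range.mp hj).ne', smul_zero]

theorem eq_zero_of_moment_eq_zero {n : ℕ} {p : ℝ[X]} (hp : p.degree < n)
    (h : ∀ q : ℝ[X], q.degree < n → J.moment (p * q) = 0) : p = 0 := by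
  rw [J.expansion hp]
  refine Finset.sum_eq_zero fun j hj => ?_
  rw [h _ (by rw [J.degree_eq]; exact_mod_cast Finset.mem_range.mp hj)]
  simp

/-- The moment functional satisfies the Pearson equation. -/
theorem moment_pearson (hα : -1 < α) (hβ : -1 < β) (p : ℝ[X]) :
    J.moment ((1 - X ^ 2) * derivative p + (C (β - α) - C (α + β + 2) * X) * p) = 0 := by
  have hα' : 0 < α + 1 := by linarith
  have hβ' : 0 < β + 1 := by linarith
  rw [moment_apply, ← integral_Ioc_eq_integral_Ioo,
    ← intervalIntegral.integral_of_le (by norm_num)]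
  set F : ℝ → ℝ := fun t => (1 - t) ^ (α + 1) * (1 + t) ^ (β + 1) * p.eval t with hF
  rw [intervalIntegral.integral_eq_sub_of_hasDerivAt_of_le (f := F) (by norm_num)]
  · simp [hF, Real.zero_rpow hα'.ne', Real.zero_rpow hβ'.ne']
  · refine Continuous.continuousOn ?_
    refine (Continuous.mul ?_ ?_).mul p.continuous
    · exact (continuous_const.sub continuous_id).rpow_const fun _ => Or.inr hα'.le
    · exact (continuous_const.add continuous_id).rpow_const fun _ => Or.inr hβ'.le
  · intro t ht
    have h1 : 0 < 1 - t := by linarith [ht.2]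
    have h2 : 0 < 1 + t := by linarith [ht.1]
    have d1 : HasDerivAt (fun t : ℝ => (1 - t) ^ (α + 1)) (-1 * (α + 1) * (1 - t) ^ (α + 1 - 1)) t :=
      ((hasDerivAt_id t).const_sub 1).rpow_const (Or.inl h1.ne')
    have d2 : HasDerivAt (fun t : ℝ => (1 + t) ^ (β + 1)) (1 * (β + 1) * (1 + t) ^ (β + 1 - 1)) t :=
      ((hasDerivAt_id t).const_add 1).rpow_const (Or.inl h2.ne')
    refine ((d1.mul d2).mul (p.hasDerivAt t)).congr_deriv ?_
    simp only [Pi.mul_apply, jacobiWeight, eval_add, eval_mul, eval_sub, eval_one, eval_pow, eval_X,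
      eval_C,
      add_sub_cancel_right, Real.rpow_add_one h1.ne', Real.rpow_add_one h2.ne']
    ring
  · rw [intervalIntegrable_iff_integrableOn_Ioo_of_le (by norm_num)]
    exact J.integrableOn_mul_weight (Polynomial.continuous _)

/-- The Jacobi differential operator. -/
noncomputable def diffOp (α β : ℝ) (p : ℝ[X]) : ℝ[X] :=
  (1 - X ^ 2) * derivative (derivative p) + (C (β - α) - C (α + β + 2) * X) * derivative p

theorem coeff_diffOp (p : ℝ[X]) (k : ℕ) :
    (diffOp α β p).coeff k = (k + 2) * (k + 1) * p.coeff (k + 2) +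
      (β - α) * (k + 1) * p.coeff (k + 1) - k * (k + α + β + 1) * p.coeff k := by
  have h : diffOp α β p = derivative (derivative p) - derivative (derivative p) * X ^ 2 +
      C (β - α) * derivative p - C (α + β + 2) * (derivative p * X) := by
    rw [diffOp]; ring
  rw [h, coeff_sub, coeff_add, coeff_sub, coeff_C_mul, coeff_C_mul]
  rcases k with _ | _ | k
  · simp [coeff_derivative]; ring
  · simp [coeff_derivative, coeff_mul_X_pow']; ring
  · simp [coeff_derivative, coeff_mul_X_pow', coeff_mul_X]; ring

theorem moment_diffOp_comm (hα : -1 < α) (hβ : -1 < β) (p q : ℝ[X]) :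
    J.moment (diffOp α β p * q) = J.moment (p * diffOp α β q) := by
  have h1 := J.moment_pearson hα hβ (derivative p * q)
  have h2 := J.moment_pearson hα hβ (p * derivative q)
  have h3 : diffOp α β p * q - p * diffOp α β q =
      ((1 - X ^ 2) * derivative (derivative p * q) +
        (C (β - α) - C (α + β + 2) * X) * (derivative p * q)) -
      ((1 - X ^ 2) * derivative (p * derivative q) +
        (C (β - α) - C (α + β + 2) * X) * (p * derivative q)) := by
    simp only [diffOp, derivative_mul]
    ring
  rw [← sub_eq_zero, ← map_sub, h3, map_sub, h1, h2, sub_zero]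

theorem degree_diffOp_lt {q : ℝ[X]} {n : ℕ} (hq : q.degree < n) : (diffOp α β q).degree < n := by
  rw [degree_lt_iff_coeff_zero] at hq ⊢
  intro m hm
  rw [coeff_diffOp, hq m hm, hq _ (by lia), hq _ (by lia)]
  ring

theorem diffOp_P (hα : -1 < α) (hβ : -1 < β) (n : ℕ) :
    diffOp α β (J.P n) = -C (n * (n + α + β + 1)) * J.P n := by
  have hz : diffOp α β (J.P n) + C (n * (n + α + β + 1)) * J.P n = 0 := by
    have hd : ∀ m, n < m → (J.P n).coeff m = 0 := fun m hm =>
      coeff_eq_zero_of_natDegree_lt (by rwa [J.natDegree_eq])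
    refine J.eq_zero_of_moment_eq_zero (n := n) ?_ fun q hq => ?_
    · rw [degree_lt_iff_coeff_zero]
      intro m hm
      rw [coeff_add, coeff_diffOp, coeff_C_mul, hd _ (by lia), hd _ (by lia)]
      rcases hm.eq_or_lt with rfl | hm
      · ring
      · rw [hd m hm]; ring
    · rw [add_mul, map_add, J.moment_diffOp_comm hα hβ, J.moment_mul_eq_zero (degree_diffOp_lt hq),
        mul_assoc, ← smul_eq_C_mul, map_smul, J.moment_mul_eq_zero hq]
      simp
  rw [neg_mul]
  exact eq_neg_of_add_eq_zero_left hz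

theorem coeff_relation (hα : -1 < α) (hβ : -1 < β) (n k : ℕ) :
    (n * (n + α + β + 1) - k * (k + α + β + 1)) * (J.P n).coeff k =
      -((k + 2) * (k + 1) * (J.P n).coeff (k + 2) + (β - α) * (k + 1) * (J.P n).coeff (k + 1)) := by
  have := congrArg (fun p => p.coeff k) (J.diffOp_P hα hβ n)
  simp only [coeff_diffOp, ← C_neg, coeff_C_mul] at this
  linarith

/-- Off-diagonal recurrence coefficients. -/
noncomputable def recA (n : ℕ) : ℝ := J.moment (X * J.P n * J.P (n + 1))

/-- Diagonal recurrence coefficients. -/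
noncomputable def recB (n : ℕ) : ℝ := J.moment (X * J.P n * J.P n)

theorem X_mul_P_succ (m : ℕ) :
    X * J.P (m + 1) = C (J.recA (m + 1)) * J.P (m + 2) + C (J.recB (m + 1)) * J.P (m + 1)
      + C (J.recA m) * J.P m := by
  have hdeg : (X * J.P (m + 1)).degree < ((m + 3 : ℕ) : WithBot ℕ) := by
    rw [degree_mul, degree_X, J.degree_eq]
    norm_cast
    lia
  rw [J.expansion hdeg, Finset.sum_range_succ, Finset.sum_range_succ, Finset.sum_range_succ,
    Finset.sum_eq_zero, zero_add]
  · rw [recA, recB, recA,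
      show X * J.P (m + 1) * J.P m = X * J.P m * J.P (m + 1) by ring]
    ring
  · intro j hj
    have : J.moment (J.P (m + 1) * (X * J.P j)) = 0 := by
      refine J.moment_mul_eq_zero ?_
      have := Finset.mem_range.mp hj
      rw [degree_mul, degree_X, J.degree_eq]
      norm_cast
      lia
    rw [show X * J.P (m + 1) * J.P j = J.P (m + 1) * (X * J.P j) by ring, this]
    simp

end JacobiSystem

theorem tendsto_add_div_two_mul_add (a c : ℝ) :
    Tendsto (fun n : ℕ => ((n : ℝ) + a) / (2 * n + c)) atTop (nhds (1 / 2)) := by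
  have hn : Tendsto (fun n : ℕ => 2 * (n : ℝ) + c) atTop atTop :=
    tendsto_atTop_add_const_right _ _
      (tendsto_natCast_atTop_atTop.const_mul_atTop (by norm_num : (0:ℝ) < 2))
  have h : Tendsto (fun n : ℕ => 1 / 2 + (a - c / 2) * (2 * (n : ℝ) + c)⁻¹) atTop
      (nhds (1 / 2 + (a - c / 2) * 0)) :=
    (hn.inv_tendsto_atTop.const_mul _).const_add _
  rw [mul_zero, add_zero] at h
  refine h.congr' ?_
  filter_upwards [hn.eventually_gt_atTop 0] with n hn
  field_simp
  ring

namespace JacobiSystem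

open Polynomial

variable {α β : ℝ} (J : JacobiSystem α β)

theorem coeff_succ_eq (m : ℕ) :
    (J.P m).coeff m = J.recA m * (J.P (m + 1)).coeff (m + 1) := by
  have h := J.moment_P_mul_P (m + 1) (m + 1)
  have hd : (X * J.P m - C ((J.P m).coeff m / (J.P (m + 1)).coeff (m + 1)) * J.P (m + 1)).degree
      < ((m + 1 : ℕ) : WithBot ℕ) := by
    rw [degree_lt_iff_coeff_zero]
    intro k hk
    obtain ⟨k, rfl⟩ : ∃ l, k = l + 1 := ⟨k - 1, by lia⟩
    rw [coeff_sub, coeff_C_mul, coeff_X_mul]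
    rcases hk.eq_or_lt with hk | hk
    · obtain rfl : m = k := by lia
      rw [div_mul_cancel₀ _ (J.coeff_self_pos _).ne', sub_self]
    · have h1 : (J.P m).coeff k = 0 :=
        coeff_eq_zero_of_natDegree_lt (by rw [J.natDegree_eq]; lia)
      have h2 : (J.P (m + 1)).coeff (k + 1) = 0 :=
        coeff_eq_zero_of_natDegree_lt (by rw [J.natDegree_eq]; lia)
      rw [h1, h2, mul_zero, sub_zero]
  have h0 := J.moment_mul_eq_zero hd
  rw [mul_sub, map_sub, mul_left_comm _ (C _), ← smul_eq_C_mul, map_smul, h, if_pos rfl,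
    sub_eq_zero, mul_comm] at h0
  rw [recA, h0]
  simp [(J.coeff_self_pos _).ne']

theorem recA_pos (m : ℕ) : 0 < J.recA m := by
  have := J.coeff_succ_eq m
  exact pos_of_mul_pos_left (this ▸ J.coeff_self_pos m) (J.coeff_self_pos _).le

/-- The ratio of the second coefficient to the leading one. -/
noncomputable def ratioOne (m : ℕ) : ℝ := (J.P (m + 2)).coeff (m + 1) / (J.P (m + 2)).coeff (m + 2)

/-- The ratio of the third coefficient to the leading one. -/
noncomputable def ratioTwo (m : ℕ) : ℝ := (J.P (m + 2)).coeff m / (J.P (m + 2)).coeff (m + 2)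

theorem ratioOne_eq (hα : -1 < α) (hβ : -1 < β) (m : ℕ) :
    J.ratioOne m = -(β - α) * ((m + 2) / (2 * m + (4 + α + β))) := by
  have h := J.coeff_relation hα hβ (m + 2) (m + 1)
  have hpos := J.coeff_self_pos (m + 2)
  have hz : (J.P (m + 2)).coeff (m + 1 + 2) = 0 :=
    coeff_eq_zero_of_natDegree_lt (by rw [J.natDegree_eq]; lia)
  have hm : (0:ℝ) < 2 * m + (4 + α + β) := by
    have : (0:ℝ) ≤ m := m.cast_nonneg
    linarith
  rw [hz] at h
  push_cast at h
  rw [ratioOne, ← mul_div_assoc, div_eq_div_iff hpos.ne' hm.ne']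
  linear_combination h

theorem ratioTwo_eq (hα : -1 < α) (hβ : -1 < β) (m : ℕ) :
    J.ratioTwo m = -((m + 1) * (m + 2) / (2 * (2 * m + (3 + α + β)))) -
      (β - α) / 2 * ((m + 1) / (2 * m + (3 + α + β)) * J.ratioOne m) := by
  have h := J.coeff_relation hα hβ (m + 2) m
  have hpos := J.coeff_self_pos (m + 2)
  have hm : (0:ℝ) < 2 * m + (3 + α + β) := by
    have : (0:ℝ) ≤ m := m.cast_nonneg
    linarith
  push_cast at h
  rw [ratioOne, ratioTwo]
  generalize hD : 2 * (m:ℝ) + (3 + α + β) = D at *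
  field_simp
  rw [← hD]
  linear_combination h

theorem recB_eq (m : ℕ) : J.recB (m + 2) = J.ratioOne m - J.ratioOne (m + 1) := by
  have h := congrArg (fun p => p.coeff (m + 2)) (J.X_mul_P_succ (m + 1))
  have h1 := J.coeff_succ_eq (m + 2)
  have hz : (J.P (m + 1)).coeff (m + 2) = 0 :=
    coeff_eq_zero_of_natDegree_lt (by rw [J.natDegree_eq]; lia)
  have hp2 := J.coeff_self_pos (m + 2)
  have hp3 := J.coeff_self_pos (m + 2 + 1)
  simp only [coeff_X_mul, coeff_add, coeff_C_mul, add_assoc, Nat.reduceAdd] at h h1 hp2 hp3 hz ⊢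
  rw [hz] at h
  simp only [ratioOne, add_assoc, Nat.reduceAdd]
  rw [div_sub_div _ _ hp2.ne' hp3.ne', eq_div_iff (mul_pos hp2 hp3).ne']
  linear_combination (J.P (m + 3)).coeff (m + 2) * h1 - (J.P (m + 3)).coeff (m + 3) * h

theorem recA_sq_eq (m : ℕ) : J.recA (m + 1) ^ 2 =
    J.ratioTwo m - J.ratioTwo (m + 1) - J.recB (m + 2) * J.ratioOne m := by
  have h := congrArg (fun p => p.coeff (m + 1)) (J.X_mul_P_succ (m + 1))
  have h1 := J.coeff_succ_eq (m + 2)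
  have h2 := J.coeff_succ_eq (m + 1)
  have hp2 := J.coeff_self_pos (m + 2)
  have hp3 := J.coeff_self_pos (m + 2 + 1)
  simp only [coeff_X_mul, coeff_add, coeff_C_mul, add_assoc, Nat.reduceAdd] at h h1 h2 hp2 hp3 ⊢
  simp only [ratioOne, ratioTwo, add_assoc, Nat.reduceAdd]
  rw [h2] at h
  field_simp
  linear_combination (J.P (m + 3)).coeff (m + 1) * h1 - (J.P (m + 3)).coeff (m + 3) * h

theorem tendsto_ratioOne (hα : -1 < α) (hβ : -1 < β) :
    Tendsto J.ratioOne atTop (nhds (-(β - α) * (1 / 2))) :=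
  ((tendsto_add_div_two_mul_add 2 (4 + α + β)).const_mul (-(β - α))).congr
    fun m => (J.ratioOne_eq hα hβ m).symm

theorem tendsto_recB (hα : -1 < α) (hβ : -1 < β) : Tendsto J.recB atTop (nhds 0) := by
  rw [← tendsto_add_atTop_iff_nat 2]
  have h := J.tendsto_ratioOne hα hβ
  have := h.sub ((tendsto_add_atTop_iff_nat 1).mpr h)
  rw [sub_self] at this
  exact this.congr fun m => (J.recB_eq m).symm

theorem tendsto_recA (hα : -1 < α) (hβ : -1 < β) : Tendsto J.recA atTop (nhds (1 / 2)) := by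
  have hs := J.tendsto_ratioOne hα hβ
  have hB := (tendsto_add_atTop_iff_nat 2).mpr (J.tendsto_recB hα hβ)
  have hft := ((tendsto_add_div_two_mul_add 1 (3 + α + β)).mul hs).const_mul ((β - α) / 2)
  have hfd := ((tendsto_add_atTop_iff_nat 1).mpr hft).sub hft
  have he := (tendsto_add_div_two_mul_add 2 (3 + α + β)).mul
    (tendsto_add_div_two_mul_add (2 + α + β) (5 + α + β))
  have hsq : Tendsto (fun m => J.recA (m + 1) ^ 2) atTop (nhds (1 / 4)) := by
    have hlim := (he.add hfd).sub (hB.mul hs)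
    rw [sub_self, zero_mul, sub_zero, add_zero, show (1:ℝ) / 2 * (1 / 2) = 1 / 4 by norm_num]
      at hlim
    refine hlim.congr fun m => ?_
    rw [recA_sq_eq, J.ratioTwo_eq hα hβ m, J.ratioTwo_eq hα hβ (m + 1)]
    have hm1 : (0:ℝ) < 2 * m + (3 + α + β) := by
      have : (0:ℝ) ≤ m := m.cast_nonneg
      linarith
    have hm2 : 2 * ((m + 1 : ℕ) : ℝ) + (3 + α + β) = 2 * m + (3 + α + β) + 2 := by
      push_cast; ring
    have hm3 : 2 * (m : ℝ) + (5 + α + β) = 2 * m + (3 + α + β) + 2 := by ring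
    have hm4 : (m : ℝ) + (2 + α + β) = 2 * m + (3 + α + β) - m - 1 := by ring
    rw [hm2, hm3, hm4]
    push_cast
    generalize 2 * (m:ℝ) + (3 + α + β) = D at *
    have hD : 0 < D + 2 := by linarith
    field_simp
    ring
  rw [← tendsto_add_atTop_iff_nat 1]
  have := hsq.sqrt
  rw [show (1:ℝ) / 4 = (1 / 2) ^ 2 by norm_num, Real.sqrt_sq (by norm_num)] at this
  exact this.congr fun m => Real.sqrt_sq (J.recA_pos _).le

end JacobiSystem

theorem sum_exp_eq {N : ℕ} (hN : N ≠ 0) (d : ℤ) :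
    ∑ k ∈ Finset.range N, Complex.exp (((d * (2 * Real.pi * k / N) : ℝ) : ℂ) * Complex.I) =
      if (N : ℤ) ∣ d then (N : ℂ) else 0 := by
  have hNC : (N : ℂ) ≠ 0 := Nat.cast_ne_zero.mpr hN
  have hpi : (2 * Real.pi * Complex.I : ℂ) ≠ 0 := Complex.two_pi_I_ne_zero
  set z : ℂ := Complex.exp (d / N * (2 * Real.pi * Complex.I)) with hz
  have hterm : ∀ k : ℕ, Complex.exp (((d * (2 * Real.pi * k / N) : ℝ) : ℂ) * Complex.I) = z ^ k := by
    intro k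
    rw [hz, ← Complex.exp_nat_mul]
    congr 1
    push_cast
    ring
  simp only [hterm]
  split_ifs with h
  · obtain ⟨e, rfl⟩ := h
    have : z = 1 := by
      rw [hz, Complex.exp_eq_one_iff]
      refine ⟨e, ?_⟩
      push_cast
      field_simp
    simp [this]
  · have hz1 : z ≠ 1 := by
      rw [hz, Ne, Complex.exp_eq_one_iff]
      rintro ⟨e, he⟩
      have := mul_right_cancel₀ hpi he
      rw [div_eq_iff hNC] at this
      refine h ⟨e, ?_⟩
      rw [mul_comm]
      exact_mod_cast this
    have hzN : z ^ N = 1 := by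
      rw [hz, ← Complex.exp_nat_mul, Complex.exp_eq_one_iff]
      refine ⟨d, ?_⟩
      field_simp
    rw [geom_sum_eq hz1, hzN, sub_self, zero_div]

theorem sum_cos_eq {N : ℕ} (hN : N ≠ 0) (d : ℤ) :
    ∑ k ∈ Finset.range N, Real.cos (d * (2 * Real.pi * k / N)) =
      if (N : ℤ) ∣ d then (N : ℝ) else 0 := by
  have := congrArg Complex.re (sum_exp_eq hN d)
  rw [Complex.re_sum] at this
  simp only [Complex.exp_ofReal_mul_I_re] at this
  rw [this]
  split_ifs <;> simp

theorem sum_sin_eq {N : ℕ} (hN : N ≠ 0) (d : ℤ) :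
    ∑ k ∈ Finset.range N, Real.sin (d * (2 * Real.pi * k / N)) = 0 := by
  have := congrArg Complex.im (sum_exp_eq hN d)
  rw [Complex.im_sum] at this
  simp only [Complex.exp_ofReal_mul_I_im] at this
  rw [this]
  split_ifs <;> simp

theorem sum_sum_cos_sub_mul (s : Finset ℕ) (v f : ℕ → ℝ) :
    ∑ i ∈ s, ∑ j ∈ s, v i * v j * Real.cos (f i - f j) =
      (∑ i ∈ s, v i * Real.cos (f i)) ^ 2 + (∑ i ∈ s, v i * Real.sin (f i)) ^ 2 := by
  simp only [sq, Finset.sum_mul_sum, ← Finset.sum_add_distrib, Real.cos_sub]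
  refine Finset.sum_congr rfl fun i _ => Finset.sum_congr rfl fun j _ => ?_
  ring

section Fejer

open Polynomial

/-- The Fejér-type polynomial `∑_{r,s<L} cos((r-s)θ) T_{r-s}`. -/
noncomputable def fejerPoly (L : ℕ) (θ : ℝ) : ℝ[X] :=
  ∑ r ∈ Finset.range L, ∑ s ∈ Finset.range L,
    C (Real.cos (((r - s : ℤ) : ℝ) * θ)) * Chebyshev.T ℝ (r - s)

theorem eval_fejerPoly (L : ℕ) (θ t : ℝ) : (fejerPoly L θ).eval t =
    ∑ r ∈ Finset.range L, ∑ s ∈ Finset.range L,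
      Real.cos (((r - s : ℤ) : ℝ) * θ) * (Chebyshev.T ℝ (r - s)).eval t := by
  simp [fejerPoly, eval_finsetSum]

theorem eval_fejerPoly_nonneg (L : ℕ) (θ : ℝ) {t : ℝ} (ht : t ∈ Icc (-1:ℝ) 1) :
    0 ≤ (fejerPoly L θ).eval t := by
  obtain ⟨φ, rfl⟩ : ∃ φ, Real.cos φ = t := ⟨_, Real.cos_arccos ht.1 ht.2⟩
  have h1 := sum_sum_cos_sub_mul (Finset.range L) (fun _ => 1) fun r => r * (θ - φ)
  have h2 := sum_sum_cos_sub_mul (Finset.range L) (fun _ => 1) fun r => r * (θ + φ)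
  have : (fejerPoly L θ).eval (Real.cos φ) =
      (∑ r ∈ Finset.range L, ∑ s ∈ Finset.range L, 1 * 1 * Real.cos (r * (θ - φ) - s * (θ - φ)) +
       ∑ r ∈ Finset.range L, ∑ s ∈ Finset.range L,
        1 * 1 * Real.cos (r * (θ + φ) - s * (θ + φ))) / 2 := by
    rw [eval_fejerPoly, ← Finset.sum_add_distrib, Finset.sum_div]
    refine Finset.sum_congr rfl fun r _ => ?_
    rw [← Finset.sum_add_distrib, Finset.sum_div]
    refine Finset.sum_congr rfl fun s _ => ?_
    rw [Chebyshev.T_real_cos, one_mul, one_mul, one_mul,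
      show (r * (θ - φ) - s * (θ - φ) : ℝ) = ((r - s : ℤ) : ℝ) * θ - ((r - s : ℤ) : ℝ) * φ by
        push_cast; ring,
      show (r * (θ + φ) - s * (θ + φ) : ℝ) = ((r - s : ℤ) : ℝ) * θ + ((r - s : ℤ) : ℝ) * φ by
        push_cast; ring, Real.cos_sub, Real.cos_add]
    ring
  rw [this, h1, h2]
  positivity

theorem sum_eval_fejerPoly_le {N : ℕ} (hN : N ≠ 0) {t : ℝ} (ht : t ∈ Icc (-1:ℝ) 1) :
    ∑ k ∈ Finset.range N, (fejerPoly (2 * N) (2 * Real.pi * k / N)).eval t ≤ 6 * N ^ 2 := by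
  obtain ⟨φ, rfl⟩ : ∃ φ, Real.cos φ = t := ⟨_, Real.cos_arccos ht.1 ht.2⟩
  simp only [eval_fejerPoly, Chebyshev.T_real_cos]
  rw [Finset.sum_comm]
  have hrow : ∀ r ∈ Finset.range (2 * N), ∑ k ∈ Finset.range N, ∑ s ∈ Finset.range (2 * N),
      Real.cos (((r - s : ℤ) : ℝ) * (2 * Real.pi * k / N)) *
        Real.cos (((r - s : ℤ) : ℝ) * φ) ≤ 3 * N := by
    intro r hr
    rw [Finset.sum_comm]
    simp only [← Finset.sum_mul, sum_cos_eq hN]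
    calc ∑ s ∈ Finset.range (2 * N), (if (N : ℤ) ∣ (r - s : ℤ) then (N : ℝ) else 0) *
          Real.cos (((r - s : ℤ) : ℝ) * φ)
        ≤ ∑ s ∈ Finset.range (2 * N), if (N : ℤ) ∣ (r - s : ℤ) then (N : ℝ) else 0 := by
          refine Finset.sum_le_sum fun s _ => mul_le_of_le_one_right ?_ (Real.cos_le_one _)
          split_ifs <;> positivity
      _ = ((Finset.range (2 * N)).filter fun s : ℕ => (N : ℤ) ∣ (r - s : ℤ)).card * (N : ℝ) := by
          rw [← Finset.sum_filter, Finset.sum_const, nsmul_eq_mul]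
      _ ≤ 3 * N := by
          gcongr
          have hsub : ((Finset.range (2 * N)).filter fun s : ℕ => (N : ℤ) ∣ (r - s : ℤ)) ⊆
              {r - N, r, r + N} := by
            intro s hs
            rw [Finset.mem_filter, Finset.mem_range] at hs
            rw [Finset.mem_range] at hr
            obtain ⟨hs, e, he⟩ := hs
            have he1 : e < 2 := by
              by_contra! h
              nlinarith
            have he2 : -2 < e := by
              by_contra! h
              nlinarith
            simp only [Finset.mem_insert, Finset.mem_singleton]
            have : e = -1 ∨ e = 0 ∨ e = 1 := by lia
            rcases this with rfl | rfl | rfl <;> lia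
          exact_mod_cast (Finset.card_le_card hsub).trans Finset.card_le_three
  calc _ ≤ ∑ r ∈ Finset.range (2 * N), (3 * N : ℝ) := Finset.sum_le_sum hrow
    _ = 6 * N ^ 2 := by simp; ring

/-- Number of pairs in a square on a given diagonal. -/
theorem sum_sum_diagonal (L : ℕ) (d : ℤ) (hd : |d| ≤ L) :
    ∑ r ∈ Finset.range L, ∑ s ∈ Finset.range L, (if d = (r - s : ℤ) then (1 : ℝ) else 0) =
      L - |d| := by
  have hin : ∀ r ∈ Finset.range L,
      ∑ s ∈ Finset.range L, (if d = (r - s : ℤ) then (1 : ℝ) else 0) =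
        if d ≤ r ∧ r < L + d then 1 else 0 := by
    intro r _
    split_ifs with h
    · rw [Finset.sum_eq_single (r - d).toNat]
      · rw [if_pos (by lia)]
      · intro s _ hs
        rw [if_neg (by lia)]
      · intro hs
        rw [Finset.mem_range] at hs
        lia
    · refine Finset.sum_eq_zero fun s hs => if_neg ?_
      rw [Finset.mem_range] at hs
      lia
  rw [Finset.sum_congr rfl hin, ← Finset.sum_filter, Finset.sum_const, nsmul_eq_mul, mul_one]
  have hset : ((Finset.range L).filter fun r : ℕ => d ≤ r ∧ r < L + d) =
      Finset.Ico d.toNat (min L (L + d).toNat) := by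
    ext r
    simp only [Finset.mem_filter, Finset.mem_range, Finset.mem_Ico]
    lia
  rw [hset, Nat.card_Ico]
  have hcard : ((min L (L + d).toNat - d.toNat : ℕ) : ℤ) = L - |d| := by
    rcases abs_cases d with h | h <;> lia
  exact_mod_cast hcard

/-- The limit of `∫ T_l P_{M+i} P_{M+j} w`, as a function of `d = i - j`. -/
noncomputable def chebyshevLimit (l d : ℤ) : ℝ :=
  ((if d = l then 1 else 0) + (if d = -l then 1 else 0)) / 2

theorem sum_sum_cos_mul_chebyshevLimit (L : ℕ) (θ : ℝ) (d : ℤ) (hd : |d| ≤ L) :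
    ∑ r ∈ Finset.range L, ∑ s ∈ Finset.range L,
      Real.cos (((r - s : ℤ) : ℝ) * θ) * chebyshevLimit (r - s) d =
        (L - |d|) * Real.cos (d * θ) := by
  have h1 : ∀ r s : ℕ, Real.cos (((r - s : ℤ) : ℝ) * θ) * chebyshevLimit (r - s) d =
      Real.cos (d * θ) / 2 * (if d = (r - s : ℤ) then (1 : ℝ) else 0) +
      Real.cos (d * θ) / 2 * (if d = (s - r : ℤ) then (1 : ℝ) else 0) := by
    intro r s
    rw [chebyshevLimit, neg_sub]
    by_cases h1 : d = (r - s : ℤ) <;> by_cases h2 : d = (s - r : ℤ)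
    · rw [if_pos h1, if_pos h2, h1]; ring
    · rw [if_pos h1, if_neg h2, h1]; ring
    · rw [if_neg h1, if_pos h2, h2, show ((r - s : ℤ) : ℝ) * θ = -(((s - r : ℤ) : ℝ) * θ) by
        push_cast; ring, Real.cos_neg]
      ring
    · rw [if_neg h1, if_neg h2]; ring
  simp only [h1, Finset.sum_add_distrib, ← Finset.mul_sum]
  rw [sum_sum_diagonal L d hd, Finset.sum_comm, sum_sum_diagonal L d hd]
  push_cast
  ring

end Fejer

namespace JacobiSystem

open Polynomial

variable {α β : ℝ} (J : JacobiSystem α β)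

theorem tendsto_moment_X_mul (hα : -1 < α) (hβ : -1 < β) {Q : ℝ[X]} {κ : ℤ → ℝ}
    (h : ∀ i j : ℕ, Tendsto (fun M => J.moment (Q * J.P (M + i) * J.P (M + j))) atTop
      (nhds (κ (i - j)))) (i j : ℕ) :
    Tendsto (fun M => J.moment (X * Q * J.P (M + i) * J.P (M + j))) atTop
      (nhds ((κ (i - j + 1) + κ (i - j - 1)) / 2)) := by
  rw [← tendsto_add_atTop_iff_nat 1]
  have hA := J.tendsto_recA hα hβ
  have hB := J.tendsto_recB hα hβ
  have hA1 := (tendsto_add_atTop_iff_nat (i + 1)).mpr hA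
  have hA0 := (tendsto_add_atTop_iff_nat i).mpr hA
  have hB1 := (tendsto_add_atTop_iff_nat (i + 1)).mpr hB
  have hlim := ((hA1.mul (h (i + 2) (j + 1))).add (hB1.mul (h (i + 1) (j + 1)))).add
    (hA0.mul (h i (j + 1)))
  refine (hlim.congr fun M => ?_).trans_eq ?_
  · have hx := J.X_mul_P_succ (M + i)
    have : X * Q * J.P (M + 1 + i) * J.P (M + 1 + j) =
        J.recA (M + (i + 1)) • (Q * J.P (M + (i + 2)) * J.P (M + (j + 1))) +
        J.recB (M + (i + 1)) • (Q * J.P (M + (i + 1)) * J.P (M + (j + 1))) +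
        J.recA (M + i) • (Q * J.P (M + i) * J.P (M + (j + 1))) := by
      simp only [smul_eq_C_mul]
      rw [show M + 1 + i = M + i + 1 by ring, show M + 1 + j = M + (j + 1) by ring,
        show M + (i + 2) = M + i + 2 by ring, show M + (i + 1) = M + i + 1 by ring]
      linear_combination Q * J.P (M + (j + 1)) * hx
    rw [this]
    simp only [map_add, map_smul, smul_eq_mul]
  · congr 1
    push_cast
    rw [show (i + 2 - (j + 1) : ℤ) = i - j + 1 by ring, show (i - (j + 1) : ℤ) = i - j - 1 by ring]
    ring

theorem tendsto_moment_T_nat (hα : -1 < α) (hβ : -1 < β) (l : ℕ) : ∀ i j : ℕ,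
    Tendsto (fun M => J.moment (Chebyshev.T ℝ l * J.P (M + i) * J.P (M + j))) atTop
      (nhds (chebyshevLimit l (i - j))) := by
  induction l using Nat.twoStepInduction with
  | zero =>
    intro i j
    refine tendsto_const_nhds.congr fun M => ?_
    simp only [Nat.cast_zero, Chebyshev.T_zero, one_mul, moment_P_mul_P, chebyshevLimit, neg_zero]
    by_cases h : i = j
    · simp [h]
    · rw [if_neg (by lia), if_neg (by lia)]; simp
  | one =>
    intro i j
    have h := J.tendsto_moment_X_mul hα hβ (Q := 1) (κ := fun d => if d = 0 then 1 else 0)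
      (fun i j => tendsto_const_nhds.congr fun M => by
        simp only [one_mul, moment_P_mul_P]
        by_cases h : i = j
        · simp [h]
        · rw [if_neg (by lia), if_neg (by lia)]) i j
    simp only [mul_one] at h
    simp only [Nat.cast_one, Chebyshev.T_one, chebyshevLimit]
    convert h using 2
    rw [add_comm]
    congr 2 <;> congr 1 <;> apply propext <;> lia
  | more l ih0 ih1 =>
    intro i j
    have h := ((J.tendsto_moment_X_mul hα hβ ih1 i j).const_mul 2).sub (ih0 i j)
    refine (h.congr fun M => ?_).trans_eq ?_
    · push_cast
      rw [Chebyshev.T_add_two, ← smul_eq_mul, ← map_smul, ← map_sub]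
      congr 1
      rw [smul_eq_C_mul, C_ofNat]
      ring
    · congr 1
      simp only [chebyshevLimit]
      push_cast
      have e1 : ((i - j + 1 : ℤ) = l + 1) = ((i - j : ℤ) = l) := by apply propext; lia
      have e2 : ((i - j + 1 : ℤ) = -(l + 1)) = ((i - j : ℤ) = -(l + 2)) := by apply propext; lia
      have e3 : ((i - j - 1 : ℤ) = l + 1) = ((i - j : ℤ) = l + 2) := by apply propext; lia
      have e4 : ((i - j - 1 : ℤ) = -(l + 1)) = ((i - j : ℤ) = -l) := by apply propext; lia
      simp only [e1, e2, e3, e4]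
      ring

theorem tendsto_moment_T (hα : -1 < α) (hβ : -1 < β) (l : ℤ) (i j : ℕ) :
    Tendsto (fun M => J.moment (Chebyshev.T ℝ l * J.P (M + i) * J.P (M + j))) atTop
      (nhds (chebyshevLimit l (i - j))) := by
  obtain ⟨n, rfl | rfl⟩ := l.eq_nat_or_neg
  · exact J.tendsto_moment_T_nat hα hβ n i j
  · rw [Chebyshev.T_neg, show chebyshevLimit (-n) (i - j) = chebyshevLimit n (i - j) by
      rw [chebyshevLimit, chebyshevLimit, neg_neg, add_comm]]
    exact J.tendsto_moment_T_nat hα hβ n i j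

theorem tendsto_moment_fejerPoly (hα : -1 < α) (hβ : -1 < β) {N L : ℕ} (hNL : N ≤ L) (θ : ℝ)
    (v : ℕ → ℝ) :
    Tendsto (fun M => J.moment (fejerPoly L θ *
        (∑ i ∈ Finset.range N, C (v i) * J.P (M + i)) ^ 2)) atTop
      (nhds (∑ i ∈ Finset.range N, ∑ j ∈ Finset.range N,
        v i * v j * ((L - |((i - j : ℤ) : ℝ)|) * Real.cos (((i - j : ℤ) : ℝ) * θ)))) := by
  have hexp : ∀ M, J.moment (fejerPoly L θ * (∑ i ∈ Finset.range N, C (v i) * J.P (M + i)) ^ 2) =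
      ∑ i ∈ Finset.range N, ∑ j ∈ Finset.range N, v i * v j *
        ∑ r ∈ Finset.range L, ∑ s ∈ Finset.range L, Real.cos (((r - s : ℤ) : ℝ) * θ) *
          J.moment (Chebyshev.T ℝ (r - s) * J.P (M + i) * J.P (M + j)) := by
    intro M
    simp only [← smul_eq_mul, ← map_smul, ← map_sum]
    congr 1
    rw [smul_eq_mul, sq, Finset.sum_mul_sum, Finset.mul_sum]
    refine Finset.sum_congr rfl fun i _ => ?_
    rw [Finset.mul_sum]
    refine Finset.sum_congr rfl fun j _ => ?_
    rw [fejerPoly, Finset.sum_mul, Finset.smul_sum]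
    refine Finset.sum_congr rfl fun r _ => ?_
    rw [Finset.sum_mul, Finset.smul_sum]
    refine Finset.sum_congr rfl fun s _ => ?_
    simp only [smul_eq_C_mul, smul_eq_mul, C_mul]
    ring
  simp only [hexp]
  refine tendsto_finsetSum _ fun i hi => tendsto_finsetSum _ fun j hj => ?_
  refine Tendsto.const_mul _ ?_
  rw [Finset.mem_range] at hi hj
  have hd : |(i - j : ℤ)| ≤ L := by rw [abs_le]; lia
  have := sum_sum_cos_mul_chebyshevLimit L θ (i - j) hd
  push_cast at this ⊢
  rw [← this]
  refine tendsto_finsetSum _ fun r _ => tendsto_finsetSum _ fun s _ => ?_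
  exact (J.tendsto_moment_T hα hβ _ i j).const_mul _

end JacobiSystem

/-- `cos θ + sin θ` at `θ = 2π j k / N`, the entries of the Hartley matrix. -/
noncomputable def hartley (N j k : ℕ) : ℝ :=
  Real.cos (2 * Real.pi * (j * k) / N) + Real.sin (2 * Real.pi * (j * k) / N)

namespace JacobiSystem

open Polynomial

variable {α β : ℝ} (J : JacobiSystem α β)

theorem jacobiWeight_nonneg (α β : ℝ) {t : ℝ} (ht : t ∈ Ioo (-1:ℝ) 1) : 0 ≤ jacobiWeight α β t :=
  mul_nonneg (Real.rpow_nonneg (by linarith [ht.2]) _) (Real.rpow_nonneg (by linarith [ht.1]) _)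

variable {X : Type*} [NormedAddCommGroup X] [NormedSpace ℝ X]

theorem continuous_norm_sum_smul_sq (s : Finset ℕ) (p : ℕ → ℝ[X]) (x : ℕ → X) :
    Continuous fun t => ‖∑ j ∈ s, (p j).eval t • x j‖ ^ 2 :=
  (continuous_finsetSum _ fun j _ => (p j).continuous.smul continuous_const).norm.pow 2

theorem integral_shift_le {c : ℝ}
    (htype : ∀ m : ℕ, ∀ x : ℕ → X,
      (∫ t in Ioo (-1:ℝ) 1,
          ‖∑ j ∈ Finset.range (m + 1), (J.P j).eval t • x j‖ ^ 2 * jacobiWeight α β t) ^ ((1:ℝ) / 2)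
        ≤ c * (∑ j ∈ Finset.range (m + 1), ‖x j‖ ^ 2) ^ ((1:ℝ) / 2))
    (x : ℕ → X) (M N : ℕ) :
    ∫ t in Ioo (-1:ℝ) 1,
        ‖∑ j ∈ Finset.range N, (J.P (M + j)).eval t • x j‖ ^ 2 * jacobiWeight α β t
      ≤ c ^ 2 * ∑ j ∈ Finset.range N, ‖x j‖ ^ 2 := by
  set y : ℕ → X := fun j => if M ≤ j ∧ j < M + N then x (j - M) else 0 with hy
  have hlow : ∀ j ∈ Finset.range M, y j = 0 := fun j hj => by
    rw [Finset.mem_range] at hj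
    exact if_neg (by lia)
  have htop : y (M + N) = 0 := if_neg (by lia)
  have hmid : ∀ j ∈ Finset.range N, y (M + j) = x j := fun j hj => by
    rw [Finset.mem_range] at hj
    rw [hy]
    simp only
    rw [if_pos (by lia), Nat.add_sub_cancel_left]
  have h := htype (M + N) y
  have e1 : ∀ t, ∑ j ∈ Finset.range (M + N + 1), (J.P j).eval t • y j =
      ∑ j ∈ Finset.range N, (J.P (M + j)).eval t • x j := by
    intro t
    rw [Finset.sum_range_succ, htop, smul_zero, add_zero, Finset.sum_range_add,
      Finset.sum_eq_zero fun j hj => by rw [hlow j hj, smul_zero], zero_add]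
    exact Finset.sum_congr rfl fun j hj => by rw [hmid j hj]
  have e2 : ∑ j ∈ Finset.range (M + N + 1), ‖y j‖ ^ 2 = ∑ j ∈ Finset.range N, ‖x j‖ ^ 2 := by
    rw [Finset.sum_range_succ, htop, norm_zero, zero_pow two_ne_zero, add_zero,
      Finset.sum_range_add,
      Finset.sum_eq_zero fun j hj => by rw [hlow j hj, norm_zero, zero_pow two_ne_zero], zero_add]
    exact Finset.sum_congr rfl fun j hj => by rw [hmid j hj]
  simp only [e1, e2, ← Real.sqrt_eq_rpow] at h
  have := (Real.sqrt_le_iff.mp h).2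
  rwa [mul_pow, Real.sq_sqrt (by positivity)] at this

theorem sum_moment_fejerPoly_le {c : ℝ} {N M : ℕ} (hN : N ≠ 0) (x : ℕ → X)
    (hx : ∫ t in Ioo (-1:ℝ) 1,
        ‖∑ j ∈ Finset.range N, (J.P (M + j)).eval t • x j‖ ^ 2 * jacobiWeight α β t
      ≤ c) (ξ : ℕ → X →L[ℝ] ℝ) (hξ : ∀ k, ‖ξ k‖ ≤ 1) :
    ∑ k ∈ Finset.range N, J.moment (fejerPoly (2 * N) (2 * Real.pi * k / N) *
        (∑ i ∈ Finset.range N, C (ξ k (x i)) * J.P (M + i)) ^ 2) ≤ 6 * N ^ 2 * c := by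
  simp only [moment_apply]
  rw [← integral_finsetSum _ fun k _ => J.integrableOn_mul_weight (Polynomial.continuous _)]
  refine le_trans ?_ (mul_le_mul_of_nonneg_left hx (by positivity))
  rw [← integral_const_mul]
  refine setIntegral_mono_on ?_ ?_ measurableSet_Ioo fun t ht => ?_
  · exact integrable_finsetSum _ fun k _ => J.integrableOn_mul_weight (Polynomial.continuous _)
  · exact (J.integrableOn_mul_weight
      (continuous_norm_sum_smul_sq _ (fun j => J.P (M + j)) x)).const_mul _
  · rw [← Finset.sum_mul, ← mul_assoc]
    refine mul_le_mul_of_nonneg_right ?_ (jacobiWeight_nonneg α β ht)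
    have ht' := Ioo_subset_Icc_self ht
    refine le_trans (Finset.sum_le_sum fun k _ => ?_)
      ((Finset.sum_mul _ _ _).symm.le.trans
        (mul_le_mul_of_nonneg_right (sum_eval_fejerPoly_le hN ht') (sq_nonneg _)))
    rw [eval_mul]
    refine mul_le_mul_of_nonneg_left ?_ (eval_fejerPoly_nonneg _ _ ht')
    have : (∑ i ∈ Finset.range N, C (ξ k (x i)) * J.P (M + i)).eval t =
        ξ k (∑ j ∈ Finset.range N, (J.P (M + j)).eval t • x j) := by
      simp [eval_finsetSum, map_sum, mul_comm]
    rw [eval_pow, this, sq_le_sq, abs_norm]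
    exact (ξ k).le_of_opNorm_le_of_le (hξ k) le_rfl |>.trans_eq (one_mul _)

theorem sum_hartley_apply_sq_le (hα : -1 < α) (hβ : -1 < β) {c : ℝ} {N : ℕ} (hN : N ≠ 0)
    (x : ℕ → X)
    (hx : ∀ M, ∫ t in Ioo (-1:ℝ) 1,
        ‖∑ j ∈ Finset.range N, (J.P (M + j)).eval t • x j‖ ^ 2 * jacobiWeight α β t
      ≤ c) (ξ : ℕ → X →L[ℝ] ℝ) (hξ : ∀ k, ‖ξ k‖ ≤ 1) :
    ∑ k ∈ Finset.range N, (ξ k (∑ j ∈ Finset.range N, hartley N j k • x j)) ^ 2 ≤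
      12 * c * N := by
  set S : ℕ → ℕ → ℝ := fun L k => ∑ i ∈ Finset.range N, ∑ j ∈ Finset.range N,
    ξ k (x i) * ξ k (x j) * ((L - |((i - j : ℤ) : ℝ)|) *
      Real.cos (((i - j : ℤ) : ℝ) * (2 * Real.pi * k / N))) with hS
  have hlim : ∀ L, N ≤ L → ∀ k : ℕ, Tendsto (fun M => J.moment (fejerPoly L (2 * Real.pi * k / N) *
      (∑ i ∈ Finset.range N, C (ξ k (x i)) * J.P (M + i)) ^ 2)) atTop (nhds (S L k)) :=
    fun L hL k => J.tendsto_moment_fejerPoly hα hβ hL _ fun i => ξ k (x i)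
  have h1 : ∑ k ∈ Finset.range N, S (2 * N) k ≤ 6 * N ^ 2 * c :=
    le_of_tendsto (tendsto_finsetSum _ fun k _ => hlim (2 * N) (by lia) k)
      (Eventually.of_forall fun M => J.sum_moment_fejerPoly_le hN x (hx M) ξ hξ)
  have h2 : ∀ k, 0 ≤ S N k := fun k =>
    ge_of_tendsto (hlim N le_rfl k) <| Eventually.of_forall fun M => by
      rw [moment_apply]
      refine setIntegral_nonneg measurableSet_Ioo fun t ht => ?_
      rw [eval_mul, eval_pow]
      exact mul_nonneg (mul_nonneg (eval_fejerPoly_nonneg _ _ (Ioo_subset_Icc_self ht))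
        (sq_nonneg _)) (jacobiWeight_nonneg α β ht)
  have h3 : ∀ k, N * (ξ k (∑ j ∈ Finset.range N, hartley N j k • x j)) ^ 2 ≤
      2 * S (2 * N) k := by
    intro k
    have hsub := sum_sum_cos_sub_mul (Finset.range N) (fun i => ξ k (x i))
      fun i => 2 * Real.pi * (i * k) / N
    have hdiff : S (2 * N) k - S N k = N * ∑ i ∈ Finset.range N, ∑ j ∈ Finset.range N,
        ξ k (x i) * ξ k (x j) *
          Real.cos (2 * Real.pi * (i * k) / N - 2 * Real.pi * (j * k) / N) := by
      rw [hS]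
      simp only [← Finset.sum_sub_distrib, Finset.mul_sum]
      refine Finset.sum_congr rfl fun i _ => Finset.sum_congr rfl fun j _ => ?_
      rw [show ((i - j : ℤ) : ℝ) * (2 * Real.pi * k / N) =
        2 * Real.pi * (i * k) / N - 2 * Real.pi * (j * k) / N by push_cast; ring]
      push_cast
      ring
    rw [hsub] at hdiff
    have hval : ξ k (∑ j ∈ Finset.range N, hartley N j k • x j) =
        (∑ i ∈ Finset.range N, ξ k (x i) * Real.cos (2 * Real.pi * (i * k) / N)) +
        ∑ i ∈ Finset.range N, ξ k (x i) * Real.sin (2 * Real.pi * (i * k) / N) := by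
      rw [map_sum, ← Finset.sum_add_distrib]
      refine Finset.sum_congr rfl fun j _ => ?_
      rw [map_smul, smul_eq_mul, hartley]
      ring
    rw [hval]
    calc _ ≤ (N : ℝ) * (2 * (_ ^ 2 + _ ^ 2)) :=
          mul_le_mul_of_nonneg_left (add_sq_le) (Nat.cast_nonneg N)
      _ = 2 * (S (2 * N) k - S N k) := by rw [hdiff]; ring
      _ ≤ 2 * S (2 * N) k := by linarith [h2 k]
  have h4 : N * ∑ k ∈ Finset.range N, (ξ k (∑ j ∈ Finset.range N, hartley N j k • x j)) ^ 2 ≤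
      N * (12 * c * N) := by
    rw [Finset.mul_sum]
    refine (Finset.sum_le_sum fun k _ => h3 k).trans ?_
    rw [← Finset.mul_sum]
    linarith
  exact le_of_mul_le_mul_left h4 (by positivity)

theorem sum_norm_hartley_sq_le (hα : -1 < α) (hβ : -1 < β) {c : ℝ}
    (htype : ∀ m : ℕ, ∀ x : ℕ → X,
      (∫ t in Ioo (-1:ℝ) 1,
          ‖∑ j ∈ Finset.range (m + 1), (J.P j).eval t • x j‖ ^ 2 * jacobiWeight α β t) ^ ((1:ℝ) / 2)
        ≤ c * (∑ j ∈ Finset.range (m + 1), ‖x j‖ ^ 2) ^ ((1:ℝ) / 2))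
    {N : ℕ} (hN : N ≠ 0) (x : ℕ → X) :
    ∑ k ∈ Finset.range N, ‖∑ j ∈ Finset.range N, hartley N j k • x j‖ ^ 2 ≤
      12 * c ^ 2 * N * ∑ j ∈ Finset.range N, ‖x j‖ ^ 2 := by
  choose ξ hξ hξx using fun k =>
    exists_dual_vector'' ℝ (∑ j ∈ Finset.range N, hartley N j k • x j)
  have := J.sum_hartley_apply_sq_le hα hβ hN x (fun M => J.integral_shift_le htype x M N) ξ hξ
  simp only [hξx, RCLike.ofReal_real_eq_id, id] at this
  linarith

end JacobiSystem

theorem hartley_comm (N j k : ℕ) : hartley N j k = hartley N k j := by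
  rw [hartley, hartley, mul_comm (j : ℝ)]

theorem hartley_sq_le (N j k : ℕ) : hartley N j k ^ 2 ≤ 2 := by
  rw [hartley]
  refine add_sq_le.trans_eq ?_
  rw [Real.cos_sq_add_sin_sq, mul_one]

theorem sum_hartley_mul_hartley {N : ℕ} (hN : N ≠ 0) {a b : ℕ} (ha : a < N) (hb : b < N) :
    ∑ k ∈ Finset.range N, hartley N a k * hartley N b k = if a = b then (N : ℝ) else 0 := by
  have h : ∀ k : ℕ, hartley N a k * hartley N b k =
      Real.cos (((a - b : ℤ) : ℝ) * (2 * Real.pi * k / N)) +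
      Real.sin (((a + b : ℤ) : ℝ) * (2 * Real.pi * k / N)) := by
    intro k
    rw [hartley, hartley,
      show ((a - b : ℤ) : ℝ) * (2 * Real.pi * k / N) =
        2 * Real.pi * (a * k) / N - 2 * Real.pi * (b * k) / N by push_cast; ring,
      show ((a + b : ℤ) : ℝ) * (2 * Real.pi * k / N) =
        2 * Real.pi * (a * k) / N + 2 * Real.pi * (b * k) / N by push_cast; ring,
      Real.cos_sub, Real.sin_add]
    ring
  simp only [h, Finset.sum_add_distrib, sum_cos_eq hN, sum_sin_eq hN, add_zero]
  congr 1
  apply propext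
  constructor
  · intro h
    have := Int.eq_zero_of_abs_lt_dvd h (by rw [abs_lt]; lia)
    lia
  · rintro rfl
    simp

section BallMoment

variable {ι : Type*} [Fintype ι] {X : Type*} [NormedAddCommGroup X] [NormedSpace ℝ X]

/-- The second moment of `∑ g_j x_j` for `g` in the Euclidean unit ball. -/
noncomputable def ballMoment (x : ι → X) : ℝ :=
  ∫ g in Metric.closedBall (0 : EuclideanSpace ℝ ι) 1, ‖∑ j, g j • x j‖ ^ 2

theorem continuous_norm_sum_coord_smul_sq (x : ι → X) :
    Continuous fun g : EuclideanSpace ℝ ι => ‖∑ j, g j • x j‖ ^ 2 := by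
  fun_prop

theorem integrableOn_norm_sum_coord_smul_sq (x : ι → X) :
    IntegrableOn (fun g : EuclideanSpace ℝ ι => ‖∑ j, g j • x j‖ ^ 2)
      (Metric.closedBall (0 : EuclideanSpace ℝ ι) 1) :=
  (continuous_norm_sum_coord_smul_sq x).continuousOn.integrableOn_compact
    (isCompact_closedBall _ _)

theorem ballMoment_smul (a : ℝ) (x : ι → X) : ballMoment (a • x) = a ^ 2 * ballMoment x := by
  rw [ballMoment, ballMoment, ← integral_const_mul]
  congr 1
  ext g
  simp only [Pi.smul_apply, smul_comm _ a, ← Finset.smul_sum]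
  rw [norm_smul, mul_pow, Real.norm_eq_abs, sq_abs]

/-- Two families with the same Gram form differ by an isometry of the coefficient space. -/
theorem exists_isometry_of_sum_sq_eq (x y : ι → X)
    (h : ∀ ξ : X →L[ℝ] ℝ, ∑ i, ξ (x i) ^ 2 = ∑ i, ξ (y i) ^ 2) :
    ∃ e : EuclideanSpace ℝ ι ≃ₗᵢ[ℝ] EuclideanSpace ℝ ι,
      ∀ g : EuclideanSpace ℝ ι, ∑ i, e g i • y i = ∑ i, g i • x i := by
  obtain ⟨ev, hev⟩ : ∃ ev : (ι → X) → (X →L[ℝ] ℝ) →ₗ[ℝ] EuclideanSpace ℝ ι,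
      ∀ z ξ i, ev z ξ i = ξ (z i) :=
    ⟨fun z => (WithLp.linearEquiv 2 ℝ (ι → ℝ)).symm.toLinearMap ∘ₗ
      LinearMap.pi fun i => (ContinuousLinearMap.apply ℝ ℝ (z i)).toLinearMap,
      fun _ _ _ => rfl⟩
  have hnorm : ∀ ξ, ‖ev x ξ‖ = ‖ev y ξ‖ := fun ξ => by
    simp only [EuclideanSpace.norm_eq, hev, Real.norm_eq_abs, sq_abs, h]
  obtain ⟨s, hs⟩ := (ev x).rangeRestrict.exists_rightInverse_of_surjective
    (LinearMap.range_rangeRestrict _)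
  have hs' : ∀ a, ev x (s a) = a := fun a => congrArg Subtype.val (LinearMap.congr_fun hs a)
  let L : LinearMap.range (ev x) →ₗᵢ[ℝ] EuclideanSpace ℝ ι :=
    { toLinearMap := (ev y).comp s
      norm_map' := fun a => by
        rw [LinearMap.comp_apply, ← hnorm, hs']
        rfl }
  have hL : ∀ ξ, L.extend (ev x ξ) = ev y ξ := fun ξ => by
    have h1 : L.extend (ev x ξ) = ev y (s ⟨ev x ξ, LinearMap.mem_range_self _ ξ⟩) :=
      L.extend_apply ⟨ev x ξ, LinearMap.mem_range_self _ ξ⟩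
    rw [h1, ← sub_eq_zero, ← map_sub, ← norm_eq_zero, ← hnorm, map_sub, hs', sub_self, norm_zero]
  refine ⟨L.extend.toLinearIsometryEquiv rfl, fun g => ?_⟩
  rw [SeparatingDual.eq_iff_forall_dual_eq (R := ℝ)]
  intro ξ
  have h2 := L.extend.inner_map_map (ev x ξ) g
  rw [hL] at h2
  simpa [PiLp.inner_apply, hev] using h2

theorem ballMoment_eq_of_sum_sq_eq (x y : ι → X)
    (h : ∀ ξ : X →L[ℝ] ℝ, ∑ i, ξ (x i) ^ 2 = ∑ i, ξ (y i) ^ 2) :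
    ballMoment x = ballMoment y := by
  obtain ⟨e, he⟩ := exists_isometry_of_sum_sq_eq x y h
  have hpre := e.measurePreserving.setIntegral_preimage_emb
    e.toHomeomorph.measurableEmbedding (fun g => ‖∑ j, g j • y j‖ ^ 2) (Metric.closedBall 0 1)
  rw [e.preimage_closedBall, map_zero] at hpre
  rw [ballMoment, ballMoment, ← hpre]
  simp only [he]

theorem convexOn_ballMoment : ConvexOn ℝ univ (ballMoment : (ι → X) → ℝ) := by
  refine ⟨convex_univ, fun x _ y _ a b ha hb hab => ?_⟩
  rw [ballMoment, ballMoment, ballMoment, smul_eq_mul, smul_eq_mul, ← integral_const_mul,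
    ← integral_const_mul, ← integral_add ((integrableOn_norm_sum_coord_smul_sq x).const_mul a)
      ((integrableOn_norm_sum_coord_smul_sq y).const_mul b)]
  refine integral_mono (integrableOn_norm_sum_coord_smul_sq _)
    (((integrableOn_norm_sum_coord_smul_sq x).const_mul a).add
      ((integrableOn_norm_sum_coord_smul_sq y).const_mul b)) fun g => ?_
  have hconv := (convexOn_univ_norm (E := X)).pow (fun _ _ => norm_nonneg _) 2
  have := hconv.2 (mem_univ (∑ j, g j • x j)) (mem_univ (∑ j, g j • y j)) ha hb hab
  simp only [Pi.pow_apply, smul_eq_mul] at this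
  refine le_trans (le_of_eq ?_) this
  congr 2
  simp only [Pi.add_apply, Pi.smul_apply, smul_add, Finset.sum_add_distrib, Finset.smul_sum]
  congr 1 <;> exact Finset.sum_congr rfl fun j _ => smul_comm _ _ _

/-- Contraction principle. -/
theorem ballMoment_mul_le {b : ℝ} (c : ι → ℝ) (hc : ∀ j, c j ^ 2 ≤ b) (x : ι → X) :
    ballMoment (fun j => c j • x j) ≤ b * ballMoment x := by
  rcases isEmpty_or_nonempty ι with hι | ⟨⟨i⟩⟩
  · simp [ballMoment]
  have hb : 0 ≤ b := (sq_nonneg _).trans (hc i)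
  let T : (ι → ℝ) →ₗ[ℝ] (ι → X) :=
    { toFun := fun c j => c j • x j
      map_add' := fun _ _ => funext fun _ => add_smul _ _ _
      map_smul' := fun _ _ => funext fun _ => mul_smul _ _ _ }
  have hconv : Convex ℝ {c | c ∈ (univ : Set (ι → ℝ)) ∧ (ballMoment ∘ T) c ≤ b * ballMoment x} :=
    ((convexOn_ballMoment (ι := ι) (X := X)).comp_linearMap T).convex_le _
  have hmem : c ∈ convexHull ℝ (univ.pi fun _ : ι => ({-√b, √b} : Set ℝ)) := by
    rw [convexHull_pi]
    intro j _
    rw [convexHull_pair, segment_eq_Icc (by linarith [Real.sqrt_nonneg b])]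
    exact abs_le.mp (Real.abs_le_sqrt (hc j))
  refine (convexHull_min ?_ hconv hmem).2
  intro ε hε
  have hε2 : ∀ j, ε j ^ 2 = b := fun j => by
    rcases hε j (mem_univ j) with h | h
    · rw [h, neg_sq, Real.sq_sqrt hb]
    · rw [mem_singleton_iff.mp h, Real.sq_sqrt hb]
  refine ⟨mem_univ _, le_of_eq ?_⟩
  calc ballMoment (T ε) = ballMoment (√b • x) := ballMoment_eq_of_sum_sq_eq _ _ fun ξ =>
        Finset.sum_congr rfl fun j _ => by
          simp only [T, LinearMap.coe_mk, AddHom.coe_mk, Pi.smul_apply, map_smul, smul_eq_mul,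
            mul_pow, hε2, Real.sq_sqrt hb]
    _ = b * ballMoment x := by rw [ballMoment_smul, Real.sq_sqrt hb]

variable (ι) in
/-- All coordinates have the same positive second moment on the Euclidean unit ball. -/
theorem exists_integral_coord_sq_eq :
    ∃ v : ℝ, 0 < v ∧ ∀ j, ∫ g in Metric.closedBall (0 : EuclideanSpace ℝ ι) 1, g j ^ 2 = v := by
  classical
  rcases isEmpty_or_nonempty ι with hι | ⟨⟨i⟩⟩
  · exact ⟨1, one_pos, fun j => (hι.false j).elim⟩
  have hval : ∀ j, ∫ g in Metric.closedBall (0 : EuclideanSpace ℝ ι) 1, g j ^ 2 =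
      ballMoment (Pi.single j (1 : ℝ) : ι → ℝ) := by
    intro j
    rw [ballMoment]
    congr 1
    ext g
    simp [Pi.single_apply]
  refine ⟨_, ?_, fun j => (hval j).trans ((ballMoment_eq_of_sum_sq_eq _ _ fun ξ => ?_).trans
    (hval i).symm)⟩
  · have hcont : Continuous fun g : EuclideanSpace ℝ ι => g i ^ 2 := by fun_prop
    rw [setIntegral_pos_iff_support_of_nonneg_ae (Eventually.of_forall fun g => sq_nonneg _)
      (hcont.continuousOn.integrableOn_compact (isCompact_closedBall _ _))]
    refine lt_of_lt_of_le (IsOpen.measure_pos volume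
      ((hcont.isOpen_support).inter Metric.isOpen_ball)
      ⟨EuclideanSpace.single i (1 / 2 : ℝ), ?_, ?_⟩)
      (measure_mono (inter_subset_inter_right _ Metric.ball_subset_closedBall))
    · simp
    · rw [mem_ball_zero_iff, PiLp.norm_single]
      norm_num
  · have : ∀ j, ∑ k, ξ ((Pi.single j (1 : ℝ) : ι → ℝ) k) ^ 2 = ξ 1 ^ 2 := fun j => by
      rw [Finset.sum_eq_single j] <;> simp +contextual
    rw [this, this]

theorem integral_sum_coord_sq_mul {v : ℝ}
    (hv : ∀ j, ∫ g in Metric.closedBall (0 : EuclideanSpace ℝ ι) 1, g j ^ 2 = v) (w : ι → ℝ) :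
    ∫ g in Metric.closedBall (0 : EuclideanSpace ℝ ι) 1, ∑ j, g j ^ 2 * w j = v * ∑ j, w j := by
  rw [integral_finsetSum]
  · simp only [integral_mul_const, hv, Finset.mul_sum]
  · intro j _
    exact Continuous.continuousOn (by fun_prop) |>.integrableOn_compact (isCompact_closedBall _ _)

end BallMoment

section MatrixBound

variable {ι : Type*} [Fintype ι] {X : Type*} [NormedAddCommGroup X] [NormedSpace ℝ X]
  {h : ι → ι → ℝ} {K n v : ℝ}

theorem sum_ballMoment_le (hK : ∀ x : ι → X, ∑ k, ‖∑ j, h j k • x j‖ ^ 2 ≤ K * ∑ j, ‖x j‖ ^ 2)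
    (hv : ∀ j, ∫ g in Metric.closedBall (0 : EuclideanSpace ℝ ι) 1, g j ^ 2 = v) (x : ι → X) :
    ∑ k, ballMoment (fun j => h j k • x j) ≤ K * (v * ∑ j, ‖x j‖ ^ 2) := by
  rw [← integral_sum_coord_sq_mul hv, ← integral_const_mul]
  simp only [ballMoment]
  rw [← integral_finsetSum _ fun k _ => integrableOn_norm_sum_coord_smul_sq _]
  refine integral_mono (integrable_finsetSum _ fun k _ => integrableOn_norm_sum_coord_smul_sq _)
    (Continuous.continuousOn (by fun_prop) |>.integrableOn_compact (isCompact_closedBall _ _))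
    fun g => ?_
  have := hK fun j => g j • x j
  simpa only [norm_smul, mul_pow, Real.norm_eq_abs, sq_abs, smul_comm (h _ _)] using this

/-- Type 2 estimate. -/
theorem ballMoment_le (hK : ∀ x : ι → X, ∑ k, ‖∑ j, h j k • x j‖ ^ 2 ≤ K * ∑ j, ‖x j‖ ^ 2)
    (hv : ∀ j, ∫ g in Metric.closedBall (0 : EuclideanSpace ℝ ι) 1, g j ^ 2 = v)
    (hn : 0 < n) (h2 : ∀ j k, h j k ^ 2 ≤ 2) (hsum : ∀ j, ∑ k, h j k ^ 2 = n) (x : ι → X)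
    (hcard : (Fintype.card ι : ℝ) = n) :
    n * ballMoment x ≤ 2 * K * (v * ∑ j, ‖x j‖ ^ 2) := by
  have hJ := (convexOn_ballMoment (ι := ι) (X := X)).map_sum_le (t := Finset.univ)
    (w := fun _ : ι => 1 / n) (p := fun k j => h j k ^ 2 • x j) (fun _ _ => by positivity)
    (by simp [hcard, hn.ne']) fun _ _ => mem_univ _
  have hx : ∑ k, (1 / n) • (fun j => h j k ^ 2 • x j) = x := by
    ext j
    rw [Finset.sum_apply]
    simp only [Pi.smul_apply]
    rw [← Finset.smul_sum, ← Finset.sum_smul, hsum, smul_smul, one_div_mul_cancel hn.ne', one_smul]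
  rw [hx] at hJ
  have hcontr : ∀ k, ballMoment (fun j => h j k ^ 2 • x j) ≤
      2 * ballMoment fun j => h j k • x j := fun k => by
    simpa only [sq, mul_smul] using
      ballMoment_mul_le (fun j => h j k) (fun j => h2 j k) fun j => h j k • x j
  calc n * ballMoment x ≤ n * ∑ k, (1 / n) • ballMoment (fun j => h j k ^ 2 • x j) := by gcongr
    _ = ∑ k, ballMoment (fun j => h j k ^ 2 • x j) := by
        rw [← Finset.smul_sum, smul_eq_mul, ← mul_assoc, mul_one_div_cancel hn.ne', one_mul]
    _ ≤ ∑ k, 2 * ballMoment fun j => h j k • x j := Finset.sum_le_sum fun k _ => hcontr k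
    _ = 2 * ∑ k, ballMoment fun j => h j k • x j := (Finset.mul_sum _ _ _).symm
    _ ≤ 2 * (K * (v * ∑ j, ‖x j‖ ^ 2)) := by gcongr; exact sum_ballMoment_le hK hv x
    _ = 2 * K * (v * ∑ j, ‖x j‖ ^ 2) := by ring

/-- Cotype 2 estimate. -/
theorem le_ballMoment [DecidableEq ι] (hK0 : 0 ≤ K)
    (hK : ∀ x : ι → X, ∑ k, ‖∑ j, h j k • x j‖ ^ 2 ≤ K * ∑ j, ‖x j‖ ^ 2)
    (hv : ∀ j, ∫ g in Metric.closedBall (0 : EuclideanSpace ℝ ι) 1, g j ^ 2 = v)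
    (h2 : ∀ j k, h j k ^ 2 ≤ 2) (hsymm : ∀ j k, h j k = h k j)
    (horth : ∀ a b, ∑ k, h a k * h b k = if a = b then n else 0) (y : ι → X)
    (hcard : (Fintype.card ι : ℝ) = n) :
    n ^ 2 * (v * ∑ j, ‖y j‖ ^ 2) ≤ 2 * K * n * ballMoment y := by
  have hpt : ∀ x : ι → X, n ^ 2 * ∑ j, ‖x j‖ ^ 2 ≤ K * ∑ k, ‖∑ j, h j k • x j‖ ^ 2 := by
    intro x
    have hinv : ∀ a, ∑ k, h k a • ∑ j, h j k • x j = n • x a := by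
      intro a
      simp only [Finset.smul_sum, smul_smul]
      rw [Finset.sum_comm]
      simp only [← Finset.sum_smul, hsymm _ a, horth, ite_smul, zero_smul]
      simp
    have := hK fun k => ∑ j, h j k • x j
    simp only [hinv, norm_smul, mul_pow, Real.norm_eq_abs, sq_abs] at this
    rwa [← Finset.mul_sum] at this
  calc n ^ 2 * (v * ∑ j, ‖y j‖ ^ 2) ≤ K * ∑ k, ballMoment fun j => h j k • y j := by
        rw [← integral_sum_coord_sq_mul hv, ← integral_const_mul]
        simp only [ballMoment]
        rw [← integral_finsetSum _ fun k _ => integrableOn_norm_sum_coord_smul_sq _,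
          ← integral_const_mul]
        refine integral_mono
          (Continuous.continuousOn (by fun_prop) |>.integrableOn_compact (isCompact_closedBall _ _))
          ((integrable_finsetSum _ fun k _ => integrableOn_norm_sum_coord_smul_sq _).const_mul _)
          fun g => ?_
        have := hpt fun j => g j • y j
        simpa only [norm_smul, mul_pow, Real.norm_eq_abs, sq_abs, smul_comm (h _ _)] using this
    _ ≤ K * ∑ _k : ι, 2 * ballMoment y := by
        gcongr with k
        exact ballMoment_mul_le _ (fun j => h2 j k) y
    _ = 2 * K * n * ballMoment y := by
        rw [Finset.sum_const, Finset.card_univ, nsmul_eq_mul, hcard]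
        ring

end MatrixBound

theorem sum_norm_sq_le_of_hartley {X : Type*} [NormedAddCommGroup X] [NormedSpace ℝ X] {K : ℝ}
    (hK0 : 0 ≤ K)
    (hK : ∀ N : ℕ, N ≠ 0 → ∀ x : ℕ → X,
      ∑ k ∈ Finset.range N, ‖∑ j ∈ Finset.range N, hartley N j k • x j‖ ^ 2 ≤
        K * N * ∑ j ∈ Finset.range N, ‖x j‖ ^ 2)
    (n : ℕ) (x y : Fin n → X)
    (hxy : ∀ ξ : X →L[ℝ] ℝ, ∑ i, ξ (x i) ^ 2 = ∑ i, ξ (y i) ^ 2) :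
    ∑ i, ‖y i‖ ^ 2 ≤ 4 * K ^ 2 * ∑ i, ‖x i‖ ^ 2 := by
  rcases eq_or_ne n 0 with rfl | hn
  · simp
  have hn0 : (0 : ℝ) < n := by positivity
  obtain ⟨v, hv0, hv⟩ := exists_integral_coord_sq_eq (Fin n)
  have hKfin : ∀ x : Fin n → X,
      ∑ k : Fin n, ‖∑ j : Fin n, hartley n j k • x j‖ ^ 2 ≤ K * n * ∑ j, ‖x j‖ ^ 2 := by
    intro x
    have := hK n hn fun j => if hj : j < n then x ⟨j, hj⟩ else 0
    simpa [Finset.sum_range] using this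
  have horth : ∀ a b : Fin n, ∑ k : Fin n, hartley n a k * hartley n b k =
      if a = b then (n : ℝ) else 0 := by
    intro a b
    have := sum_hartley_mul_hartley hn a.2 b.2
    simpa [Finset.sum_range, Fin.ext_iff] using this
  have hT := ballMoment_le hKfin hv hn0 (fun j k => hartley_sq_le n j k)
    (fun j => by simpa [sq] using horth j j) x (by simp)
  have hC := le_ballMoment (by positivity) hKfin hv (fun j k => hartley_sq_le n j k)
    (fun j k => hartley_comm n j k) horth y (by simp)
  rw [← ballMoment_eq_of_sum_sq_eq x y hxy] at hC
  have : n ^ 2 * v * ∑ j, ‖y j‖ ^ 2 ≤ n ^ 2 * v * (4 * K ^ 2 * ∑ i, ‖x i‖ ^ 2) := by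
    calc n ^ 2 * v * ∑ j, ‖y j‖ ^ 2 ≤ 2 * K * n * (n * ballMoment x) := by linarith
      _ ≤ 2 * K * n * (2 * (K * n) * (v * ∑ j, ‖x j‖ ^ 2)) := by gcongr
      _ = _ := by ring
  exact le_of_mul_le_mul_left this (by positivity)

theorem IsIsomorphicToHilbertSpace.of_core {X : Type u} [NormedAddCommGroup X] [NormedSpace ℝ X]
    {H : Type u} [AddCommGroup H] [Module ℝ H] (core : InnerProductSpace.Core ℝ H)
    (e : X ≃ₗ[ℝ] H) {C : ℝ} (hle : ∀ x, ‖x‖ ^ 2 ≤ core.inner (e x) (e x))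
    (hge : ∀ x, core.inner (e x) (e x) ≤ C * ‖x‖ ^ 2) : IsIsomorphicToHilbertSpace X := by
  let hn : NormedAddCommGroup H := core.toNormedAddCommGroup
  let hi : InnerProductSpace ℝ H := InnerProductSpace.ofCore core.toCore
  have hsq : ∀ y : H, ‖y‖ ^ 2 = core.inner y y := fun y => (real_inner_self_eq_norm_sq y).symm
  refine ⟨H, hn, hi, ⟨LinearEquiv.toContinuousLinearEquivOfBounds e (√C) 1 (fun x => ?_)
    fun y => ?_⟩⟩
  · rw [← Real.sqrt_sq (norm_nonneg x), ← Real.sqrt_mul' _ (sq_nonneg _)]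
    exact Real.le_sqrt_of_sq_le ((hsq _).trans_le (hge x))
  · rw [one_mul]
    refine le_of_sq_le_sq ?_ (norm_nonneg _)
    have := hle (e.symm y)
    rwa [e.apply_symm_apply, ← hsq] at this

section GramDomination

variable (X : Type u) [NormedAddCommGroup X] [NormedSpace ℝ X]

/-- The span of the squares of the evaluations on the dual. -/
def squareSpan : Submodule ℝ ((X →L[ℝ] ℝ) → ℝ) :=
  Submodule.span ℝ (range fun (x : X) (ξ : X →L[ℝ] ℝ) => ξ x ^ 2)

/-- The pairs `(u, r)` such that `u` is a difference of sums of squares whose weight is at most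
`r`. -/
def squareCone (C : ℝ) : PointedCone ℝ (((X →L[ℝ] ℝ) → ℝ) × ℝ) where
  carrier := {p | ∃ (n : ℕ) (x y : Fin n → X),
    p.1 = (fun ξ : X →L[ℝ] ℝ => ∑ i, ξ (x i) ^ 2 - ∑ i, ξ (y i) ^ 2) ∧
      C * ∑ i, ‖x i‖ ^ 2 - ∑ i, ‖y i‖ ^ 2 ≤ p.2}
  zero_mem' := ⟨0, Fin.elim0, Fin.elim0, by ext; simp, by simp⟩
  add_mem' := by
    rintro p p' ⟨n, x, y, h1, h2⟩ ⟨n', x', y', h1', h2'⟩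
    refine ⟨n + n', Fin.append x x', Fin.append y y', ?_, ?_⟩
    · ext ξ
      simp only [Fin.sum_univ_add, Fin.append_left, Fin.append_right, Prod.fst_add, h1, h1',
        Pi.add_apply]
      ring
    · simp only [Fin.sum_univ_add, Fin.append_left, Fin.append_right, Prod.snd_add]
      linarith
  smul_mem' := by
    rintro ⟨a, ha⟩ p ⟨n, x, y, h1, h2⟩
    have hsmul : ∀ r : ℝ, (⟨a, ha⟩ : {a : ℝ // 0 ≤ a}) • r = a * r := fun _ => rfl
    refine ⟨n, fun i => √a • x i, fun i => √a • y i, ?_, ?_⟩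
    · ext ξ
      simp only [map_smul, smul_eq_mul, mul_pow, Real.sq_sqrt ha, ← Finset.mul_sum, Prod.smul_fst,
        h1, Pi.smul_apply, hsmul]
      ring
    · simp only [norm_smul, mul_pow, Real.norm_eq_abs, sq_abs, Real.sq_sqrt ha, ← Finset.mul_sum,
        Prod.smul_snd, hsmul]
      have := mul_le_mul_of_nonneg_left h2 ha
      linarith

variable {X}

theorem exists_mem_squareCone (C : ℝ) {u : (X →L[ℝ] ℝ) → ℝ} (hu : u ∈ squareSpan X) :
    ∃ r, (u, r) ∈ squareCone X C := by
  suffices ∃ (n : ℕ) (x y : Fin n → X),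
      u = fun ξ : X →L[ℝ] ℝ => ∑ i, ξ (x i) ^ 2 - ∑ i, ξ (y i) ^ 2 by
    obtain ⟨n, x, y, h⟩ := this
    exact ⟨_, n, x, y, h, le_rfl⟩
  induction hu using Submodule.span_induction with
  | mem u hu =>
    obtain ⟨x, rfl⟩ := hu
    exact ⟨1, fun _ => x, fun _ => 0, by ext; simp⟩
  | zero => exact ⟨0, Fin.elim0, Fin.elim0, by ext; simp⟩
  | add u u' _ _ h h' =>
    obtain ⟨n, x, y, rfl⟩ := h
    obtain ⟨n', x', y', rfl⟩ := h'
    refine ⟨n + n', Fin.append x x', Fin.append y y', ?_⟩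
    ext ξ
    simp only [Fin.sum_univ_add, Fin.append_left, Fin.append_right, Pi.add_apply]
    ring
  | smul a u _ h =>
    obtain ⟨n, x, y, rfl⟩ := h
    rcases le_total 0 a with ha | ha
    · refine ⟨n, fun i => √a • x i, fun i => √a • y i, ?_⟩
      ext ξ
      simp only [map_smul, smul_eq_mul, mul_pow, Real.sq_sqrt ha, ← Finset.mul_sum, Pi.smul_apply]
      ring
    · refine ⟨n, fun i => √(-a) • y i, fun i => √(-a) • x i, ?_⟩
      ext ξ
      simp only [map_smul, smul_eq_mul, mul_pow, Real.sq_sqrt (neg_nonneg.mpr ha),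
        ← Finset.mul_sum, Pi.smul_apply]
      ring

theorem sq_mem_squareSpan (x : X) : (fun ξ : X →L[ℝ] ℝ => ξ x ^ 2) ∈ squareSpan X :=
  Submodule.subset_span ⟨x, rfl⟩

theorem mul_mem_squareSpan (x y : X) : (fun ξ : X →L[ℝ] ℝ => ξ x * ξ y) ∈ squareSpan X := by
  have : (fun ξ : X →L[ℝ] ℝ => ξ x * ξ y) = (1 / 2 : ℝ) • ((fun ξ : X →L[ℝ] ℝ => ξ (x + y) ^ 2) -
      (fun ξ => ξ x ^ 2) - fun ξ => ξ y ^ 2) := by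
    ext ξ
    simp only [Pi.smul_apply, Pi.sub_apply, map_add, smul_eq_mul]
    ring
  rw [this]
  exact Submodule.smul_mem _ _ (Submodule.sub_mem _ (Submodule.sub_mem _ (sq_mem_squareSpan _)
    (sq_mem_squareSpan _)) (sq_mem_squareSpan _))

theorem exists_linear_on_squareSpan {C : ℝ}
    (hC : ∀ (n : ℕ) (x y : Fin n → X),
      (∀ ξ : X →L[ℝ] ℝ, ∑ i, ξ (x i) ^ 2 = ∑ i, ξ (y i) ^ 2) →
        ∑ i, ‖y i‖ ^ 2 ≤ C * ∑ i, ‖x i‖ ^ 2) :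
    ∃ q : squareSpan X →ₗ[ℝ] ℝ, ∀ x : X, ‖x‖ ^ 2 ≤ q ⟨_, sq_mem_squareSpan x⟩ ∧
      q ⟨_, sq_mem_squareSpan x⟩ ≤ C * ‖x‖ ^ 2 := by
  let s : PointedCone ℝ (squareSpan X × ℝ) :=
    (squareCone X C).comap ((squareSpan X).subtype.prodMap LinearMap.id)
  have hs : ∀ p : squareSpan X × ℝ, p ∈ s ↔ ((p.1 : (X →L[ℝ] ℝ) → ℝ), p.2) ∈ squareCone X C :=
    fun _ => Iff.rfl
  let f : (squareSpan X × ℝ) →ₗ.[ℝ] ℝ :=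
    ⟨LinearMap.range (LinearMap.inr ℝ (squareSpan X) ℝ),
      (LinearMap.snd ℝ (squareSpan X) ℝ).domRestrict _⟩
  obtain ⟨g, hg, hgs⟩ := riesz_extension s f
    (by
      rintro ⟨_, r, rfl⟩ hp
      obtain ⟨n, x, y, h1, h2⟩ := (hs _).mp hp
      have h := hC n x y fun ξ => sub_eq_zero.mp (congrFun h1 ξ).symm
      exact (sub_nonneg.mpr h).trans h2)
    (by
      rintro ⟨u, r⟩
      obtain ⟨r', hr'⟩ := exists_mem_squareCone C u.2
      refine ⟨⟨_, r' - r, rfl⟩, (hs _).mpr ?_⟩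
      simpa using hr')
  have hgr : ∀ r : ℝ, g (0, r) = r := fun r => hg ⟨_, r, rfl⟩
  have hsplit : ∀ u r, g (u, r) = g (u, 0) + r := fun u r => by
    rw [← hgr r, ← map_add, Prod.mk_add_mk, add_zero, zero_add, hgr]
  refine ⟨-(g ∘ₗ LinearMap.inl ℝ (squareSpan X) ℝ), fun x => ⟨?_, ?_⟩⟩
  · have h : 0 ≤ g (-⟨_, sq_mem_squareSpan x⟩, -‖x‖ ^ 2) :=
      hgs _ ((hs _).mpr ⟨1, fun _ => 0, fun _ => x, by ext; simp, by simp⟩)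
    rw [hsplit, ← neg_zero, ← Prod.neg_mk, map_neg] at h
    simp only [LinearMap.neg_apply, LinearMap.comp_apply, LinearMap.inl_apply]
    linarith
  · have h : 0 ≤ g (⟨_, sq_mem_squareSpan x⟩, C * ‖x‖ ^ 2) :=
      hgs _ ((hs _).mpr ⟨1, fun _ => x, fun _ => 0, by ext; simp, by simp⟩)
    rw [hsplit] at h
    simp only [LinearMap.neg_apply, LinearMap.comp_apply, LinearMap.inl_apply]
    linarith

theorem isIsomorphicToHilbertSpace_of_sum_sq_domination {C : ℝ}
    (hC : ∀ (n : ℕ) (x y : Fin n → X),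
      (∀ ξ : X →L[ℝ] ℝ, ∑ i, ξ (x i) ^ 2 = ∑ i, ξ (y i) ^ 2) →
        ∑ i, ‖y i‖ ^ 2 ≤ C * ∑ i, ‖x i‖ ^ 2) :
    IsIsomorphicToHilbertSpace X := by
  obtain ⟨q, hq⟩ := exists_linear_on_squareSpan hC
  have hself : ∀ x : X, q ⟨_, mul_mem_squareSpan x x⟩ = q ⟨_, sq_mem_squareSpan x⟩ := fun x => by
    simp only [sq]
  let core : InnerProductSpace.Core ℝ X :=
    { inner := fun x y => q ⟨_, mul_mem_squareSpan x y⟩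
      conj_inner_symm := fun x y => by
        simp only [mul_comm, conj_trivial]
      re_inner_nonneg := fun x => (sq_nonneg ‖x‖).trans ((hq x).1.trans_eq (hself x).symm)
      add_left := fun x y z => by
        rw [← map_add]
        congr 1
        ext ξ
        simp [add_mul]
      smul_left := fun x y r => by
        rw [conj_trivial, ← smul_eq_mul, ← map_smul]
        congr 1
        ext ξ
        simp [mul_assoc]
      definite := fun x hx => by
        have := (hq x).1.trans_eq ((hself x).symm.trans hx)
        exact norm_eq_zero.mp (pow_eq_zero_iff two_ne_zero |>.mp
          (le_antisymm this (sq_nonneg _))) }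
  exact .of_core core (LinearEquiv.refl ℝ X) (fun x => (hq x).1.trans_eq (hself x).symm)
    fun x => (hself x).trans_le (hq x).2

end GramDomination

/-- Proposition 6: a Banach space of Jacobi `(p_n^{(α,β)})`-type 2 is isomorphic to a
Hilbert space. -/
theorem hilbert_of_jacobi_type_two
    {X : Type u} [NormedAddCommGroup X] [NormedSpace ℝ X] [CompleteSpace X]
    (α β : ℝ) (hα : -1 < α) (hβ : -1 < β)
    (J : JacobiSystem α β)
    (c : ℝ) (hc : 0 < c)
    (htype : ∀ m : ℕ, ∀ x : ℕ → X,
      (∫ t in Ioo (-1:ℝ) 1,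
          ‖∑ j ∈ Finset.range (m + 1), (J.P j).eval t • x j‖ ^ 2 * jacobiWeight α β t) ^ ((1:ℝ) / 2)
        ≤ c * (∑ j ∈ Finset.range (m + 1), ‖x j‖ ^ 2) ^ ((1:ℝ) / 2)) :
    IsIsomorphicToHilbertSpace X := by
  exact isIsomorphicToHilbertSpace_of_sum_sq_domination
    (sum_norm_sq_le_of_hartley (K := 12 * c ^ 2) (by positivity)
      fun _ hN x => J.sum_norm_hartley_sq_le hα hβ htype hN x)
end
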